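/- arXiv:math/0603488 — 6 statements merged into one kernel-verified Lean document; each statement's English description precedes it below -/
import Mathlib

section
/- For every odd prime p, Σ_{k=0}^{p-1} C(p-1,k)^5 ≡ 32^{p-1} + (55/12) p^3 B_{p-3} (mod p^4), as a congruence of p-integral rationals. -/
namespace PanFifth
open Polynomial Finset

/-- Splitting a sum over `1..2m` symmetrically. -/
lemma sum_split_refl {M : Type*} [AddCommMonoid M] (f : ℕ → M) (m : ℕ) :
    ∑ j ∈ range (2 * m), f (j + 1) =
      ∑ i ∈ range m, f (i + 1) + ∑ i ∈ range m, f (2 * m + 1 - (i + 1)) := by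
  rw [two_mul, sum_range_add]
  congr 1
  rw [← sum_range_reflect]
  refine sum_congr rfl fun i hi => ?_
  have := mem_range.1 hi
  congr 1; omega

lemma sum_split_par {M : Type*} [AddCommMonoid M] (f : ℕ → M) (m : ℕ) :
    ∑ j ∈ range (2 * m), f (j + 1) =
      ∑ i ∈ range m, f (2 * (i + 1)) + ∑ i ∈ range m, f (2 * m + 1 - 2 * (i + 1)) := by
  have h : ∑ i ∈ range m, f (2 * m + 1 - 2 * (i + 1)) = ∑ i ∈ range m, f (2 * i + 1) := by
    rw [← sum_range_reflect]
    refine sum_congr rfl fun i hi => ?_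
    have := mem_range.1 hi
    congr 1; omega
  rw [h]
  clear h
  induction m with
  | zero => simp
  | succ m ih =>
    rw [show 2 * (m + 1) = 2 * m + 1 + 1 by ring, sum_range_succ, sum_range_succ, ih,
      sum_range_succ, sum_range_succ, show 2 * (m + 1) = 2 * m + 1 + 1 by ring]
    abel

lemma prod_split_refl {M : Type*} [CommMonoid M] (f : ℕ → M) (m : ℕ) :
    ∏ j ∈ range (2 * m), f (j + 1) =
      (∏ i ∈ range m, f (i + 1)) * ∏ i ∈ range m, f (2 * m + 1 - (i + 1)) :=
  sum_split_refl (M := Additive M) f m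

lemma prod_split_par {M : Type*} [CommMonoid M] (f : ℕ → M) (m : ℕ) :
    ∏ j ∈ range (2 * m), f (j + 1) =
      (∏ i ∈ range m, f (2 * (i + 1))) * ∏ i ∈ range m, f (2 * m + 1 - 2 * (i + 1)) :=
  sum_split_par (M := Additive M) f m

variable (p : ℕ) [Fact p.Prime]

/-- the inverse of `j` in the `p`-adic integers -/
noncomputable def rr (j : ℕ) : ℤ_[p] := Ring.inverse (j : ℤ_[p])

/-- generalized harmonic numbers -/
noncomputable def hs (s k : ℕ) : ℤ_[p] := ∑ j ∈ range k, rr p (j + 1) ^ s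

/-- the polynomial with roots `1, ..., k` and constant coefficient `1` -/
noncomputable def EE (k : ℕ) : ℤ_[p][X] := ∏ j ∈ range k, (1 - C (rr p (j + 1)) * X)

variable {p}

lemma isUnit_nat {j : ℕ} (h : ¬ p ∣ j) : IsUnit (j : ℤ_[p]) := by
  rw [PadicInt.isUnit_iff]
  by_contra h1
  have h2 : ‖((j : ℤ) : ℤ_[p])‖ < 1 := by
    push_cast
    exact lt_of_le_of_ne (PadicInt.norm_le_one _) h1
  rw [PadicInt.norm_int_lt_one_iff_dvd] at h2
  exact h (by exact_mod_cast h2)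

lemma rr_mul {j : ℕ} (h0 : 0 < j) (h : j < p) : (j : ℤ_[p]) * rr p j = 1 :=
  Ring.mul_inverse_cancel _ (isUnit_nat (Nat.not_dvd_of_pos_of_lt h0 h))

lemma EE_succ (k : ℕ) : EE p (k + 1) = EE p k * (1 - C (rr p (k + 1)) * X) := by
  simp [EE, prod_range_succ]

lemma hs_succ (s k : ℕ) : hs p s (k + 1) = hs p s k + rr p (k + 1) ^ s := by
  simp [hs, sum_range_succ]

lemma coeff_step (f : ℤ_[p][X]) (r : ℤ_[p]) (n : ℕ) :
    (f * (1 - C r * X)).coeff (n + 1) = f.coeff (n + 1) - r * f.coeff n := by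
  rw [mul_sub, mul_one, coeff_sub, ← mul_assoc, coeff_mul_X, mul_comm f, coeff_C_mul]

lemma EE_coeff (k : ℕ) : (EE p k).coeff 0 = 1 ∧ (EE p k).coeff 1 = - hs p 1 k ∧
    2 * (EE p k).coeff 2 = hs p 1 k ^ 2 - hs p 2 k ∧
    6 * (EE p k).coeff 3 = - (hs p 1 k ^ 3 - 3 * hs p 1 k * hs p 2 k + 2 * hs p 3 k) := by
  induction k with
  | zero => simp [EE, hs, coeff_one]
  | succ k ih =>
    obtain ⟨h0, h1, h2, h3⟩ := ih
    simp only [EE_succ, hs_succ]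
    refine ⟨?_, ?_, ?_, ?_⟩
    · simp [mul_coeff_zero, h0]
    · rw [coeff_step, h0, h1]; ring
    · rw [coeff_step, h1]; linear_combination h2
    · rw [coeff_step]; linear_combination h3 - 3 * rr p (k + 1) * h2

lemma eval_expand (f : ℤ_[p][X]) (z : ℤ_[p]) : ∃ w, f.eval z =
    f.coeff 0 + f.coeff 1 * z + f.coeff 2 * z ^ 2 + f.coeff 3 * z ^ 3 + z ^ 4 * w := by
  have key : ∀ g : ℤ_[p][X], g.eval z = g.divX.eval z * z + g.coeff 0 := fun g => by
    conv_lhs => rw [← divX_mul_X_add g]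
    simp
  refine ⟨f.divX.divX.divX.divX.eval z, ?_⟩
  rw [key f, key f.divX, key f.divX.divX, key f.divX.divX.divX]
  simp only [coeff_divX]
  ring

lemma EE_eval_nat (N : ℕ) {k : ℕ} (hk : k < p) :
    (EE p k).eval ((N : ℤ_[p]) + 1) = (-1) ^ k * (N.choose k : ℤ_[p]) := by
  induction k with
  | zero => simp [EE]
  | succ k ih =>
    have hk' := rr_mul (p := p) (Nat.succ_pos k) hk
    have ih := ih (by omega)
    have hne : ((k + 1 : ℕ) : ℤ_[p]) ≠ 0 := by
      exact_mod_cast Nat.succ_ne_zero k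
    apply mul_left_cancel₀ hne
    have hc : (N.choose (k + 1) : ℤ_[p]) * (k + 1) = (N.choose k : ℤ_[p]) * (N - k) := by
      rcases le_or_gt k N with h | h
      · rw [← Nat.cast_sub h]
        exact_mod_cast Nat.choose_succ_right_eq N k
      · simp [Nat.choose_eq_zero_of_lt h, Nat.choose_eq_zero_of_lt (Nat.lt_succ_of_lt h)]
    rw [EE_succ, eval_mul, ih]
    simp only [eval_sub, eval_one, eval_mul, eval_C, eval_X]
    push_cast at hk' hc ⊢
    simp only [Nat.succ_eq_add_one] at hk'
    linear_combination (-(-1) ^ k * (N.choose k : ℤ_[p]) * (N + 1)) * hk' + (-1) ^ k * hc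

lemma choose_alt (N m : ℕ) : ∑ k ∈ range (2 * m + 1),
    ((-1) ^ k * (N.choose k : ℤ)) * (N.choose (2 * m - k) : ℤ) = (-1) ^ m * N.choose m := by
  have h : ((1 - X : ℤ[X]) ^ N * (1 + X) ^ N).coeff (2 * m) =
      (expand ℤ 2 ((1 - X : ℤ[X]) ^ N)).coeff (2 * m) := by
    congr 1
    rw [← mul_pow]; simp; ring_nf
  have hA : ∀ k, ((1 - X : ℤ[X]) ^ N).coeff k = (-1) ^ k * (N.choose k : ℤ) := by
    intro k
    have : (1 - X : ℤ[X]) ^ N = ((1 + X) ^ N).comp (C (-1) * X) := by simp [sub_eq_add_neg]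
    rw [this, comp_C_mul_X_coeff, coeff_one_add_X_pow, mul_comm]
  rw [coeff_mul, Finset.Nat.sum_antidiagonal_eq_sum_range_succ_mk, mul_comm 2 m,
    coeff_expand_mul (by norm_num), hA] at h
  rw [← h, mul_comm 2 m]
  refine sum_congr rfl fun k _ => ?_
  rw [hA, coeff_one_add_X_pow]

lemma EE_conv {m : ℕ} (hm : 2 * m < p) : ∑ k ∈ range (2 * m + 1),
    (-1) ^ k * EE p k * EE p (2 * m - k) = EE p m := by
  apply Polynomial.eq_of_infinite_eval_eq
  refine Set.Infinite.mono (s := Set.range fun N : ℕ => (N : ℤ_[p]) + 1) ?_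
    (Set.infinite_range_of_injective fun a b h => by simpa using h)
  rintro _ ⟨N, rfl⟩
  simp only [Set.mem_ofPred_eq]
  rw [eval_finsetSum, EE_eval_nat N (by omega)]
  have := congrArg (Int.cast : ℤ → ℤ_[p]) (choose_alt N m)
  push_cast at this
  rw [← this]
  refine sum_congr rfl fun k hk => ?_
  have := mem_range.1 hk
  rw [eval_mul, eval_mul, EE_eval_nat N (by omega), EE_eval_nat N (by omega)]
  have h2 : ((-1 : ℤ_[p]) ^ (2 * m - k)) = (-1) ^ k := by
    have : (-1 : ℤ_[p]) ^ (2 * m - k) * (-1) ^ k = 1 := by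
      rw [← pow_add, Nat.sub_add_cancel (by omega), pow_mul]; simp
    have h3 : ((-1 : ℤ_[p]) ^ k) * (-1) ^ k = 1 := by rw [← mul_pow]; simp
    linear_combination (-1) ^ k * this - (-1) ^ (2 * m - k) * h3
  rw [h2]
  have h3 : ((-1 : ℤ_[p]) ^ k) * (-1) ^ k = 1 := by rw [← mul_pow]; simp
  simp only [eval_pow, eval_neg, eval_one]
  linear_combination ((-1) ^ k * (N.choose k : ℤ_[p]) * (N.choose (2 * m - k) : ℤ_[p])) * h3

lemma norm_nat_le (n : ℕ) : ‖(n : ℚ_[p])‖ ≤ 1 := by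
  simpa using Padic.norm_int_le_one (p := p) (n : ℤ)

lemma integral_bernoulli' (n : ℕ) (hn : n + 1 < p) : ‖((bernoulli' n : ℚ) : ℚ_[p])‖ ≤ 1 := by
  induction n using Nat.strong_induction_on with
  | _ n ih =>
    rw [bernoulli'_def]
    push_cast
    have hs : ‖∑ k ∈ range n, (n.choose k : ℚ_[p]) / ((n : ℚ_[p]) - k + 1) * ((bernoulli' k : ℚ) : ℚ_[p])‖ ≤ 1 := by
      apply IsUltrametricDist.norm_sum_le_of_forall_le_of_nonneg zero_le_one
      intro k hk
      have hk := mem_range.1 hk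
      have e : (n : ℚ_[p]) - k + 1 = ((n - k + 1 : ℕ) : ℚ_[p]) := by
        rw [Nat.cast_add, Nat.cast_sub hk.le]; simp
      have e1 : ‖((n - k + 1 : ℕ) : ℚ_[p])‖ = 1 := by
        rw [Padic.norm_natCast_eq_one_iff]
        exact ((Nat.Prime.coprime_iff_not_dvd Fact.out).2
          (Nat.not_dvd_of_pos_of_lt (by omega) (by omega)))
      rw [norm_mul, norm_div, e, e1, div_one]
      have := ih k hk (by omega)
      have h2 : ‖(n.choose k : ℚ_[p])‖ ≤ 1 := norm_nat_le _
      exact mul_le_one₀ h2 (norm_nonneg _) this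
    rw [sub_eq_add_neg]
    refine (IsUltrametricDist.norm_add_le_max _ _).trans ?_
    simpa using hs

lemma integral_bernoulli (n : ℕ) (hn : n + 1 < p) : ‖((bernoulli n : ℚ) : ℚ_[p])‖ ≤ 1 := by
  have := integral_bernoulli' n hn
  rw [_root_.bernoulli]; push_cast
  simpa using this

lemma sum_pow_bern {s : ℕ} (hs : s + 1 < p) (β : ℤ_[p]) (hβ : (β : ℚ_[p]) = ((bernoulli s : ℚ) : ℚ_[p])) :
    (p : ℤ_[p]) ^ 2 ∣ ∑ k ∈ range p, (k : ℤ_[p]) ^ s - p * β := by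
  rw [← Ideal.mem_span_singleton, ← PadicInt.norm_le_pow_iff_mem_span_pow, PadicInt.norm_def]
  have h := congrArg (Rat.cast : ℚ → ℚ_[p]) (sum_range_pow p s)
  have hs1 : ‖((s + 1 : ℕ) : ℚ_[p])‖ = 1 := by
    rw [Padic.norm_natCast_eq_one_iff]
    exact ((Nat.Prime.coprime_iff_not_dvd Fact.out).2
          (Nat.not_dvd_of_pos_of_lt (by omega) (by omega)))
  have hs0 : ((s : ℚ_[p]) + 1) ≠ 0 := by exact_mod_cast Nat.succ_ne_zero s
  push_cast at h
  rw [PadicInt.coe_sub, PadicInt.coe_sum, PadicInt.coe_mul]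
  simp only [PadicInt.coe_pow, PadicInt.coe_natCast]
  rw [h, sum_range_succ, hβ]
  simp only [Nat.choose_succ_self_right, Nat.add_sub_cancel_left]
  push_cast
  rw [show ((bernoulli s : ℚ) : ℚ_[p]) * (s + 1) * (p : ℚ_[p]) ^ 1 / (s + 1) = p * ((bernoulli s : ℚ) : ℚ_[p]) by
    field_simp]
  rw [add_sub_cancel_right]
  apply IsUltrametricDist.norm_sum_le_of_forall_le_of_nonneg (by positivity)
  intro i hi
  have hi := mem_range.1 hi
  obtain ⟨d, rfl⟩ : ∃ d, s = i + 1 + d := ⟨s - (i + 1), by omega⟩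
  rw [show i + 1 + d + 1 - i = 2 + d by omega, norm_div]
  have e2 : ‖(((i + 1 + d : ℕ) : ℚ_[p]) + 1)‖ = 1 := by exact_mod_cast hs1
  rw [e2, div_one, norm_mul, norm_mul, pow_add, norm_mul, norm_pow (p : ℚ_[p]) 2, Padic.norm_p]
  have a1 := integral_bernoulli (p := p) i (by omega)
  have a2 : ‖((i + 1 + d + 1).choose i : ℚ_[p])‖ ≤ 1 := norm_nat_le _
  have a3 : ‖(p : ℚ_[p]) ^ d‖ ≤ 1 := by
    rw [← Nat.cast_pow]; exact norm_nat_le _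
  have a4 : ((p : ℝ)⁻¹) ^ 2 = (p : ℝ) ^ (-(2 : ℕ) : ℤ) := by simp [zpow_neg]
  rw [a4]
  have a5 : 0 ≤ (p : ℝ) ^ (-(2 : ℕ) : ℤ) := by positivity
  calc _ ≤ 1 * 1 * ((p : ℝ) ^ (-(2 : ℕ) : ℤ) * 1) := by gcongr
    _ = _ := by ring

lemma toZMod_eq_zero {x : ℤ_[p]} : PadicInt.toZMod x = 0 ↔ (p : ℤ_[p]) ∣ x := by
  rw [← RingHom.mem_ker, PadicInt.ker_toZMod, PadicInt.maximalIdeal_eq_span_p,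
    Ideal.mem_span_singleton]

lemma nat_ne_zero {j : ℕ} (h : ¬ p ∣ j) : (j : ZMod p) ≠ 0 := by
  rwa [Ne, ZMod.natCast_eq_zero_iff]

lemma two_ne (hp5 : 5 ≤ p) : (2 : ZMod p) ≠ 0 := by
  exact_mod_cast nat_ne_zero (p := p) (j := 2) (Nat.not_dvd_of_pos_of_lt (by omega) (by omega))

lemma three_ne (hp5 : 5 ≤ p) : (3 : ZMod p) ≠ 0 := by
  exact_mod_cast nat_ne_zero (p := p) (j := 3) (Nat.not_dvd_of_pos_of_lt (by omega) (by omega))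

/-- reduction mod `p` of the inverse -/
noncomputable def rz (p : ℕ) [Fact p.Prime] (j : ℕ) : ZMod p := PadicInt.toZMod (rr p j)

/-- reduction mod `p` of the harmonic number -/
noncomputable def hz (p : ℕ) [Fact p.Prime] (s j : ℕ) : ZMod p := PadicInt.toZMod (hs p s j)

lemma hz_eq (s k : ℕ) : hz p s k = ∑ j ∈ range k, rz p (j + 1) ^ s := by
  simp [hz, hs, rz, map_sum, map_pow]

lemma rz_mul {j : ℕ} (h0 : 0 < j) (h : j < p) : (j : ZMod p) * rz p j = 1 := by
  have := congrArg PadicInt.toZMod (rr_mul h0 h)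
  simpa [rz] using this

lemma rz_refl {j : ℕ} (h0 : 0 < j) (h : j < p) : rz p (p - j) = - rz p j := by
  have h1 := rz_mul h0 h
  have h2 := rz_mul (p := p) (j := p - j) (by omega) (by omega)
  rw [Nat.cast_sub h.le, ZMod.natCast_self] at h2
  linear_combination -rz p (p - j) * h1 - rz p j * h2

lemma hz_refl {m : ℕ} (hp : p = 2 * m + 1) (s k : ℕ) (hk : k ≤ 2 * m) :
    hz p s (2 * m - k) = hz p s (2 * m) - (-1) ^ s * hz p s k := by
  induction k with
  | zero => simp [hz_eq]
  | succ k ih =>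
    have ih := ih (by omega)
    have e1 : hz p s (2 * m - k) = hz p s (2 * m - (k + 1)) + rz p (p - (k + 1)) ^ s := by
      rw [hz_eq, hz_eq, show 2 * m - k = 2 * m - (k + 1) + 1 by omega, sum_range_succ]
      congr 3; omega
    have e2 : hz p s (k + 1) = hz p s k + rz p (k + 1) ^ s := by
      rw [hz_eq, hz_eq, sum_range_succ]
    rw [rz_refl (by omega) (by omega), neg_pow] at e1
    rw [e2]
    linear_combination ih - e1

lemma hz_odd {m : ℕ} (hp5 : 5 ≤ p) (hp : p = 2 * m + 1) (s : ℕ) (hs : Odd s) :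
    hz p s (2 * m) = 0 := by
  have := hz_refl hp s (2 * m) le_rfl
  rw [hs.neg_one_pow] at this
  simp only [Nat.sub_self] at this
  have h0 : hz p s 0 = 0 := by simp [hz_eq]
  rw [h0] at this
  have h2 : 2 * hz p s (2 * m) = 0 := by linear_combination -this
  exact (mul_eq_zero.1 h2).resolve_left (two_ne hp5)

lemma inv_sq {P J a b : ℤ_[p]} (h1 : J * a = 1) (h2 : (P - J) * b = 1) :
    ∃ c, b ^ 2 = a ^ 2 + 2 * P * a ^ 3 + P ^ 2 * c := by
  have hb : b = -a - P * a ^ 2 + P ^ 2 * (a ^ 2 * b) := by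
    have h3 : b = -a + P * a * b := by linear_combination -b * h1 - a * h2
    linear_combination (1 + P * a) * h3
  refine ⟨a ^ 4 - 2 * a * (a ^ 2 * b) - 2 * P * a ^ 2 * (a ^ 2 * b)
    + P ^ 2 * (a ^ 2 * b) ^ 2, ?_⟩
  linear_combination (b + (-a - P * a ^ 2 + P ^ 2 * (a ^ 2 * b))) * hb

lemma rr_two_mul {i : ℕ} (h0 : 0 < i) (h : 2 * i < p) : rr p (2 * i) = rr p 2 * rr p i := by
  have h1 := rr_mul (p := p) (j := 2 * i) (by omega) h
  have h2 := rr_mul (p := p) (j := 2) (by omega) (by omega)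
  have h3 := rr_mul (p := p) (j := i) (by omega) (by omega)
  push_cast at h1 h2
  linear_combination -rr p (2 * i) * h2 - rr p (2 * i) * 2 * rr p 2 * h3 + rr p 2 * rr p i * h1

lemma hs_two_A {m : ℕ} (hp : p = 2 * m + 1) :
    (p : ℤ_[p]) ^ 2 ∣ hs p 2 (2 * m) - (2 * hs p 2 m + 2 * p * hs p 3 m) := by
  have e : hs p 2 (2 * m) - (2 * hs p 2 m + 2 * p * hs p 3 m) = ∑ i ∈ range m,
      (rr p (2 * m + 1 - (i + 1)) ^ 2 - (rr p (i + 1) ^ 2 + 2 * p * rr p (i + 1) ^ 3)) := by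
    rw [sum_sub_distrib, sum_add_distrib, ← mul_sum, hs,
      sum_split_refl (fun j => rr p j ^ 2) m]
    simp only [hs]; ring
  rw [e]
  refine dvd_sum fun i hi => ?_
  have hi := mem_range.1 hi
  have h1 := rr_mul (p := p) (j := i + 1) (by omega) (by omega)
  have h2 := rr_mul (p := p) (j := p - (i + 1)) (by omega) (by omega)
  rw [Nat.cast_sub (by omega)] at h2
  obtain ⟨c, hc⟩ := inv_sq h1 h2
  refine ⟨c, ?_⟩
  rw [← hp]
  linear_combination hc

lemma hs_two_B {m : ℕ} (hp : p = 2 * m + 1) :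
    (p : ℤ_[p]) ^ 2 ∣ hs p 2 (2 * m) -
      (2 * rr p 2 ^ 2 * hs p 2 m + 2 * p * rr p 2 ^ 3 * hs p 3 m) := by
  have e : hs p 2 (2 * m) - (2 * rr p 2 ^ 2 * hs p 2 m + 2 * p * rr p 2 ^ 3 * hs p 3 m) =
      ∑ i ∈ range m,
      (rr p (2 * m + 1 - 2 * (i + 1)) ^ 2 - (rr p (2 * (i + 1)) ^ 2
        + 2 * p * rr p (2 * (i + 1)) ^ 3)) := by
    have e2 : ∀ s, ∑ i ∈ range m, rr p (2 * (i + 1)) ^ s = rr p 2 ^ s * hs p s m := by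
      intro s
      rw [hs, mul_sum]
      refine sum_congr rfl fun i hi => ?_
      have hi := mem_range.1 hi
      rw [rr_two_mul (by omega) (by omega), mul_pow]
    rw [sum_sub_distrib, sum_add_distrib, ← mul_sum, hs,
      sum_split_par (fun j => rr p j ^ 2) m, e2, e2]
    ring
  rw [e]
  refine dvd_sum fun i hi => ?_
  have hi := mem_range.1 hi
  have h1 := rr_mul (p := p) (j := 2 * (i + 1)) (by omega) (by omega)
  have h2 := rr_mul (p := p) (j := p - 2 * (i + 1)) (by omega) (by omega)
  rw [Nat.cast_sub (by omega)] at h2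
  obtain ⟨c, hc⟩ := inv_sq h1 h2
  refine ⟨c, ?_⟩
  rw [← hp]
  linear_combination hc

lemma hs_two_rel {m : ℕ} (hp5 : 5 ≤ p) (hp : p = 2 * m + 1) :
    (p : ℤ_[p]) ^ 2 ∣ 6 * hs p 2 m + 7 * p * hs p 3 m := by
  obtain ⟨x, hx⟩ := hs_two_A hp
  obtain ⟨y, hy⟩ := hs_two_B hp
  have h2 := rr_mul (p := p) (j := 2) (by omega) (by omega)
  push_cast at h2
  have h4 : 4 * rr p 2 ^ 2 = 1 := by linear_combination (2 * rr p 2 + 1) * h2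
  have h8 : 8 * rr p 2 ^ 3 = 1 := by linear_combination (4 * rr p 2 ^ 2 + 2 * rr p 2 + 1) * h2
  refine ⟨4 * (y - x), ?_⟩
  linear_combination 4 * hy - 4 * hx + 2 * hs p 2 m * h4 + p * hs p 3 m * h8

lemma hz_two_half {m : ℕ} (hp5 : 5 ≤ p) (hp : p = 2 * m + 1) : hz p 2 m = 0 := by
  obtain ⟨x, hx⟩ := hs_two_rel hp5 hp
  have := congrArg PadicInt.toZMod hx
  simp only [map_add, map_mul, map_pow, map_natCast, map_ofNat, ZMod.natCast_self] at this
  have h2 : (2 * 3) * hz p 2 m = 0 := by rw [hz]; linear_combination this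
  exact (mul_eq_zero.1 h2).resolve_left (mul_ne_zero (two_ne hp5) (three_ne hp5))

lemma hz_two {m : ℕ} (hp5 : 5 ≤ p) (hp : p = 2 * m + 1) : hz p 2 (2 * m) = 0 := by
  obtain ⟨x, hx⟩ := hs_two_A hp
  have := congrArg PadicInt.toZMod hx
  simp only [map_add, map_sub, map_mul, map_pow, map_natCast, map_ofNat, ZMod.natCast_self] at this
  have h := hz_two_half hp5 hp
  rw [hz] at h ⊢
  linear_combination this + 2 * h

lemma alt_sum (n : ℕ) : 2 * ∑ k ∈ range (n + 1), (-1) ^ k * hz p 3 k =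
    (-1) ^ n * hz p 3 n + ∑ j ∈ range n, (-1) ^ (j + 1) * rz p (j + 1) ^ 3 := by
  induction n with
  | zero => simp [hz_eq]
  | succ n ih =>
    have e2 : hz p 3 (n + 1) = hz p 3 n + rz p (n + 1) ^ 3 := by
      rw [hz_eq, hz_eq, sum_range_succ]
    rw [sum_range_succ, mul_add, ih, sum_range_succ (n := n), e2]
    ring

lemma alt_three {m : ℕ} (hp5 : 5 ≤ p) (hp : p = 2 * m + 1) :
    8 * ∑ k ∈ range (2 * m + 1), (-1) ^ k * hz p 3 k = hz p 3 m := by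
  have h := alt_sum (p := p) (2 * m)
  rw [hz_odd hp5 hp 3 (by decide), sum_split_par (fun j => (-1) ^ j * rz p j ^ 3) m] at h
  have h2 := congrArg PadicInt.toZMod (rr_mul (p := p) (j := 2) (by omega) (by omega))
  simp only [map_mul, map_one, map_natCast] at h2
  push_cast at h2
  change 2 * rz p 2 = 1 at h2
  have e : ∀ i ∈ range m, (-1) ^ (2 * (i + 1)) * rz p (2 * (i + 1)) ^ 3 =
      rz p 2 ^ 3 * rz p (i + 1) ^ 3 := by
    intro i hi
    have hi := mem_range.1 hi
    rw [rz, rr_two_mul (by omega) (by omega), pow_mul]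
    simp [rz, mul_pow]
  have e' : ∀ i ∈ range m, (-1) ^ (2 * m + 1 - 2 * (i + 1)) * rz p (2 * m + 1 - 2 * (i + 1)) ^ 3 =
      rz p 2 ^ 3 * rz p (i + 1) ^ 3 := by
    intro i hi
    rw [← e i hi]
    have hi := mem_range.1 hi
    rw [Odd.neg_one_pow ⟨m - (i + 1), by omega⟩, Even.neg_one_pow ⟨i + 1, by omega⟩, ← hp,
      rz_refl (by omega) (by omega)]
    ring
  rw [sum_congr rfl e, sum_congr rfl e', ← mul_sum, ← hz_eq] at h
  have h8 : 8 * rz p 2 ^ 3 = 1 := by linear_combination (4 * rz p 2 ^ 2 + 2 * rz p 2 + 1) * h2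
  linear_combination 4 * h + hz p 3 m * h8

lemma cube_sum {m : ℕ} (hp5 : 5 ≤ p) (hp : p = 2 * m + 1) :
    16 * ∑ k ∈ range (2 * m + 1), (-1) ^ k * hz p 1 k ^ 3 = 2 * hz p 1 m ^ 3 + 3 * hz p 3 m := by
  have h := congrArg (fun f => PadicInt.toZMod (f.coeff 3)) (EE_conv (p := p) (m := m) (by omega))
  simp only [finsetSum_coeff, map_sum] at h
  have e : ∀ k ∈ range (2 * m + 1), 6 * PadicInt.toZMod
      (((-1) ^ k * EE p k * EE p (2 * m - k)).coeff 3) =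
      -(8 * ((-1) ^ k * hz p 1 k ^ 3) + 4 * ((-1) ^ k * hz p 3 k)) := by
    intro k hk
    have hk := mem_range.1 hk
    have e0 : ((-1) ^ k * EE p k * EE p (2 * m - k)).coeff 3 =
        (-1) ^ k * (EE p k * EE p (2 * m - k)).coeff 3 := by
      rw [← coeff_C_mul]; simp [mul_assoc]
    rw [e0, coeff_mul]
    simp only [Finset.Nat.sum_antidiagonal_eq_sum_range_succ_mk, sum_range_succ, range_zero,
      sum_empty, Nat.sub_zero, Nat.succ_eq_add_one, Nat.reduceAdd, Nat.reduceSub, zero_add]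
    obtain ⟨a0, a1, a2, a3⟩ := EE_coeff (p := p) k
    obtain ⟨b0, b1, b2, b3⟩ := EE_coeff (p := p) (2 * m - k)
    have a2 := congrArg PadicInt.toZMod a2
    have a3 := congrArg PadicInt.toZMod a3
    have b2 := congrArg PadicInt.toZMod b2
    have b3 := congrArg PadicInt.toZMod b3
    rw [a0, a1, b0, b1]
    simp only [map_add, map_sub, map_mul, map_pow, map_neg, map_one, map_ofNat] at a2 a3 b2 b3 ⊢
    simp only [← hz.eq_def] at a2 a3 b2 b3 ⊢
    have r1 := hz_refl hp 1 k (by omega)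
    have r2 := hz_refl hp 2 k (by omega)
    have r3 := hz_refl hp 3 k (by omega)
    rw [hz_odd hp5 hp 1 (by decide)] at r1
    rw [hz_two hp5 hp] at r2
    rw [hz_odd hp5 hp 3 (by decide)] at r3
    rw [r1, r2, r3] at b3
    rw [r1, r2] at b2
    rw [r1]
    linear_combination (-1) ^ k * (a3 + b3 - 3 * hz p 1 k * (a2 + b2))
  have h6 := congrArg (fun x => 6 * x) h
  simp only [mul_sum] at h6
  rw [sum_congr rfl e] at h6
  have c3 := congrArg PadicInt.toZMod (EE_coeff (p := p) m).2.2.2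
  simp only [map_add, map_sub, map_mul, map_pow, map_neg, map_one, map_ofNat] at c3
  simp only [← hz.eq_def] at c3
  rw [c3, sum_neg_distrib, sum_add_distrib, ← mul_sum, ← mul_sum, hz_two_half hp5 hp] at h6
  linear_combination -2 * h6 - alt_three hp5 hp

lemma pow_expand (P x : ℤ_[p]) (e : ℕ) : ∃ c, (P - x) ^ (e + 1) =
    (-1) ^ (e + 1) * (x ^ (e + 1) - (e + 1) * P * x ^ e) + P ^ 2 * c := by
  induction e with
  | zero => exact ⟨0, by simp⟩
  | succ e ih =>
    obtain ⟨c, hc⟩ := ih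
    refine ⟨(-1) ^ (e + 2) * (e + 1) * x ^ e + (P - x) * c, ?_⟩
    rw [pow_succ, hc]
    push_cast
    ring

/-- The link between the half-sum of inverse cubes and the Bernoulli number. -/
lemma hz_three_bern {m : ℕ} (hp5 : 5 ≤ p) (hp : p = 2 * m + 1) (β : ℤ_[p])
    (hβ : (β : ℚ_[p]) = ((_root_.bernoulli (p - 3) : ℚ) : ℚ_[p])) :
    hz p 3 m = -2 * PadicInt.toZMod β := by
  obtain ⟨n, rfl⟩ : ∃ n, m = n + 2 := ⟨m - 2, by omega⟩
  obtain ⟨g, hg⟩ := sum_pow_bern (p := p) (s := p - 3) (by omega) β hβ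
  set m := n + 2 with hm
  rw [show p - 3 = 2 * n + 1 + 1 by omega] at hg
  set G := ∑ k ∈ range p, (k : ℤ_[p]) ^ (2 * n + 1 + 1) with hG
  have hG' : G = ∑ j ∈ range (2 * m), ((j + 1 : ℕ) : ℤ_[p]) ^ (2 * n + 1 + 1) := by
    rw [hG, show range p = range (2 * m + 1) by rw [← hp], sum_range_succ']
    simp
  set Gm := ∑ i ∈ range m, ((i + 1 : ℕ) : ℤ_[p]) ^ (2 * n + 1 + 1) with hGm
  set W := ∑ i ∈ range m, ((i + 1 : ℕ) : ℤ_[p]) ^ (2 * n + 1) with hW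
  have ev : (-1 : ℤ_[p]) ^ (2 * n + 1 + 1) = 1 := Even.neg_one_pow ⟨n + 1, by ring⟩
  have A : (p : ℤ_[p]) ^ 2 ∣ G - (2 * Gm - (2 * n + 2) * p * W) := by
    have e : G - (2 * Gm - (2 * n + 2) * p * W) = ∑ i ∈ range m,
        (((2 * m + 1 - (i + 1) : ℕ) : ℤ_[p]) ^ (2 * n + 1 + 1) -
          (((i + 1 : ℕ) : ℤ_[p]) ^ (2 * n + 1 + 1) -
            (2 * n + 2) * p * ((i + 1 : ℕ) : ℤ_[p]) ^ (2 * n + 1))) := by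
      rw [sum_sub_distrib, sum_sub_distrib, ← mul_sum, hG',
        sum_split_refl (fun j => ((j : ℕ) : ℤ_[p]) ^ (2 * n + 1 + 1)) m]
      ring
    rw [e]
    refine dvd_sum fun i hi => ?_
    have hi := mem_range.1 hi
    obtain ⟨c, hc⟩ := pow_expand (p := p) p ((i + 1 : ℕ) : ℤ_[p]) (2 * n + 1)
    refine ⟨c, ?_⟩
    rw [← hp, Nat.cast_sub (by omega), hc, ev]
    push_cast
    ring
  have B : (p : ℤ_[p]) ^ 2 ∣ G - (2 * 2 ^ (2 * n + 2) * Gm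
      - (2 * n + 2) * p * 2 ^ (2 * n + 1) * W) := by
    have e : G - (2 * 2 ^ (2 * n + 2) * Gm - (2 * n + 2) * p * 2 ^ (2 * n + 1) * W)
      = ∑ i ∈ range m,
        (((2 * m + 1 - 2 * (i + 1) : ℕ) : ℤ_[p]) ^ (2 * n + 1 + 1) -
          (2 ^ (2 * n + 2) * ((i + 1 : ℕ) : ℤ_[p]) ^ (2 * n + 1 + 1) -
            (2 * n + 2) * p * 2 ^ (2 * n + 1) * ((i + 1 : ℕ) : ℤ_[p]) ^ (2 * n + 1))) := by
      have e1 : ∑ i ∈ range m, ((2 * (i + 1) : ℕ) : ℤ_[p]) ^ (2 * n + 1 + 1) =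
          2 ^ (2 * n + 2) * Gm := by
        rw [hGm, mul_sum]
        refine sum_congr rfl fun i _ => ?_
        rw [Nat.cast_mul, mul_pow]; simp
      rw [sum_sub_distrib, sum_sub_distrib, ← mul_sum, ← mul_sum, hG',
        sum_split_par (fun j => ((j : ℕ) : ℤ_[p]) ^ (2 * n + 1 + 1)) m, e1]
      ring
    rw [e]
    refine dvd_sum fun i hi => ?_
    have hi := mem_range.1 hi
    obtain ⟨c, hc⟩ := pow_expand (p := p) p ((2 * (i + 1) : ℕ) : ℤ_[p]) (2 * n + 1)
    refine ⟨c, ?_⟩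
    rw [← hp, Nat.cast_sub (by omega), hc, ev, Nat.cast_mul, mul_pow, mul_pow]
    push_cast
    ring
  obtain ⟨x, hx⟩ := A
  obtain ⟨y, hy⟩ := B
  have hp0 : (p : ℤ_[p]) ≠ 0 := by
    exact_mod_cast (Fact.out : p.Prime).ne_zero
  have key : (2 ^ (2 * n + 2) - 1) * β + (2 * n + 2) * 2 ^ (2 * n + 1) * W =
      p * (2 ^ (2 * n + 2) * x - y - (2 ^ (2 * n + 2) - 1) * g) := by
    apply mul_left_cancel₀ hp0
    linear_combination 2 ^ (2 * n + 2) * hx - hy - (2 ^ (2 * n + 2) - 1) * hg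
  have kz := congrArg PadicInt.toZMod key
  simp only [map_add, map_sub, map_mul, map_pow, map_natCast, map_ofNat, map_one,
    ZMod.natCast_self] at kz
  have fer : ∀ {j : ℕ}, 0 < j → j < p → ((j : ZMod p)) ^ (2 * n + 1) * (j : ZMod p) ^ 3 = 1 := by
    intro j h0 hj
    rw [← pow_add, show 2 * n + 1 + 3 = p - 1 by omega]
    exact ZMod.pow_card_sub_one_eq_one (nat_ne_zero (Nat.not_dvd_of_pos_of_lt h0 hj))
  have hWz : PadicInt.toZMod W = hz p 3 m := by
    rw [hW, map_sum, hz_eq]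
    refine sum_congr rfl fun i hi => ?_
    have hi := mem_range.1 hi
    have h1 := fer (j := i + 1) (by omega) (by omega)
    have h2 := rz_mul (p := p) (j := i + 1) (by omega) (by omega)
    rw [map_pow, map_natCast]
    have h3 : ((i + 1 : ℕ) : ZMod p) ^ 3 * rz p (i + 1) ^ 3 = 1 := by
      rw [← mul_pow, h2, one_pow]
    linear_combination rz p (i + 1) ^ 3 * h1 - ((i + 1 : ℕ) : ZMod p) ^ (2 * n + 1) * h3
  have f2 := fer (j := 2) (by omega) (by omega)
  push_cast at f2
  have hn : (2 * n + 5 : ZMod p) = 0 := by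
    have : ((2 * n + 5 : ℕ) : ZMod p) = 0 := by
      rw [show 2 * n + 5 = p by omega]; simp
    exact_mod_cast this
  rw [hWz] at kz
  have : 3 * (hz p 3 m + 2 * PadicInt.toZMod β) = 0 := by
    have e : (2 : ZMod p) ^ (2 * n + 2) = 2 ^ (2 * n + 1) * 2 := by ring
    rw [e] at kz
    linear_combination -8 * kz + (2 * PadicInt.toZMod β + (2 * n + 2) * hz p 3 m) * f2
      + hz p 3 m * hn
  have := (mul_eq_zero.1 this).resolve_left (three_ne hp5)
  linear_combination this

lemma eval_half {m : ℕ} (hp5 : 5 ≤ p) (hp : p = 2 * m + 1) :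
    (EE p m).eval (p : ℤ_[p]) = 2 ^ (2 * m) * (EE p m).eval ((p : ℤ_[p]) * rr p 2) := by
  set Q : ℤ_[p] := ∏ i ∈ range m, ((i + 1 : ℕ) : ℤ_[p]) with hQ
  set D1 : ℤ_[p] := ∏ i ∈ range m, ((p - (i + 1) : ℕ) : ℤ_[p]) with hD1
  set D2 : ℤ_[p] := ∏ i ∈ range m, ((p - 2 * (i + 1) : ℕ) : ℤ_[p]) with hD2
  have hQ0 : Q ≠ 0 := by
    rw [hQ, prod_ne_zero_iff]
    intro i _
    exact_mod_cast Nat.succ_ne_zero i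
  have h2 := rr_mul (p := p) (j := 2) (by omega) (by omega)
  push_cast at h2
  have e1 : ∏ i ∈ range m, ((2 * (i + 1) : ℕ) : ℤ_[p]) = 2 ^ m * Q := by
    simp [hQ, prod_mul_distrib]
  have hD : Q * D1 = 2 ^ m * Q * D2 := by
    rw [← e1, hQ, hD1, hD2]
    have a := prod_split_refl (fun j => (j : ℤ_[p])) m
    have b := prod_split_par (fun j => (j : ℤ_[p])) m
    rw [← hp] at a b
    rw [← a, ← b]
  have hA : Q * (EE p m).eval (p : ℤ_[p]) = (-1) ^ m * D1 := by
    have : ((-1 : ℤ_[p])) ^ m = ∏ i ∈ range m, (-1) := by simp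
    rw [EE, eval_prod, hQ, hD1, this, ← prod_mul_distrib, ← prod_mul_distrib]
    refine prod_congr rfl fun i hi => ?_
    have hi := mem_range.1 hi
    have h1 := rr_mul (p := p) (j := i + 1) (by omega) (by omega)
    rw [Nat.cast_sub (by omega)]
    simp only [eval_sub, eval_one, eval_mul, eval_C, eval_X]
    linear_combination -(p : ℤ_[p]) * h1
  have hB : 2 ^ m * Q * (EE p m).eval ((p : ℤ_[p]) * rr p 2) = (-1) ^ m * D2 := by
    have : ((-1 : ℤ_[p])) ^ m = ∏ i ∈ range m, (-1) := by simp
    rw [← e1, EE, eval_prod, hD2, this, ← prod_mul_distrib, ← prod_mul_distrib]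
    refine prod_congr rfl fun i hi => ?_
    have hi := mem_range.1 hi
    have h1 := rr_mul (p := p) (j := i + 1) (by omega) (by omega)
    rw [Nat.cast_sub (by omega)]
    simp only [eval_sub, eval_one, eval_mul, eval_C, eval_X]
    push_cast at h1 ⊢
    linear_combination -(p : ℤ_[p]) * h1 - (p : ℤ_[p]) * (i + 1) * rr p (i + 1) * h2
  apply mul_left_cancel₀ hQ0
  apply mul_left_cancel₀ hQ0
  have e4 : (2 : ℤ_[p]) ^ (2 * m) = 2 ^ m * 2 ^ m := by rw [two_mul, pow_add]
  rw [e4]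
  linear_combination Q * hA - 2 ^ m * Q * hB + (-1) ^ m * hD

/-- Carlitz' refinement of Morley's congruence, and the Fermat quotient. -/
lemma morley {m : ℕ} (hp5 : 5 ≤ p) (hp : p = 2 * m + 1) :
    (p : ℤ_[p]) ^ 4 ∣ 24 * ((EE p m).eval (p : ℤ_[p]) - (2 ^ (2 * m)) ^ 2) + p ^ 3 * hs p 3 m ∧
    ∃ q z : ℤ_[p], 2 ^ (2 * m) = 1 + p * q ∧ 2 * q + hs p 1 m = p * z := by
  obtain ⟨v, hv⟩ := hs_two_rel hp5 hp
  have hr := rr_mul (p := p) (j := 2) (by omega) (by omega)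
  push_cast at hr
  have hT := eval_half hp5 hp
  obtain ⟨u, hu⟩ := eval_expand (EE p m) (p : ℤ_[p])
  obtain ⟨u', hu'⟩ := eval_expand (EE p m) ((p : ℤ_[p]) * rr p 2)
  obtain ⟨a0, a1, hc2, hc3⟩ := EE_coeff (p := p) m
  rw [a0, a1] at hu hu'
  have hp0 : (p : ℤ_[p]) ≠ 0 := by
    exact_mod_cast (Fact.out : p.Prime).ne_zero
  generalize (EE p m).eval ((p : ℤ_[p]) * rr p 2) = f' at *
  generalize (EE p m).eval (p : ℤ_[p]) = f at *
  generalize (EE p m).coeff 2 = c2 at *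
  generalize (EE p m).coeff 3 = c3 at *
  generalize hs p 1 m = h1 at *
  generalize hs p 2 m = h2 at *
  generalize hs p 3 m = h3 at *
  generalize (2 : ℤ_[p]) ^ (2 * m) = T at *
  generalize rr p 2 = r at *
  generalize (p : ℤ_[p]) = P at *
  have hr2 : 4 * r ^ 2 = 1 := by linear_combination (2 * r + 1) * hr
  have hr3 : 8 * r ^ 3 = 1 := by linear_combination (4 * r ^ 2 + 2 * r + 1) * hr
  obtain ⟨U, hU⟩ : ∃ U, f' = (1 - h1 * (P * r) + c2 * P ^ 2 * r ^ 2 + c3 * P ^ 3 * r ^ 3)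
      + P ^ 4 * U := ⟨r ^ 4 * u', by rw [hu']; ring⟩
  obtain ⟨V, hV⟩ : ∃ V, f' = 1 - h1 * (P * r) + P ^ 2 * V :=
    ⟨c2 * r ^ 2 + c3 * P * r ^ 3 + P ^ 2 * U, by rw [hU]; ring⟩
  obtain ⟨V2, hV2⟩ : ∃ V, f = 1 - h1 * P + P ^ 2 * V :=
    ⟨c2 + c3 * P + P ^ 2 * u, by rw [hu]; ring⟩
  have cop : IsCoprime P f' := ⟨h1 * r - P * V, 1, by rw [hV]; ring⟩
  obtain ⟨c, hc⟩ : ∃ c, 24 * (f' ^ 2 - f) = - P ^ 3 * h3 + P ^ 4 * c := by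
    refine ⟨24 * (c2 ^ 2 * r ^ 4 - 2 * h1 * c3 * r ^ 4 + 2 * P * c2 * c3 * r ^ 5
      + P ^ 2 * c3 ^ 2 * r ^ 6) + v + 7 * h1 * h3 - P * h1 * v
      + 24 * (2 * (1 - h1 * (P * r) + c2 * P ^ 2 * r ^ 2 + c3 * P ^ 3 * r ^ 3) * U
        + P ^ 4 * U ^ 2 - u), ?_⟩
    rw [hU, hu]
    linear_combination -24 * h1 * P * hr + 6 * P ^ 2 * (h1 ^ 2 + 2 * c2) * hr2
      + 3 * P ^ 3 * (2 * c3 - 2 * h1 * c2) * hr3 - 6 * P ^ 2 * hc2 - 3 * P ^ 3 * hc3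
      - 3 * P ^ 3 * h1 * hc2 + (P ^ 2 - P ^ 3 * h1) * hv
  constructor
  · have cop2 : IsCoprime (P ^ 4) (f' ^ 2) := cop.pow
    apply cop2.dvd_of_dvd_mul_right
    obtain ⟨d, hd⟩ : ∃ d, f' ^ 2 - f = P * d := by
      refine ⟨-2 * h1 * r + 2 * P * V + P * (-(h1 * r) + P * V) ^ 2 + h1 - P * V2, ?_⟩
      rw [hV, hV2]; ring
    refine ⟨h3 * d + c * f, ?_⟩
    linear_combination f * hc + P ^ 3 * h3 * hd + 24 * (f + T * f') * hT
  · obtain ⟨q, hq⟩ : P ∣ T - 1 := by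
      apply cop.dvd_of_dvd_mul_right
      refine ⟨-h1 + P * V2 + h1 * r - P * V, ?_⟩
      linear_combination -hT + hV2 - hV
    refine ⟨q, 2 * V2 - 2 * (V + q * V * P - q * h1 * r), by linear_combination hq, ?_⟩
    apply mul_left_cancel₀ hp0
    rw [hV, hV2] at hT
    have hq' : T = 1 + P * q := by linear_combination hq
    rw [hq'] at hT
    linear_combination -2 * hT + h1 * P * hr

lemma alt_one (m : ℕ) : ∑ k ∈ range (2 * m + 1), (-1 : ℤ_[p]) ^ k = 1 := by
  induction m with
  | zero => simp
  | succ m ih =>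
    rw [show 2 * (m + 1) + 1 = 2 * m + 1 + 1 + 1 by ring, sum_range_succ, sum_range_succ, ih]
    ring

lemma main_cong {m : ℕ} (hp5 : 5 ≤ p) (hp : p = 2 * m + 1) (β : ℤ_[p])
    (hβ : (β : ℚ_[p]) = ((_root_.bernoulli (p - 3) : ℚ) : ℚ_[p])) :
    (p : ℤ_[p]) ^ 4 ∣ 24 * (∑ k ∈ range (2 * m + 1), ((2 * m).choose k : ℤ_[p]) ^ 5)
      - 24 * (2 ^ (2 * m)) ^ 5 - 110 * p ^ 3 * β := by
  have sq1 : ∀ k : ℕ, ((-1 : ℤ_[p]) ^ k) * (-1) ^ k = 1 := fun k => by rw [← mul_pow]; simp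
  have hP : ((2 * m : ℕ) : ℤ_[p]) + 1 = p := by
    rw [← Nat.cast_succ]; congr 1; exact hp.symm
  set x : ℕ → ℤ_[p] := fun k => (EE p k).eval (p : ℤ_[p]) with hx
  have hxk : ∀ k ∈ range (2 * m + 1), x k = (-1) ^ k * ((2 * m).choose k : ℤ_[p]) := by
    intro k hk
    have hk := mem_range.1 hk
    rw [hx, ← EE_eval_nat (2 * m) (by omega), hP]
  have f1 : ∑ k ∈ range (2 * m + 1), (-1) ^ k * x k = 2 ^ (2 * m) := by
    have : ((∑ k ∈ range (2 * m + 1), (2 * m).choose k : ℕ) : ℤ_[p]) = 2 ^ (2 * m) := by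
      rw [Nat.sum_range_choose]; simp
    rw [← this, Nat.cast_sum]
    refine sum_congr rfl fun k hk => ?_
    rw [hxk k hk, ← mul_assoc, sq1, one_mul]
  have f2 : ∑ k ∈ range (2 * m + 1), (-1) ^ k * x k ^ 2 = (EE p m).eval (p : ℤ_[p]) := by
    rw [← EE_conv (by omega), eval_finsetSum]
    refine sum_congr rfl fun k hk => ?_
    have hk' := mem_range.1 hk
    have hsym : x (2 * m - k) = x k := by
      rw [hxk _ hk, hxk _ (mem_range.2 (by omega)), Nat.choose_symm (by omega)]
      congr 1
      have : (-1 : ℤ_[p]) ^ (2 * m - k) * (-1) ^ k = 1 := by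
        rw [← pow_add, Nat.sub_add_cancel (by omega), pow_mul]; simp
      linear_combination (-1) ^ k * this - (-1) ^ (2 * m - k) * sq1 k
    simp only [eval_mul, eval_pow, eval_neg, eval_one]
    change _ = (-1) ^ k * x k * x (2 * m - k)
    rw [hsym]; ring
  have f5 : ∑ k ∈ range (2 * m + 1), (-1) ^ k * x k ^ 5 =
      ∑ k ∈ range (2 * m + 1), ((2 * m).choose k : ℤ_[p]) ^ 5 := by
    refine sum_congr rfl fun k hk => ?_
    rw [hxk k hk]
    linear_combination (((-1 : ℤ_[p]) ^ k * (-1) ^ k) ^ 2 + (-1) ^ k * (-1) ^ k + 1) *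
      ((2 * m).choose k : ℤ_[p]) ^ 5 * sq1 k
  have hy : ∀ k, ∃ y, x k = 1 + p * y ∧ PadicInt.toZMod y = - hz p 1 k := by
    intro k
    obtain ⟨u, hu⟩ := eval_expand (EE p k) (p : ℤ_[p])
    obtain ⟨a0, a1, -, -⟩ := EE_coeff (p := p) k
    rw [a0, a1] at hu
    refine ⟨-hs p 1 k + p * ((EE p k).coeff 2 + (EE p k).coeff 3 * p + p ^ 2 * u), ?_, ?_⟩
    · simp only [hx]; rw [hu]; ring
    · simp [hz]
  choose y hy1 hy2 using hy
  set Y := ∑ k ∈ range (2 * m + 1), (-1) ^ k * y k ^ 3 with hY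
  have hf : ∑ k ∈ range (2 * m + 1), (-1) ^ k * x k ^ 5 =
      10 * (EE p m).eval (p : ℤ_[p]) - 15 * 2 ^ (2 * m) + 6 + 10 * p ^ 3 * Y
      + p ^ 4 * ∑ k ∈ range (2 * m + 1), (-1) ^ k * (5 * y k ^ 4 + p * y k ^ 5) := by
    rw [← f2, ← f1]
    have h6 : (6 : ℤ_[p]) = 6 * ∑ k ∈ range (2 * m + 1), (-1 : ℤ_[p]) ^ k := by
      rw [alt_one]; simp
    rw [h6, hY]
    simp only [mul_sum]
    rw [← sum_sub_distrib, ← sum_add_distrib, ← sum_add_distrib, ← sum_add_distrib]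
    refine sum_congr rfl fun k _ => ?_
    rw [hy1 k]; ring
  obtain ⟨⟨w, hw⟩, q, z, hq, hz'⟩ := morley hp5 hp
  have hYq : (p : ℤ_[p]) ∣ 16 * Y - 16 * q ^ 3 + 3 * hs p 3 m := by
    rw [← toZMod_eq_zero]
    have hYz : PadicInt.toZMod Y = - ∑ k ∈ range (2 * m + 1), (-1) ^ k * hz p 1 k ^ 3 := by
      rw [hY, map_sum, ← sum_neg_distrib]
      refine sum_congr rfl fun k _ => ?_
      simp only [map_mul, map_pow, map_neg, map_one, hy2]
      ring
    have hzz := congrArg PadicInt.toZMod hz'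
    simp only [map_add, map_mul, map_ofNat, map_natCast, ZMod.natCast_self] at hzz ⊢
    rw [map_sub, map_mul, map_mul, map_pow, hYz, map_ofNat]
    have cs := cube_sum hp5 hp
    have e1 : PadicInt.toZMod (hs p 1 m) = hz p 1 m := rfl
    have e3 : PadicInt.toZMod (hs p 3 m) = hz p 3 m := rfl
    rw [e1] at hzz
    rw [e3]
    have hh : hz p 1 m = -2 * PadicInt.toZMod q := by linear_combination hzz
    rw [hh] at cs
    linear_combination -cs
  obtain ⟨a, ha⟩ := hYq
  have hb : (p : ℤ_[p]) ∣ hs p 3 m + 2 * β := by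
    rw [← toZMod_eq_zero]
    have := hz_three_bern hp5 hp β hβ
    simp only [map_add, map_mul, map_ofNat]
    rw [hz] at this
    rw [this]; ring
  obtain ⟨b, hb⟩ := hb
  rw [← f5, hf]
  rw [hq] at hw ⊢
  generalize ∑ k ∈ range (2 * m + 1), (-1) ^ k * (5 * y k ^ 4 + p * y k ^ 5) = K
  generalize (p : ℤ_[p]) = P at *
  refine ⟨24 * K + 10 * w + 15 * a - 55 * b - 24 * (5 * q ^ 4 + P * q ^ 5), ?_⟩
  linear_combination 10 * hw + 15 * P ^ 3 * ha - 55 * P ^ 3 * hb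

end PanFifth

theorem pan_cor_fifth (p : ℕ) [Fact p.Prime] (hodd : Odd p) :
    ‖(((∑ k ∈ Finset.range p, ((p - 1).choose k : ℚ) ^ 5)
        - (32 ^ (p - 1) + (55 / 12) * (p : ℚ) ^ 3 * bernoulli (p - 3)) : ℚ) : ℚ_[p])‖
      ≤ (p : ℝ) ^ (-(4 : ℤ)) := by
  obtain ⟨m, hm⟩ := hodd
  have hp : p.Prime := Fact.out
  have h2 := hp.two_le
  by_cases h3 : p = 3
  · subst h3
    have e : ((∑ k ∈ Finset.range 3, ((3 - 1).choose k : ℚ) ^ 5)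
        - (32 ^ (3 - 1) + (55 / 12) * ((3 : ℕ) : ℚ) ^ 3 * bernoulli (3 - 3)) : ℚ)
        = ((3 : ℕ) : ℚ) ^ 4 * (-55 : ℤ) / (4 : ℕ) := by
      norm_num [Finset.sum_range_succ, Nat.choose]
    rw [e]
    push_cast
    have h4 : ‖((4 : ℕ) : ℚ_[3])‖ = 1 := by
      rw [Padic.norm_natCast_eq_one_iff]; decide
    have h55 := Padic.norm_int_le_one (p := 3) (-55)
    have h33 : ‖((3 : ℕ) : ℚ_[3])‖ = ((3 : ℕ) : ℝ)⁻¹ := Padic.norm_p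
    push_cast at h4 h55 h33
    rw [norm_div, norm_mul, norm_pow, h4, h33, div_one]
    calc _ ≤ ((3 : ℝ)⁻¹) ^ 4 * 1 := by gcongr
      _ = _ := by norm_num [zpow_neg]
  have hp5 : 5 ≤ p := by omega
  let β : ℤ_[p] := ⟨((bernoulli (p - 3) : ℚ) : ℚ_[p]), PanFifth.integral_bernoulli _ (by omega)⟩
  have key := PanFifth.main_cong hp5 hm β rfl
  rw [← Ideal.mem_span_singleton, ← PadicInt.norm_le_pow_iff_mem_span_pow, PadicInt.norm_def] at key
  have h24 : ‖((24 : ℕ) : ℚ_[p])‖ = 1 := by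
    rw [Padic.norm_natCast_eq_one_iff, show 24 = 2 ^ 3 * 3 by norm_num]
    refine Nat.Coprime.mul_right (Nat.Coprime.pow_right _ ?_) ?_
    · exact (Nat.coprime_primes hp Nat.prime_two).2 (by omega)
    · exact (Nat.coprime_primes hp Nat.prime_three).2 h3
  rw [← one_mul (norm _), ← h24, ← norm_mul]
  convert key using 2
  swap
  · norm_num
  simp only [PadicInt.coe_sub, PadicInt.coe_mul, PadicInt.coe_sum, PadicInt.coe_pow,
    PadicInt.coe_natCast]
  have e1 : ((24 : ℤ_[p]) : ℚ_[p]) = 24 := by exact_mod_cast PadicInt.coe_natCast 24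
  have e2 : ((110 : ℤ_[p]) : ℚ_[p]) = 110 := by exact_mod_cast PadicInt.coe_natCast 110
  have e3 : ((2 : ℤ_[p]) : ℚ_[p]) = 2 := by exact_mod_cast PadicInt.coe_natCast 2
  have e4 : (β : ℚ_[p]) = ((bernoulli (p - 3) : ℚ) : ℚ_[p]) := rfl
  rw [e1, e2, e3, e4, show p - 1 = 2 * m by omega,
    show Finset.range p = Finset.range (2 * m + 1) by rw [← hm]]
  push_cast
  have e5 : ((2 : ℚ_[p]) ^ (2 * m)) ^ 5 = 32 ^ (2 * m) := by
    rw [← pow_mul, mul_comm, pow_mul]; norm_num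
  rw [e5]
  ring
end

section
/- For every prime p ≥ 5, Σ_{k=1}^{(p-1)/2} 1/k ≡ -2 q_2(p) + p q_2(p)^2 - (2/3) p^2 q_2(p)^3 - (7/12) p^2 B_{p-3} (mod p^3), as a congruence of p-integral rationals. -/
/-- The subring of p-integral rationals. -/
noncomputable def Rp (p : ℕ) [Fact p.Prime] : Subring ℚ :=
  (PadicInt.subring p).comap (Rat.castHom ℚ_[p])

section
variable {p : ℕ} [Fact p.Prime]

lemma mem_Rp {x : ℚ} : x ∈ Rp p ↔ ‖(x : ℚ_[p])‖ ≤ 1 := Iff.rfl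

/-- `x` is divisible by `p^m` among the p-integral rationals. -/
def Dv (p : ℕ) [Fact p.Prime] (m : ℕ) (x : ℚ) : Prop := ∃ r ∈ Rp p, x = (p : ℚ) ^ m * r

lemma Dv.add {m : ℕ} {x y : ℚ} (hx : Dv p m x) (hy : Dv p m y) : Dv p m (x + y) := by
  obtain ⟨r, hr, rfl⟩ := hx
  obtain ⟨s, hs, rfl⟩ := hy
  exact ⟨r + s, add_mem hr hs, by ring⟩

lemma Dv.sub {m : ℕ} {x y : ℚ} (hx : Dv p m x) (hy : Dv p m y) : Dv p m (x - y) := by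
  obtain ⟨r, hr, rfl⟩ := hx
  obtain ⟨s, hs, rfl⟩ := hy
  exact ⟨r - s, sub_mem hr hs, by ring⟩

lemma Dv.mul {m : ℕ} {x c : ℚ} (hc : c ∈ Rp p) (hx : Dv p m x) : Dv p m (c * x) := by
  obtain ⟨r, hr, rfl⟩ := hx
  exact ⟨c * r, mul_mem hc hr, by ring⟩

lemma Dv.sum {m : ℕ} {ι : Type*} (s : Finset ι) {f : ι → ℚ} (h : ∀ i ∈ s, Dv p m (f i)) :
    Dv p m (∑ i ∈ s, f i) := by
  classical
  induction s using Finset.induction_on with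
  | empty => exact ⟨0, zero_mem _, by simp⟩
  | insert a s ha ih =>
    rw [Finset.sum_insert ha]
    exact (h a (by simp)).add (ih fun i hi => h i (by simp [hi]))

lemma nat_mem (k : ℕ) : (k : ℚ) ∈ Rp p := natCast_mem _ k

lemma inv_mem' {k : ℕ} (hk : ¬ p ∣ k) : (k : ℚ)⁻¹ ∈ Rp p := by
  rw [mem_Rp]
  push_cast
  rw [norm_inv]
  have h1 : ‖(k : ℚ_[p])‖ = 1 := by
    rw [Padic.norm_natCast_eq_one_iff]
    exact (Fact.out : p.Prime).coprime_iff_not_dvd.2 hk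
  simp [h1]

lemma inv_mem_lt {k : ℕ} (h0 : 0 < k) (hk : k < p) : (k : ℚ)⁻¹ ∈ Rp p :=
  inv_mem' (Nat.not_dvd_of_pos_of_lt h0 hk)

lemma Dv_pow_sub {x y : ℚ} (hx : x ∈ Rp p) (hy : y ∈ Rp p) (h : Dv p 1 (x - y)) (i : ℕ) :
    Dv p 1 (x ^ i - y ^ i) := by
  induction i with
  | zero => exact ⟨0, zero_mem _, by simp⟩
  | succ i ih =>
    have : x ^ (i+1) - y ^ (i+1) = x * (x ^ i - y ^ i) + y ^ i * (x - y) := by ring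
    rw [this]
    exact (ih.mul hx).add (h.mul (pow_mem hy i))

lemma bern_mem (i : ℕ) (hi : i + 1 < p) : bernoulli i ∈ Rp p := by
  induction i using Nat.strong_induction_on with
  | _ i ih =>
    have h := sum_bernoulli (i + 1)
    rw [Finset.sum_range_succ] at h
    have h2 : bernoulli i = ((i + 1 : ℕ) : ℚ)⁻¹ * ((if i + 1 = 1 then 1 else 0) -
        ∑ k ∈ Finset.range i, ((i + 1).choose k : ℚ) * bernoulli k) := by
      rw [← h]
      have : ((i + 1 : ℕ) : ℚ) ≠ 0 := by positivity
      rw [Nat.choose_succ_self_right]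
      field_simp
      ring
    rw [h2]
    refine mul_mem (inv_mem_lt (by omega) hi) (sub_mem ?_ (sum_mem fun k hk => ?_))
    · split_ifs
      · exact one_mem _
      · exact zero_mem _
    · have := Finset.mem_range.1 hk
      exact mul_mem (nat_mem _) (ih k this (by omega))

lemma bern_half (k : ℕ) :
    (Polynomial.bernoulli k).eval (2⁻¹ : ℚ) = (2 / 2 ^ k - 1) * bernoulli k := by
  have h := bernoulliFun_eval_half k
  unfold bernoulliFun at h
  have e : ((2:ℝ)⁻¹) = algebraMap ℚ ℝ (2⁻¹) := by simp
  rw [e, Polynomial.eval_map_algebraMap, Polynomial.aeval_algebraMap_apply] at h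
  have h3 : (((Polynomial.bernoulli k).eval (2⁻¹ : ℚ) : ℚ) : ℝ)
      = (((2 / 2 ^ k - 1) * bernoulli k : ℚ) : ℝ) := by
    push_cast
    simpa using h
  exact_mod_cast h3

lemma fermat_dv {k : ℕ} (hk : ¬ p ∣ k) : Dv p 1 ((k : ℚ) ^ (p - 1) - 1) := by
  have hp : p.Prime := Fact.out
  have hc : IsCoprime (k : ℤ) p := by
    rw [Nat.isCoprime_iff_coprime]
    exact ((hp.coprime_iff_not_dvd).2 hk).symm
  have h := (Int.ModEq.pow_card_sub_one_eq_one hp hc).symm.dvd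
  obtain ⟨c, hc⟩ := h
  refine ⟨c, intCast_mem _ c, ?_⟩
  have : (((k:ℤ) ^ (p-1) - 1 : ℤ) : ℚ) = ((p * c : ℤ) : ℚ) := by rw [hc]
  push_cast at this
  rw [this]; ring

lemma bern_cong {n : ℕ} (hn : p = 2 * n + 1) (h5 : 5 ≤ p) :
    Dv p 1 ((∑ j ∈ Finset.range n, ((j + 1 : ℕ) : ℚ)⁻¹ ^ 3) + 2 * bernoulli (p - 3)) := by
  have i2 : (2:ℚ)⁻¹ ∈ Rp p := by simpa using inv_mem_lt (p := p) (k := 2) (by omega) (by omega)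
  have i3 : (3:ℚ)⁻¹ ∈ Rp p := by simpa using inv_mem_lt (p := p) (k := 3) (by omega) (by omega)
  have hB : bernoulli (p - 3) ∈ Rp p := bern_mem _ (by omega)
  have hS : (∑ j ∈ Finset.range n, ((j + 1 : ℕ) : ℚ) ^ (p - 4)) ∈ Rp p :=
    sum_mem fun j _ => pow_mem (nat_mem _) _
  have h1 : Dv p 1 (∑ j ∈ Finset.range n,
      (((j + 1 : ℕ) : ℚ)⁻¹ ^ 3 - ((j + 1 : ℕ) : ℚ) ^ (p - 4))) := by
    refine Dv.sum _ fun j hj => ?_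
    have hj := Finset.mem_range.1 hj
    have hi := inv_mem_lt (p := p) (k := j + 1) (by omega) (by omega)
    have hf := fermat_dv (p := p) (k := j + 1) (Nat.not_dvd_of_pos_of_lt (by omega) (by omega))
    have e : ((j + 1 : ℕ) : ℚ)⁻¹ ^ 3 - ((j + 1 : ℕ) : ℚ) ^ (p - 4)
        = (-((j + 1 : ℕ) : ℚ)⁻¹ ^ 3) * (((j + 1 : ℕ) : ℚ) ^ (p - 1) - 1) := by
      have : ((j + 1 : ℕ) : ℚ) ≠ 0 := by positivity
      have e2 : p - 1 = (p - 4) + 3 := by omega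
      rw [e2, pow_add]
      field_simp
      ring
    rw [e]
    exact hf.mul (neg_mem (pow_mem hi 3))
  have h2 := Polynomial.sum_range_pow_eq_bernoulli_sub (n + 1) (p - 4)
  rw [Finset.sum_range_succ'] at h2
  have e4 : (p - 4).succ = p - 3 := by omega
  have e5 : ((p - 4 : ℕ) : ℚ) = p - 4 := by rw [Nat.cast_sub (by omega)]; norm_num
  rw [e4, e5, Nat.cast_zero, zero_pow (by omega), add_zero] at h2
  have h3 : Dv p 1 ((Polynomial.bernoulli (p - 3)).eval ((n + 1 : ℕ) : ℚ)
      - (Polynomial.bernoulli (p - 3)).eval (2⁻¹ : ℚ)) := by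
    simp only [Polynomial.bernoulli, Polynomial.eval_finsetSum, Polynomial.eval_monomial]
    rw [← Finset.sum_sub_distrib]
    refine Dv.sum _ fun i hi => ?_
    have hi := Finset.mem_range.1 hi
    rw [← mul_sub]
    refine Dv.mul (mul_mem (bern_mem i (by omega)) (nat_mem _)) (Dv_pow_sub (nat_mem _) i2 ?_ _)
    refine ⟨2⁻¹, i2, ?_⟩
    rw [hn]; push_cast; ring
  rw [bern_half] at h3
  have h4 : Dv p 1 ((2:ℚ) / 2 ^ (p - 3) - 8) := by
    have hf := fermat_dv (p := p) (k := 2) (Nat.not_dvd_of_pos_of_lt (by omega) (by omega))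
    have e : (2:ℚ) / 2 ^ (p - 3) - 8 = (-8 * (2⁻¹) ^ (p-1)) * (((2:ℕ):ℚ) ^ (p - 1) - 1) := by
      have e2 : p - 1 = (p - 3) + 2 := by omega
      rw [e2, pow_add, pow_add, inv_pow]
      push_cast
      field_simp
      ring
    rw [e]
    exact hf.mul (mul_mem (neg_mem (nat_mem (p := p) 8)) (pow_mem i2 _))
  rw [Finset.sum_sub_distrib] at h1
  set S := ∑ j ∈ Finset.range n, ((j + 1 : ℕ) : ℚ) ^ (p - 4)
  set T := ∑ j ∈ Finset.range n, ((j + 1 : ℕ) : ℚ)⁻¹ ^ 3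
  set B := bernoulli (p - 3)
  set E := (Polynomial.bernoulli (p - 3)).eval ((n + 1 : ℕ) : ℚ)
  have hpS : Dv p 1 (p * S) := ⟨S, hS, by ring⟩
  have h6 := h1.add (((hpS.sub h3).sub (h4.mul hB)).mul i3)
  convert h6 using 1
  have h2' : E = (p - 3) * S + B := by linarith
  rw [h2']
  ring

/-- truncated logarithm -/
def Lg (u : ℚ) : ℚ := u - u ^ 2 / 2 + u ^ 3 / 3

lemma Lg_mul (i2 : (2:ℚ)⁻¹ ∈ Rp p) (i3 : (3:ℚ)⁻¹ ∈ Rp p) {u v : ℚ} (hu : u ∈ Rp p)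
    (hv : v ∈ Rp p) :
    Dv p 4 (Lg ((1 + p * u) * (1 + p * v) - 1) - Lg (p * u) - Lg (p * v)) := by
  have hp := nat_mem (p := p) p
  lift u to Rp p using hu
  lift v to Rp p using hv
  have e6 : (3:ℚ)⁻¹ * 2⁻¹ ∈ Rp p := mul_mem i3 i2
  refine ⟨(((u*v)^2 * (- 2⁻¹) + u*v*(u^2+v^2+2*u*v) + (p:ℚ) * (u*v)^2*(u+v) + (p:ℚ)^2 * (u*v)^3 * 3⁻¹)),
    ?_, ?_⟩
  · have hm : ∀ x : Rp p, (x:ℚ) ∈ Rp p := fun x => x.2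
    have h2 : (2:ℚ) ∈ Rp p := by simpa using nat_mem (p := p) 2
    have := hm u
    have := hm v
    aesop
  · unfold Lg; ring

lemma Lg_prod (i2 : (2:ℚ)⁻¹ ∈ Rp p) (i3 : (3:ℚ)⁻¹ ∈ Rp p) (n : ℕ) (x : ℕ → ℚ)
    (hx : ∀ j < n, x j ∈ Rp p) :
    ∃ u ∈ Rp p, ∏ j ∈ Finset.range n, (1 + p * x j) = 1 + p * u ∧
      Dv p 4 (Lg (p * u) - ∑ j ∈ Finset.range n, Lg (p * x j)) := by
  induction n with
  | zero => exact ⟨0, zero_mem _, by simp, 0, zero_mem _, by simp [Lg]⟩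
  | succ n ih =>
    obtain ⟨u, hu, h1, h2⟩ := ih fun j hj => hx j (by omega)
    have hn := hx n (by omega)
    refine ⟨u + x n + p * u * x n,
      add_mem (add_mem hu hn) (mul_mem (mul_mem (nat_mem _) hu) hn), ?_, ?_⟩
    · rw [Finset.prod_range_succ, h1]; ring
    · rw [Finset.sum_range_succ]
      have h3 := h2.add (Lg_mul i2 i3 hu hn)
      have e : (p:ℚ) * (u + x n + p * u * x n) = (1 + p * u) * (1 + p * x n) - 1 := by ring
      rw [e]
      convert h3 using 1
      ring

lemma prod_nat (n : ℕ) :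
    2 ^ n * ∏ i ∈ Finset.range n, (2 * i + 1) = ∏ i ∈ Finset.range n, (n + 1 + i) := by
  have h1 : ∀ n : ℕ, n.factorial * (2 ^ n * ∏ i ∈ Finset.range n, (2 * i + 1))
      = (2 * n).factorial := by
    intro n
    induction n with
    | zero => simp
    | succ n ih =>
      rw [Finset.prod_range_succ, show 2 * (n + 1) = 2 * n + 1 + 1 by ring, Nat.factorial_succ (2 * n + 1),
        Nat.factorial_succ (2 * n), Nat.factorial_succ n, ← ih]
      ring
  have h2 := Nat.factorial_mul_ascFactorial n n
  rw [Nat.ascFactorial_eq_prod_range] at h2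
  have h3 := h1 n
  rw [two_mul n, ← h2] at h3
  exact Nat.eq_of_mul_eq_mul_left (Nat.factorial_pos n) h3

lemma prod_rat (n : ℕ) :
    (2:ℚ) ^ n * ∏ j ∈ Finset.range n, (((2 * n + 1 : ℕ) : ℚ) - 2 * ((j + 1 : ℕ) : ℚ))
      = ∏ j ∈ Finset.range n, (((2 * n + 1 : ℕ) : ℚ) - ((j + 1 : ℕ) : ℚ)) := by
  have h := congrArg (Nat.cast : ℕ → ℚ) (prod_nat n)
  push_cast at h
  rw [← Finset.prod_range_reflect, ← Finset.prod_range_reflect (n := n)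
    (f := fun i => (n:ℚ) + 1 + i)] at h
  have e1 : ∀ j ∈ Finset.range n, ((n - 1 - j : ℕ) : ℚ) = n - 1 - j := by
    intro j hj
    have := Finset.mem_range.1 hj
    rw [Nat.cast_sub (by omega), Nat.cast_sub (by omega)]; simp
  convert h using 1
  · congr 1
    refine Finset.prod_congr rfl fun j hj => ?_
    rw [e1 j hj]; push_cast; ring
  · refine Finset.prod_congr rfl fun j hj => ?_
    rw [e1 j hj]; push_cast; ring

lemma prod_main (n : ℕ) :
    (2:ℚ) ^ (2 * n) * ∏ j ∈ Finset.range n,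
        (1 + ((2 * n + 1 : ℕ) : ℚ) * (-(2⁻¹ * ((j + 1 : ℕ) : ℚ)⁻¹)))
      = ∏ j ∈ Finset.range n, (1 + ((2 * n + 1 : ℕ) : ℚ) * (-((j + 1 : ℕ) : ℚ)⁻¹)) := by
  have e1 : ∀ j ∈ Finset.range n, (1 + ((2 * n + 1 : ℕ) : ℚ) * (-((j + 1 : ℕ) : ℚ)⁻¹))
      = (-((j + 1 : ℕ) : ℚ)⁻¹) * (((2 * n + 1 : ℕ) : ℚ) - ((j + 1 : ℕ) : ℚ)) := by
    intro j _
    have : ((j + 1 : ℕ) : ℚ) ≠ 0 := by positivity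
    field_simp
    ring
  have e2 : ∀ j ∈ Finset.range n, (1 + ((2 * n + 1 : ℕ) : ℚ) * (-(2⁻¹ * ((j + 1 : ℕ) : ℚ)⁻¹)))
      = 2⁻¹ * ((-((j + 1 : ℕ) : ℚ)⁻¹) * (((2 * n + 1 : ℕ) : ℚ) - 2 * ((j + 1 : ℕ) : ℚ))) := by
    intro j _
    have : ((j + 1 : ℕ) : ℚ) ≠ 0 := by positivity
    field_simp
    ring
  rw [Finset.prod_congr rfl e1, Finset.prod_congr rfl e2, Finset.prod_mul_distrib,
    Finset.prod_mul_distrib, Finset.prod_mul_distrib, ← prod_rat, Finset.prod_const,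
    Finset.card_range, two_mul, pow_add, inv_pow]
  field_simp

lemma sum_split1 (f : ℚ → ℚ) (n : ℕ) :
    ∑ k ∈ Finset.range (2 * n), f ((k + 1 : ℕ) : ℚ) = ∑ j ∈ Finset.range n, f ((j + 1 : ℕ) : ℚ)
      + ∑ j ∈ Finset.range n, f (((2 * n + 1 : ℕ) : ℚ) - ((j + 1 : ℕ) : ℚ)) := by
  rw [two_mul, Finset.sum_range_add]
  congr 1
  rw [← Finset.sum_range_reflect]
  refine Finset.sum_congr rfl fun j hj => ?_
  have := Finset.mem_range.1 hj
  congr 1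
  rw [Nat.cast_add, Nat.cast_add, Nat.cast_sub (by omega), Nat.cast_sub (by omega)]
  push_cast; ring

lemma sum_split2 (f : ℚ → ℚ) (n : ℕ) :
    ∑ k ∈ Finset.range (2 * n), f ((k + 1 : ℕ) : ℚ)
      = ∑ j ∈ Finset.range n, f (2 * ((j + 1 : ℕ) : ℚ))
      + ∑ j ∈ Finset.range n, f (((2 * n + 1 : ℕ) : ℚ) - 2 * ((j + 1 : ℕ) : ℚ)) := by
  have h : ∀ n : ℕ, ∑ k ∈ Finset.range (2 * n), f ((k + 1 : ℕ) : ℚ)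
      = ∑ j ∈ Finset.range n, f (2 * ((j + 1 : ℕ) : ℚ))
        + ∑ j ∈ Finset.range n, f (2 * (j : ℚ) + 1) := by
    intro n
    induction n with
    | zero => simp
    | succ n ih =>
      rw [show 2 * (n + 1) = 2 * n + 1 + 1 by ring, Finset.sum_range_succ, Finset.sum_range_succ,
        ih, Finset.sum_range_succ, Finset.sum_range_succ]
      have a1 : ((2 * n + 1 + 1 : ℕ) : ℚ) = 2 * ((n + 1 : ℕ) : ℚ) := by push_cast; ring
      have a2 : ((2 * n + 1 : ℕ) : ℚ) = 2 * (n : ℚ) + 1 := by push_cast; ring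
      rw [a1, a2]
      ring
  rw [h]
  congr 1
  rw [← Finset.sum_range_reflect]
  refine Finset.sum_congr rfl fun j hj => ?_
  have := Finset.mem_range.1 hj
  congr 1
  rw [Nat.cast_sub (by omega), Nat.cast_sub (by omega)]
  push_cast; ring

lemma inv_sq_cong {a : ℕ} (h0 : 0 < a) (ha : a < p) :
    Dv p 2 (((p : ℚ) - a)⁻¹ ^ 2 - (a : ℚ)⁻¹ ^ 2 - 2 * p * (a : ℚ)⁻¹ ^ 3) := by
  have h1 := inv_mem_lt h0 ha
  have h2 := inv_mem_lt (p := p) (k := p - a) (by omega) (by omega)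
  rw [Nat.cast_sub ha.le] at h2
  have hp := nat_mem (p := p) p
  have n1 : (a : ℚ) ≠ 0 := by positivity
  have n2 : (p : ℚ) - a ≠ 0 := by
    have : (a : ℚ) < p := by exact_mod_cast ha
    linarith
  refine ⟨(((3 : ℕ) : ℚ) * a - ((2 : ℕ) : ℚ) * p) * ((a : ℚ)⁻¹ ^ 3 * ((p : ℚ) - a)⁻¹ ^ 2),
    mul_mem (sub_mem (mul_mem (nat_mem _) (nat_mem _)) (mul_mem (nat_mem _) hp))
      (mul_mem (pow_mem h1 _) (pow_mem h2 _)), ?_⟩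
  push_cast
  field_simp
  ring

lemma H2_cong {n : ℕ} (hn : p = 2 * n + 1) (h5 : 5 ≤ p) :
    Dv p 2 ((∑ j ∈ Finset.range n, ((j + 1 : ℕ) : ℚ)⁻¹ ^ 2)
      + 7 / 6 * p * ∑ j ∈ Finset.range n, ((j + 1 : ℕ) : ℚ)⁻¹ ^ 3) := by
  have i3 : (3:ℚ)⁻¹ ∈ Rp p := by simpa using inv_mem_lt (p := p) (k := 3) (by omega) (by omega)
  have s1 := sum_split1 (fun x => x⁻¹ ^ 2) n
  have s2 := sum_split2 (fun x => x⁻¹ ^ 2) n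
  rw [← hn] at s1 s2
  have d1 : Dv p 2 (∑ j ∈ Finset.range n, (((p : ℚ) - ((j + 1 : ℕ) : ℚ))⁻¹ ^ 2
      - ((j + 1 : ℕ) : ℚ)⁻¹ ^ 2 - 2 * p * ((j + 1 : ℕ) : ℚ)⁻¹ ^ 3)) := by
    refine Dv.sum _ fun j hj => ?_
    have := Finset.mem_range.1 hj
    exact inv_sq_cong (by omega) (by omega)
  have d2 : Dv p 2 (∑ j ∈ Finset.range n, (((p : ℚ) - 2 * ((j + 1 : ℕ) : ℚ))⁻¹ ^ 2
      - 4⁻¹ * ((j + 1 : ℕ) : ℚ)⁻¹ ^ 2 - 4⁻¹ * p * ((j + 1 : ℕ) : ℚ)⁻¹ ^ 3)) := by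
    refine Dv.sum _ fun j hj => ?_
    have := Finset.mem_range.1 hj
    have h := inv_sq_cong (p := p) (a := 2 * (j + 1)) (by omega) (by omega)
    rw [Nat.cast_mul] at h
    convert h using 1
    push_cast
    rw [mul_inv]
    ring
  simp only [Finset.sum_sub_distrib, ← Finset.mul_sum] at d1 d2
  have e : ∑ j ∈ Finset.range n, (2 * ((j + 1 : ℕ) : ℚ))⁻¹ ^ 2
      = 4⁻¹ * ∑ j ∈ Finset.range n, ((j + 1 : ℕ) : ℚ)⁻¹ ^ 2 := by
    rw [Finset.mul_sum]
    refine Finset.sum_congr rfl fun j _ => ?_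
    rw [mul_inv]; ring
  rw [s2, e] at s1
  have h := (d2.sub d1).mul (c := 2 * 3⁻¹) (mul_mem (nat_mem (p := p) 2) i3)
  convert h using 1
  linear_combination (-2/3) * s1

lemma main_aux {n : ℕ} (hn : p = 2 * n + 1) (h5 : 5 ≤ p) :
    Dv p 3 ((∑ j ∈ Finset.range n, ((j + 1 : ℕ) : ℚ)⁻¹)
        - (-2 * ((2 ^ (p - 1) - 1 : ℚ) / p) + (p : ℚ) * ((2 ^ (p - 1) - 1 : ℚ) / p) ^ 2
          - (2 / 3) * (p : ℚ) ^ 2 * ((2 ^ (p - 1) - 1 : ℚ) / p) ^ 3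
          - (7 / 12) * (p : ℚ) ^ 2 * bernoulli (p - 3))) := by
  have p0 : (p : ℚ) ≠ 0 := by have : 0 < p := by omega
                              positivity
  have i2 : (2:ℚ)⁻¹ ∈ Rp p := by simpa using inv_mem_lt (p := p) (k := 2) (by omega) (by omega)
  have i3 : (3:ℚ)⁻¹ ∈ Rp p := by simpa using inv_mem_lt (p := p) (k := 3) (by omega) (by omega)
  obtain ⟨q, hq, hq'⟩ :=
    fermat_dv (p := p) (k := 2) (Nat.not_dvd_of_pos_of_lt (by omega) (by omega))
  have hq2 : (2 ^ (p - 1) - 1 : ℚ) / p = q := by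
    push_cast at hq'
    rw [hq']; field_simp
  rw [hq2]
  have hx : ∀ j < n, (-((j + 1 : ℕ) : ℚ)⁻¹) ∈ Rp p := fun j hj =>
    neg_mem (inv_mem_lt (by omega) (by omega))
  have hy : ∀ j < n, (-(2⁻¹ * ((j + 1 : ℕ) : ℚ)⁻¹)) ∈ Rp p := fun j hj =>
    neg_mem (mul_mem i2 (inv_mem_lt (by omega) (by omega)))
  obtain ⟨u, hu, u1, u2⟩ := Lg_prod i2 i3 n _ hx
  obtain ⟨v, hv, v1, v2⟩ := Lg_prod i2 i3 n _ hy
  have hm := prod_main n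
  rw [← hn, u1, v1, show 2 * n = p - 1 by omega] at hm
  have hp2 : (2:ℚ) ^ (p - 1) = 1 + p * q := by
    push_cast at hq'
    linear_combination hq'
  rw [hp2] at hm
  have hl := Lg_mul i2 i3 hq hv
  rw [hm, add_sub_cancel_left] at hl
  obtain ⟨r, hr, hr'⟩ := (hl.sub u2).add v2
  obtain ⟨s, hs, hs'⟩ := H2_cong hn h5
  obtain ⟨t, ht, ht'⟩ := bern_cong hn h5
  set H1 := ∑ j ∈ Finset.range n, ((j + 1 : ℕ) : ℚ)⁻¹
  set H2 := ∑ j ∈ Finset.range n, ((j + 1 : ℕ) : ℚ)⁻¹ ^ 2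
  set H3 := ∑ j ∈ Finset.range n, ((j + 1 : ℕ) : ℚ)⁻¹ ^ 3
  have a1 : ∑ j ∈ Finset.range n, Lg (p * (-((j + 1 : ℕ) : ℚ)⁻¹))
      = - p * H1 - p ^ 2 / 2 * H2 - p ^ 3 / 3 * H3 := by
    simp only [H1, H2, H3, Finset.mul_sum, ← Finset.sum_sub_distrib]
    refine Finset.sum_congr rfl fun j _ => ?_
    unfold Lg; ring
  have a2 : ∑ j ∈ Finset.range n, Lg (p * (-(2⁻¹ * ((j + 1 : ℕ) : ℚ)⁻¹)))
      = - p / 2 * H1 - p ^ 2 / 8 * H2 - p ^ 3 / 24 * H3 := by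
    simp only [H1, H2, H3, Finset.mul_sum, ← Finset.sum_sub_distrib]
    refine Finset.sum_congr rfl fun j _ => ?_
    unfold Lg; ring
  rw [a1, a2] at hr'
  have four : (4:ℚ)⁻¹ = 2⁻¹ * 2⁻¹ := by norm_num
  refine ⟨-2 * r - 3 * (2⁻¹ * 2⁻¹) * s + 7 * 3⁻¹ * (2⁻¹ * 2⁻¹ * 2⁻¹) * t, ?_, ?_⟩
  · have m2 : (-2:ℚ) ∈ Rp p := neg_mem (nat_mem (p := p) 2)
    have m3 : (3:ℚ) ∈ Rp p := nat_mem (p := p) 3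
    have m7 : (7:ℚ) ∈ Rp p := nat_mem (p := p) 7
    have m4 := mul_mem i2 i2
    exact add_mem (sub_mem (mul_mem m2 hr) (mul_mem (mul_mem m3 m4) hs))
      (mul_mem (mul_mem (mul_mem m7 i3) (mul_mem m4 i2)) ht)
  · apply mul_left_cancel₀ p0
    unfold Lg at hr'
    linear_combination (-2) * hr' - 3 / 4 * p ^ 2 * hs' + 7 / 24 * p ^ 3 * ht'

end



theorem half_harmonic_sum (p : ℕ) [Fact p.Prime] (h5 : 5 ≤ p) :
    ‖(((∑ k ∈ Finset.Icc 1 ((p - 1) / 2), (1 : ℚ) / k)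
        - (-2 * ((2 ^ (p - 1) - 1 : ℚ) / p) + (p : ℚ) * ((2 ^ (p - 1) - 1 : ℚ) / p) ^ 2
          - (2 / 3) * (p : ℚ) ^ 2 * ((2 ^ (p - 1) - 1 : ℚ) / p) ^ 3
          - (7 / 12) * (p : ℚ) ^ 2 * bernoulli (p - 3)) : ℚ) : ℚ_[p])‖
      ≤ (p : ℝ) ^ (-(3 : ℤ)) := by
  obtain ⟨n, hn⟩ : ∃ n, p = 2 * n + 1 :=
    (Fact.out : p.Prime).odd_of_ne_two (by omega)
  obtain ⟨r, hr, h⟩ := main_aux hn h5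
  have e : ∑ k ∈ Finset.Icc 1 ((p - 1) / 2), (1 : ℚ) / k
      = ∑ j ∈ Finset.range n, ((j + 1 : ℕ) : ℚ)⁻¹ := by
    rw [show (p - 1) / 2 = n by omega, ← Finset.Ico_add_one_right_eq_Icc,
      Finset.sum_Ico_eq_sum_range]
    refine Finset.sum_congr (by simp) fun j _ => ?_
    rw [one_div, add_comm]
  rw [e, h]
  have hr2 : ‖(r : ℚ_[p])‖ ≤ 1 := hr
  rw [Rat.cast_mul, Rat.cast_pow, Rat.cast_natCast, norm_mul, norm_pow, Padic.norm_p]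
  calc _ ≤ ((p : ℝ)⁻¹) ^ 3 * 1 := by gcongr
    _ = _ := by rw [mul_one, zpow_neg, inv_pow]; norm_cast
end

section
/- For every prime p ≥ 5 and every even integer n with 2 ≤ n ≤ p-3, Σ_{k=1}^{(p-1)/2} 1/k^n ≡ (n(2^{n+1}-1)/(2(n+1))) p B_{p-n-1} (mod p^2), as a congruence of p-integral rationals. -/
lemma hps_one_add (R : Type*) [CommRing R] (e t : R) (he : e * e = 0) (n : ℕ) :
    (1 + e * t) ^ n = 1 + n * (e * t) := by
  induction n with
  | zero => simp
  | succ n ih =>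
    rw [pow_succ, ih]; push_cast
    linear_combination (n * t ^ 2) * he

lemma hps_inv_add (R : Type*) [CommRing R] (e x z y z' : R) (he : e * e = 0) (hz : x * z = 1)
    (hz' : (x + e * y) * z' = 1) (n : ℕ) :
    z' ^ n = z ^ n * (1 - n * (e * y * z)) := by
  have h1 : (x + e * y) * (z * (1 + e * (-(y * z)))) = 1 := by
    linear_combination (1 - e * y * z) * hz - (y ^ 2 * z ^ 2) * he
  have h2 : z' = z * (1 + e * (-(y * z))) := by
    linear_combination z' * (-h1) + z * (1 + e * (-(y * z))) * hz'
  rw [h2, mul_pow, hps_one_add R e _ he]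
  ring

/-- Half sum in terms of full sum. -/
lemma hps_half (p : ℕ) [Fact p.Prime] (h5 : 5 ≤ p) (n : ℕ) (hne : Even n) :
    (2 : ZMod (p ^ 2)) * ∑ k ∈ Finset.Icc 1 ((p - 1) / 2), ((k : ZMod (p ^ 2))⁻¹) ^ n
      = (2 ^ (n + 1) - 1) * ∑ k ∈ Finset.Ico 1 p, ((k : ZMod (p ^ 2))⁻¹) ^ n := by
  have hp : p.Prime := Fact.out
  obtain ⟨h, hh⟩ : ∃ h, p = 2 * h + 1 := hp.odd_of_ne_two (by omega)
  have hhalf : (p - 1) / 2 = h := by omega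
  set f : ℕ → ZMod (p ^ 2) := fun k => ((k : ZMod (p ^ 2))⁻¹) ^ n with hf
  have hIcc : Finset.Icc 1 ((p - 1) / 2) = Finset.Ico 1 (h + 1) := by
    rw [hhalf]; rfl
  have hinv : ∀ k : ℕ, 1 ≤ k → k < p → (k : ZMod (p ^ 2)) * (k : ZMod (p ^ 2))⁻¹ = 1 := by
    intro k h1 h2
    apply ZMod.coe_mul_inv_eq_one
    exact Nat.Coprime.pow_right 2 (Nat.coprime_of_lt_prime (by omega) h2 hp).symm
  have he : (p : ZMod (p ^ 2)) * p = 0 := by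
    have := ZMod.natCast_self (p ^ 2); push_cast at this; rw [← this]; ring
  have hA : ∑ k ∈ Finset.Ico 1 p, f k = ∑ j ∈ Finset.Ico 1 (h + 1), (f j + f (p - j)) := by
    rw [Finset.sum_add_distrib, ← Finset.sum_Ico_consecutive f (show 1 ≤ h + 1 by omega) (show h + 1 ≤ p by omega)]
    congr 1
    refine Finset.sum_bij' (fun k _ => p - k) (fun k _ => p - k) ?_ ?_ ?_ ?_ ?_ <;>
      simp only [Finset.mem_Ico] <;> intro a ha
    · omega
    · omega
    · omega
    · omega
    · congr 1; omega
  have hB : ∑ k ∈ Finset.Ico 1 p, f k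
      = ∑ j ∈ Finset.Ico 1 (h + 1), (f (2 * j) + f (p - 2 * j)) := by
    rw [Finset.sum_add_distrib, ← Finset.sum_filter_add_sum_filter_not _ (fun k => Even k)]
    congr 1
    · refine Finset.sum_bij' (fun k _ => k / 2) (fun k _ => 2 * k) ?_ ?_ ?_ ?_ ?_ <;>
        simp only [Finset.mem_Ico, Finset.mem_filter, Nat.even_iff] <;> intro a ha
      · omega
      · omega
      · omega
      · omega
      · congr 1; omega
    · refine Finset.sum_bij' (fun k _ => (p - k) / 2) (fun k _ => p - 2 * k) ?_ ?_ ?_ ?_ ?_ <;>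
        simp only [Finset.mem_Ico, Finset.mem_filter, Nat.even_iff] <;> intro a ha
      · omega
      · omega
      · omega
      · omega
      · congr 1; omega
  have hC : ∀ j ∈ Finset.Ico 1 (h + 1),
      2 * f j = 2 ^ (n + 1) * (f (2 * j) + f (p - 2 * j)) - (f j + f (p - j)) := by
    intro j hj
    rw [Finset.mem_Ico] at hj
    have e1 := hinv j (by omega) (by omega)
    have e2 := hinv (2 * j) (by omega) (by omega)
    have e3 := hinv (p - j) (by omega) (by omega)
    have e4 := hinv (p - 2 * j) (by omega) (by omega)
    simp only [hf]
    rw [Nat.cast_sub (by omega)] at e3 e4 ⊢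
    rw [Nat.cast_sub (by omega)]
    generalize ((p : ZMod (p ^ 2)) - (j : ℕ))⁻¹ = z3 at *
    generalize ((p : ZMod (p ^ 2)) - ((2 * j : ℕ) : ZMod (p ^ 2)))⁻¹ = z4 at *
    generalize ((2 * j : ℕ) : ZMod (p ^ 2))⁻¹ = w at *
    generalize (j : ZMod (p ^ 2))⁻¹ = z at *
    push_cast at *
    have hzw : z = 2 * w := by linear_combination 2 * w * e1 - z * e2
    have q3 := hps_inv_add _ (p : ZMod (p ^ 2)) (-j) (-z) 1 z3 he (by linear_combination e1)
      (by linear_combination e3) n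
    have q4 := hps_inv_add _ (p : ZMod (p ^ 2)) (-(2 * j)) (-w) 1 z4 he (by linear_combination e2)
      (by linear_combination e4) n
    rw [q3, q4, hne.neg_pow, hne.neg_pow, hzw, mul_pow]
    ring
  rw [hIcc, Finset.mul_sum, Finset.sum_congr rfl hC, Finset.sum_sub_distrib, ← Finset.mul_sum, ← hA,
    ← hB]
  ring

/-- The Teichmueller sum vanishes. -/
lemma hps_teich (p : ℕ) [Fact p.Prime] (n : ℕ) (hn : ¬ (p - 1) ∣ n) :
    ∑ k ∈ Finset.Ico 1 p, (((k : ZMod (p ^ 2))⁻¹) ^ p) ^ n = 0 := by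
  have hp : p.Prime := Fact.out
  have he : (p : ZMod (p ^ 2)) ^ 2 = 0 := by
    have := ZMod.natCast_self (p ^ 2); push_cast at this; exact this
  have hinv : ∀ k : ℕ, k.Coprime p → (k : ZMod (p ^ 2)) * (k : ZMod (p ^ 2))⁻¹ = 1 := by
    intro k h1
    exact ZMod.coe_mul_inv_eq_one _ (Nat.Coprime.pow_right 2 h1)
  set F : (ZMod p)ˣ → ZMod (p ^ 2) := fun u => ((((u : ZMod p).val : ZMod (p ^ 2))⁻¹) ^ p) ^ n with hF
  have hsum : ∑ k ∈ Finset.Ico 1 p, (((k : ZMod (p ^ 2))⁻¹) ^ p) ^ n = ∑ u : (ZMod p)ˣ, F u := by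
    symm
    refine Finset.sum_bij (fun u _ => (u : ZMod p).val) ?_ ?_ ?_ ?_
    · intro u _
      have h1 := ZMod.val_lt (u : ZMod p)
      have h2 : (u : ZMod p).val ≠ 0 := by
        rw [Ne, ZMod.val_eq_zero]; exact u.ne_zero
      rw [Finset.mem_Ico]; omega
    · intro u _ v _ h
      exact Units.ext (ZMod.val_injective p h)
    · intro k hk
      rw [Finset.mem_Ico] at hk
      refine ⟨ZMod.unitOfCoprime k (Nat.coprime_of_lt_prime (by omega) hk.2 hp).symm, Finset.mem_univ _, ?_⟩
      simp [ZMod.val_natCast, Nat.mod_eq_of_lt hk.2]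
    · intro u _; rfl
  have hmul : ∀ u v, F (u * v) = F u * F v := by
    intro u v
    have hu := hinv _ (ZMod.val_coe_unit_coprime u)
    have hv := hinv _ (ZMod.val_coe_unit_coprime v)
    have huv := hinv _ (ZMod.val_coe_unit_coprime (u * v))
    simp only [hF]
    rw [← mul_pow, ← mul_pow]
    congr 1
    have hd : (p : ZMod (p ^ 2)) ∣ (((u * v : (ZMod p)ˣ) : ZMod p).val : ZMod (p ^ 2))
        - ((u : ZMod p).val : ZMod (p ^ 2)) * ((v : ZMod p).val : ZMod (p ^ 2)) := by
      rw [Units.val_mul, ZMod.val_mul]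
      refine ⟨-(((u : ZMod p).val * (v : ZMod p).val / p : ℕ) : ZMod (p ^ 2)), ?_⟩
      have := congrArg (Nat.cast (R := ZMod (p ^ 2)))
        (Nat.div_add_mod ((u : ZMod p).val * (v : ZMod p).val) p)
      push_cast at this ⊢
      linear_combination this
    have hd' := dvd_sub_pow_of_dvd_sub hd 1
    rw [pow_one, one_add_one_eq_two, he, zero_dvd_iff, sub_eq_zero, mul_pow] at hd'
    generalize (((u * v : (ZMod p)ˣ) : ZMod p).val : ZMod (p ^ 2)) = a at *
    generalize ((u : ZMod p).val : ZMod (p ^ 2)) = b at *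
    generalize ((v : ZMod p).val : ZMod (p ^ 2)) = c at *
    have a1 : a ^ p * a⁻¹ ^ p = 1 := by rw [← mul_pow, huv, one_pow]
    have b1 : b ^ p * b⁻¹ ^ p = 1 := by rw [← mul_pow, hu, one_pow]
    have c1 : c ^ p * c⁻¹ ^ p = 1 := by rw [← mul_pow, hv, one_pow]
    rw [mul_pow]
    linear_combination (-a⁻¹ ^ p) * b1 - a⁻¹ ^ p * b ^ p * b⁻¹ ^ p * c1
      + b⁻¹ ^ p * c⁻¹ ^ p * a1 - a⁻¹ ^ p * b⁻¹ ^ p * c⁻¹ ^ p * hd'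
  obtain ⟨g, hg⟩ : ∃ g : (ZMod p)ˣ, g ^ n ≠ 1 := by
    by_contra! hcon
    have := (FiniteField.forall_pow_eq_one_iff (ZMod p) n).1 hcon
    rw [ZMod.card] at this
    exact hn this
  have hinvar : F g * ∑ u, F u = ∑ u, F u := by
    rw [Finset.mul_sum]
    simp_rw [← hmul]
    exact Equiv.sum_comp (Equiv.mulLeft g) F
  have hunit : IsUnit (1 - F g) := by
    set x := 1 - F g with hx
    have hcast : ZMod.castHom (show p ∣ p ^ 2 from dvd_pow_self p two_ne_zero) (ZMod p) (F g)
        = ((g⁻¹ ^ n : (ZMod p)ˣ) : ZMod p) := by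
      have h1 := congrArg (ZMod.castHom (show p ∣ p ^ 2 from dvd_pow_self p two_ne_zero) (ZMod p))
        (hinv _ (ZMod.val_coe_unit_coprime g))
      simp only [hF]
      rw [map_mul, map_one, map_natCast, ZMod.natCast_zmod_val] at h1
      rw [map_pow, map_pow, ZMod.pow_card, Units.val_pow_eq_pow_val]
      congr 1
      exact (Units.inv_eq_of_mul_eq_one_right h1).symm
    have hne : ZMod.castHom (show p ∣ p ^ 2 from dvd_pow_self p two_ne_zero) (ZMod p) x ≠ 0 := by
      rw [hx, map_sub, map_one, hcast, sub_ne_zero]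
      intro h
      apply hg
      exact Units.ext (by simpa using h)
    have : NeZero (p ^ 2) := ⟨pow_ne_zero _ hp.ne_zero⟩
    rw [← ZMod.natCast_zmod_val x, ZMod.isUnit_iff_coprime]
    refine Nat.Coprime.pow_right 2 (Nat.Coprime.symm ((Nat.Prime.coprime_iff_not_dvd hp).2 ?_))
    intro hdvd
    apply hne
    rw [← ZMod.natCast_zmod_val x, map_natCast]
    exact (ZMod.natCast_eq_zero_iff _ _).2 hdvd
  rw [hsum]
  exact hunit.mul_left_cancel (by rw [sub_mul, hinvar]; ring)

lemma hps_full (p : ℕ) [Fact p.Prime] (n : ℕ) (hn0 : 1 ≤ n) (hn : n < p - 1) :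
    ((n : ZMod (p ^ 2)) + 1) * ∑ k ∈ Finset.Ico 1 p, ((k : ZMod (p ^ 2))⁻¹) ^ n
      = n * ∑ k ∈ Finset.Ico 1 p, (k : ZMod (p ^ 2)) ^ (p - n - 1) := by
  have hp : p.Prime := Fact.out
  have ht := hps_teich p n (fun h => absurd (Nat.le_of_dvd (by omega) h) (by omega))
  have he : (p : ZMod (p ^ 2)) * p = 0 := by
    have := ZMod.natCast_self (p ^ 2); push_cast at this; rw [← this]; ring
  rw [← sub_eq_zero, ← ht, Finset.mul_sum, Finset.mul_sum, ← Finset.sum_sub_distrib]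
  refine Finset.sum_congr rfl fun k hk => ?_
  rw [Finset.mem_Ico] at hk
  have hco : k.Coprime p := (Nat.coprime_of_lt_prime (by omega) hk.2 hp).symm
  have hz := ZMod.coe_mul_inv_eq_one k (Nat.Coprime.pow_right 2 hco)
  obtain ⟨t, ht⟩ : ∃ t : ZMod (p ^ 2), (k : ZMod (p ^ 2)) ^ (p - 1) = 1 + (p : ZMod (p ^ 2)) * t := by
    have h1 : (p : ℤ) ∣ (k : ℤ) ^ (p - 1) - 1 := by
      have := Int.ModEq.pow_card_sub_one_eq_one hp (n := (k : ℤ)) (by exact_mod_cast hco)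
      exact this.symm.dvd
    obtain ⟨t, ht⟩ := h1
    refine ⟨(t : ZMod (p ^ 2)), ?_⟩
    have := congrArg (Int.cast (R := ZMod (p ^ 2))) ht
    push_cast at this
    linear_combination this
  generalize (k : ZMod (p ^ 2))⁻¹ = z at *
  have hk1 : (k : ZMod (p ^ 2)) ^ (p - n - 1) = z ^ n * (1 + (p : ZMod (p ^ 2)) * t) := by
    rw [← ht, show p - 1 = n + (p - n - 1) by omega, pow_add, ← mul_assoc, ← mul_pow, mul_comm z, hz]
    simp
  have hz1 : z ^ (p - 1) = 1 + (p : ZMod (p ^ 2)) * (-t) := by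
    have : (k : ZMod (p ^ 2)) ^ (p - 1) * z ^ (p - 1) = 1 := by rw [← mul_pow, hz, one_pow]
    rw [ht] at this
    linear_combination (1 - (p : ZMod (p ^ 2)) * t) * this + t ^ 2 * z ^ (p - 1) * he
  have hz2 : (z ^ p) ^ n = z ^ n * (1 + (n : ZMod (p ^ 2)) * ((p : ZMod (p ^ 2)) * (-t))) := by
    rw [← hps_one_add _ _ _ he, ← hz1, ← mul_pow, ← pow_succ', show p - 1 + 1 = p by omega]
  rw [hz2, hk1]
  ring

lemma hps_bern (p : ℕ) [Fact p.Prime] (i : ℕ) (hi : i + 1 < p) :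
    ‖((bernoulli' i : ℚ) : ℚ_[p])‖ ≤ 1 := by
  induction i using Nat.strong_induction_on with
  | _ i ih =>
    rw [bernoulli'_def]
    push_cast
    rw [sub_eq_add_neg]
    refine (IsUltrametricDist.norm_add_le_max _ _).trans (max_le (by simp) ?_)
    rw [norm_neg]
    refine IsUltrametricDist.norm_sum_le_of_forall_le_of_nonneg zero_le_one fun k hk => ?_
    rw [Finset.mem_range] at hk
    have h1 : ‖((i : ℚ_[p]) - k + 1)‖ = 1 := by
      rw [← Nat.cast_sub hk.le, ← Nat.cast_one, ← Nat.cast_add, Padic.norm_natCast_eq_one_iff]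
      exact Nat.coprime_of_lt_prime (by omega) (by omega) Fact.out
    rw [norm_mul, norm_div, h1, div_one]
    exact mul_le_one₀ (by exact_mod_cast Padic.norm_int_le_one _) (norm_nonneg _) (ih k hk (by omega))

lemma hps_pow_sum (p : ℕ) [Fact p.Prime] (m : ℕ) (hm0 : 1 ≤ m) (hm : m + 1 < p) :
    ‖(((∑ k ∈ Finset.Ico 1 p, (k : ℚ) ^ m) - p * bernoulli m : ℚ) : ℚ_[p])‖ ≤ (p : ℝ) ^ (-(2 : ℤ)) := by
  have hp : p.Prime := Fact.out
  have h0 : ∑ k ∈ Finset.Ico 1 p, (k : ℚ) ^ m = ∑ k ∈ Finset.range p, (k : ℚ) ^ m := by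
    rw [Finset.range_eq_Ico, Finset.sum_eq_sum_Ico_succ_bot hp.pos]
    simp [show m ≠ 0 by omega]
  have hb : ∀ i, i + 1 < p → ‖((bernoulli i : ℚ) : ℚ_[p])‖ ≤ 1 := by
    intro i hi
    rw [bernoulli]; push_cast
    rw [norm_mul]
    simpa using hps_bern p i hi
  rw [h0, sum_range_pow, Finset.sum_range_succ]
  have hlast : bernoulli m * ((m + 1).choose m) * (p : ℚ) ^ (m + 1 - m) / (m + 1) = p * bernoulli m := by
    have : (m : ℚ) + 1 ≠ 0 := by positivity
    rw [Nat.choose_succ_self_right, show m + 1 - m = 1 by omega]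
    push_cast
    field_simp
  rw [hlast, add_sub_cancel_right]
  push_cast
  refine IsUltrametricDist.norm_sum_le_of_forall_le_of_nonneg (by positivity) fun i hi => ?_
  rw [Finset.mem_range] at hi
  have h1 : ‖((m : ℚ_[p]) + 1)‖ = 1 := by
    rw [← Nat.cast_one, ← Nat.cast_add, Padic.norm_natCast_eq_one_iff]
    exact Nat.coprime_of_lt_prime (by omega) (by omega) hp
  rw [norm_div, h1, div_one, show m + 1 - i = (m - 1 - i) + 2 by omega, pow_add, ← mul_assoc, norm_mul,
    Padic.norm_p_pow]
  refine mul_le_of_le_one_left (by positivity) ?_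
  rw [norm_mul, norm_mul]
  refine mul_le_one₀ (mul_le_one₀ (hb i (by omega)) (norm_nonneg _) ?_) (norm_nonneg _) ?_
  · exact_mod_cast Padic.norm_int_le_one _
  · exact_mod_cast Padic.norm_int_le_one ((p : ℤ) ^ (m - 1 - i))

theorem half_power_sum_even (p : ℕ) [Fact p.Prime] (h5 : 5 ≤ p) (n : ℕ)
    (hne : Even n) (h2 : 2 ≤ n) (hnp : n ≤ p - 3) :
    ‖(((∑ k ∈ Finset.Icc 1 ((p - 1) / 2), (1 : ℚ) / (k : ℚ) ^ n)
        - ((n : ℚ) * (2 ^ (n + 1) - 1) / (2 * (n + 1))) * (p : ℚ) * bernoulli (p - n - 1) : ℚ) : ℚ_[p])‖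
      ≤ (p : ℝ) ^ (-(2 : ℤ)) := by
  have hp : p.Prime := Fact.out
  have hnorm : ∀ k : ℕ, 1 ≤ k → k < p → ‖(k : ℚ_[p])‖ = 1 := by
    intro k h1 h2
    rw [Padic.norm_natCast_eq_one_iff]
    exact Nat.coprime_of_lt_prime (by omega) h2 hp
  -- the congruence in `ZMod (p ^ 2)`
  have key : (2 * (n + 1) : ZMod (p ^ 2)) *
      ∑ k ∈ Finset.Icc 1 ((p - 1) / 2), ((k : ZMod (p ^ 2))⁻¹) ^ n
      = (2 ^ (n + 1) - 1) * n * ∑ k ∈ Finset.Ico 1 p, (k : ZMod (p ^ 2)) ^ (p - n - 1) := by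
    linear_combination ((n : ZMod (p ^ 2)) + 1) * hps_half p h5 n hne
      + (2 ^ (n + 1) - 1) * hps_full p n (by omega) (by omega)
  have hinv : ∀ k : ℕ, 1 ≤ k → k < p →
      PadicInt.toZModPow 2 ((k : ℤ_[p]).inv) = (k : ZMod (p ^ 2))⁻¹ := by
    intro k h1 h2
    have a1 : (k : ℤ_[p]) * (k : ℤ_[p]).inv = 1 :=
      PadicInt.mul_inv (by rw [PadicInt.norm_def]; simpa using hnorm k h1 h2)
    have a2 := congrArg (PadicInt.toZModPow (p := p) 2) a1
    rw [map_mul, map_one, map_natCast] at a2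
    have a3 := ZMod.coe_mul_inv_eq_one k
      (Nat.Coprime.pow_right 2 (Nat.coprime_of_lt_prime (by omega) h2 hp).symm)
    linear_combination (k : ZMod (p ^ 2))⁻¹ * a2 - PadicInt.toZModPow 2 ((k : ℤ_[p]).inv) * a3
  have hinv' : ∀ k : ℕ, 1 ≤ k → k < p → (((k : ℤ_[p]).inv : ℤ_[p]) : ℚ_[p]) = (k : ℚ_[p])⁻¹ := by
    intro k h1 h2
    have a1 : (k : ℤ_[p]) * (k : ℤ_[p]).inv = 1 :=
      PadicInt.mul_inv (by rw [PadicInt.norm_def]; simpa using hnorm k h1 h2)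
    have a2 := congrArg (fun x : ℤ_[p] => (x : ℚ_[p])) a1
    push_cast at a2
    exact (inv_eq_of_mul_eq_one_right a2).symm
  have hI : ‖(2 * (n + 1) : ℤ_[p]) * ∑ k ∈ Finset.Icc 1 ((p - 1) / 2), ((k : ℤ_[p]).inv) ^ n
      - (2 ^ (n + 1) - 1) * n * ∑ k ∈ Finset.Ico 1 p, (k : ℤ_[p]) ^ (p - n - 1)‖
      ≤ (p : ℝ) ^ (-(2 : ℕ) : ℤ) := by
    rw [PadicInt.norm_le_pow_iff_mem_span_pow, ← PadicInt.ker_toZModPow, RingHom.mem_ker]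
    simp only [map_sub, map_mul, map_sum, map_pow, map_natCast, map_add, map_one, map_ofNat]
    rw [sub_eq_zero, ← key]
    congr 1
    refine Finset.sum_congr rfl fun k hk => ?_
    rw [Finset.mem_Icc] at hk
    rw [hinv k (by omega) (by omega)]
  have hQ : ‖(2 * (n + 1) : ℚ_[p]) * ∑ k ∈ Finset.Icc 1 ((p - 1) / 2), ((k : ℚ_[p])⁻¹) ^ n
      - (2 ^ (n + 1) - 1) * n * ∑ k ∈ Finset.Ico 1 p, (k : ℚ_[p]) ^ (p - n - 1)‖
      ≤ (p : ℝ) ^ (-(2 : ℤ)) := by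
    rw [PadicInt.norm_def] at hI
    have hco : ∀ x : ℤ_[p], (x : ℚ_[p]) = PadicInt.Coe.ringHom x := fun _ => rfl
    rw [hco] at hI
    simp only [map_sub, map_mul, map_sum, map_pow, map_natCast, map_add, map_one, map_ofNat] at hI
    suffices hs : ∑ k ∈ Finset.Icc 1 ((p - 1) / 2), ((k : ℚ_[p])⁻¹) ^ n
        = ∑ k ∈ Finset.Icc 1 ((p - 1) / 2), (((k : ℤ_[p]).inv : ℤ_[p]) : ℚ_[p]) ^ n by
      rw [hs]; exact hI
    refine Finset.sum_congr rfl fun k hk => ?_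
    rw [Finset.mem_Icc] at hk
    rw [hinv' k (by omega) (by omega)]
  have hB := hps_pow_sum p (p - n - 1) (by omega) (by omega)
  have hu : ‖(2 * (n + 1) : ℚ_[p])‖ = 1 := by
    rw [norm_mul]
    have a := hnorm 2 (by omega) (by omega)
    have b := hnorm (n + 1) (by omega) (by omega)
    push_cast at a b
    rw [a, b, one_mul]
  have hne0 : (2 * (n + 1) : ℚ_[p]) ≠ 0 := by
    intro h; rw [h, norm_zero] at hu; exact zero_ne_one hu
  push_cast at hB ⊢
  rw [← one_mul ‖_ - _‖, ← hu, ← norm_mul]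
  have hc : ‖((2 ^ (n + 1) - 1) * n : ℚ_[p])‖ ≤ 1 := by
    exact_mod_cast Padic.norm_int_le_one (p := p) ((2 ^ (n + 1) - 1) * n)
  have hB2 : ‖((2 ^ (n + 1) - 1) * n : ℚ_[p]) * ((∑ k ∈ Finset.Ico 1 p, (k : ℚ_[p]) ^ (p - n - 1))
      - p * (bernoulli (p - n - 1) : ℚ_[p]))‖ ≤ (p : ℝ) ^ (-(2 : ℤ)) := by
    rw [norm_mul]
    exact (mul_le_of_le_one_left (norm_nonneg _) hc).trans hB
  have := (IsUltrametricDist.norm_add_le_max _ _).trans (max_le hQ hB2)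
  refine le_of_eq_of_le ?_ this
  congr 1
  simp only [one_div, inv_pow]
  rw [mul_sub, ← mul_assoc, ← mul_assoc, mul_div_cancel₀ _ hne0]
  ring
end

section
/- For every prime p ≥ 5, Σ_{1 ≤ j < k ≤ p-1, k even} 1/(j k^2) ≡ (5/8) B_{p-3} (mod p), as a congruence of p-integral rationals. -/
/-- `q` is `p`-integral and reduces to `z` modulo `p`. -/
def RedTo (p : ℕ) [Fact p.Prime] (q : ℚ) (z : ZMod p) : Prop :=
  ∃ x : ℤ_[p], (x : ℚ_[p]) = (q : ℚ_[p]) ∧ PadicInt.toZMod x = z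

namespace RedTo
variable {p : ℕ} [Fact p.Prime]

lemma nat (n : ℕ) : RedTo p (n : ℚ) (n : ZMod p) := ⟨n, by simp, by simp⟩

lemma add {a b : ℚ} {x y : ZMod p} (h : RedTo p a x) (g : RedTo p b y) :
    RedTo p (a + b) (x + y) := by
  obtain ⟨u, hu, rfl⟩ := h
  obtain ⟨v, hv, rfl⟩ := g
  exact ⟨u + v, by push_cast; rw [hu, hv], by simp⟩

lemma mul {a b : ℚ} {x y : ZMod p} (h : RedTo p a x) (g : RedTo p b y) :
    RedTo p (a * b) (x * y) := by
  obtain ⟨u, hu, rfl⟩ := h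
  obtain ⟨v, hv, rfl⟩ := g
  exact ⟨u * v, by push_cast; rw [hu, hv], by simp⟩

lemma neg {a : ℚ} {x : ZMod p} (h : RedTo p a x) : RedTo p (-a) (-x) := by
  obtain ⟨u, hu, rfl⟩ := h
  exact ⟨-u, by push_cast; rw [hu], by simp⟩

lemma sub {a b : ℚ} {x y : ZMod p} (h : RedTo p a x) (g : RedTo p b y) :
    RedTo p (a - b) (x - y) := by
  simpa [sub_eq_add_neg] using h.add g.neg

lemma pow {a : ℚ} {x : ZMod p} (h : RedTo p a x) (n : ℕ) : RedTo p (a ^ n) (x ^ n) := by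
  obtain ⟨u, hu, rfl⟩ := h
  exact ⟨u ^ n, by push_cast; rw [hu], by simp⟩

lemma sum {ι : Type*} (s : Finset ι) {f : ι → ℚ} {g : ι → ZMod p}
    (h : ∀ i ∈ s, RedTo p (f i) (g i)) : RedTo p (∑ i ∈ s, f i) (∑ i ∈ s, g i) := by
  classical
  induction s using Finset.induction_on with
  | empty => simpa using nat (p := p) 0
  | insert a s ha ih =>
    rw [Finset.sum_insert ha, Finset.sum_insert ha]
    exact (h a (by simp)).add (ih fun i hi => h i (by simp [hi]))

lemma inv {a : ℚ} {x : ZMod p} (h : RedTo p a x) (hx : x ≠ 0) : RedTo p a⁻¹ x⁻¹ := by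
  obtain ⟨u, hu, rfl⟩ := h
  have hu' : IsUnit u := by
    by_contra hn
    apply hx
    rw [← RingHom.mem_ker, PadicInt.ker_toZMod]
    exact (IsLocalRing.mem_maximalIdeal u).2 hn
  obtain ⟨v, hv⟩ := hu'.exists_right_inv
  refine ⟨v, ?_, ?_⟩
  · push_cast
    rw [← hu]
    apply eq_inv_of_mul_eq_one_right
    exact_mod_cast congrArg (fun t : ℤ_[p] => (t : ℚ_[p])) hv
  · apply eq_inv_of_mul_eq_one_right
    rw [← map_mul, hv, map_one]

lemma div {a b : ℚ} {x y : ZMod p} (h : RedTo p a x) (g : RedTo p b y) (hy : y ≠ 0) :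
    RedTo p (a / b) (x / y) := by
  simpa [div_eq_mul_inv] using h.mul (g.inv hy)

lemma unique {a : ℚ} {x y : ZMod p} (h : RedTo p a x) (g : RedTo p a y) : x = y := by
  obtain ⟨u, hu, rfl⟩ := h
  obtain ⟨v, hv, rfl⟩ := g
  have : u = v := Subtype.ext (hu.trans hv.symm)
  rw [this]

lemma norm_le {a : ℚ} (h : RedTo p a 0) : ‖(a : ℚ_[p])‖ ≤ (p : ℝ) ^ (-(1 : ℤ)) := by
  obtain ⟨u, hu, h0⟩ := h
  rw [← RingHom.mem_ker, PadicInt.ker_toZMod, PadicInt.maximalIdeal_eq_span_p] at h0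
  have := (PadicInt.norm_le_pow_iff_mem_span_pow u 1).2 (by simpa using h0)
  rw [← hu]
  simpa using this

end RedTo

lemma natCast_ne_zero_of_lt {p : ℕ} [Fact p.Prime] {n : ℕ} (h0 : 0 < n) (h : n < p) :
    (n : ZMod p) ≠ 0 := by
  rw [Ne, ZMod.natCast_eq_zero_iff]
  exact Nat.not_dvd_of_pos_of_lt h0 h

lemma bernoulli_redTo {p : ℕ} [Fact p.Prime] (n : ℕ) (hn : n + 1 < p) :
    ∃ z, RedTo p (bernoulli n) z := by
  induction n using Nat.strong_induction_on with
  | _ n ih =>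
    have h1 : ∀ k : ℕ, ∃ z, k < n → RedTo p (bernoulli k) z := by
      intro k
      by_cases hk : k < n
      · obtain ⟨z, hz⟩ := ih k hk (by omega)
        exact ⟨z, fun _ => hz⟩
      · exact ⟨0, fun h => absurd h hk⟩
    choose β hβ using h1
    have h2 := sum_bernoulli (n + 1)
    rw [Finset.sum_range_succ] at h2
    have h3 : bernoulli n = (((if n + 1 = 1 then 1 else 0 : ℕ) : ℚ) -
        ∑ k ∈ Finset.range n, ((n + 1).choose k : ℚ) * bernoulli k) / ((n + 1 : ℕ) : ℚ) := by
      rw [eq_div_iff (by positivity)]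
      have : ((n + 1).choose n : ℚ) = ((n + 1 : ℕ) : ℚ) := by simp
      rw [this] at h2
      push_cast at h2 ⊢
      linarith
    rw [h3]
    refine ⟨_, RedTo.div (RedTo.sub (RedTo.nat _) (RedTo.sum _ fun k hk =>
      (RedTo.nat _).mul (hβ k (Finset.mem_range.1 hk)))) (RedTo.nat _)
      (natCast_ne_zero_of_lt (by omega) hn)⟩

lemma bernoulli_half (m : ℕ) :
    2 ^ m * ((Polynomial.bernoulli m).eval (1 / 2 : ℚ) + bernoulli m) = 2 * bernoulli m := by
  have hh := Polynomial.bernoulli_generating_function (1 / 2 : ℚ)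
  have h0 := Polynomial.bernoulli_generating_function (0 : ℚ)
  set G : PowerSeries ℚ := PowerSeries.mk fun n => Polynomial.aeval (1 / 2 : ℚ)
    ((1 / n.factorial : ℚ) • Polynomial.bernoulli n) with hG
  set F : PowerSeries ℚ := PowerSeries.mk fun n => Polynomial.aeval (0 : ℚ)
    ((1 / n.factorial : ℚ) • Polynomial.bernoulli n) with hF
  set E := PowerSeries.rescale (1 / 2 : ℚ) (PowerSeries.exp ℚ) with hE
  have hEE : E * E = PowerSeries.exp ℚ := by
    have := PowerSeries.exp_mul_exp_eq_exp_add (1 / 2 : ℚ) (1 / 2)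
    rw [hE, this]
    norm_num
  have h0' : F * (PowerSeries.exp ℚ - 1) = PowerSeries.X := by
    rw [h0]; simp
  have hr := congrArg (PowerSeries.rescale (1 / 2 : ℚ)) h0'
  rw [map_mul, map_sub, map_one, ← hE, PowerSeries.rescale_X] at hr
  have hne : PowerSeries.exp ℚ - 1 ≠ 0 := by
    intro h
    rw [h, mul_zero] at h0'
    exact PowerSeries.X_ne_zero h0'.symm
  have hC : (2 : PowerSeries ℚ) * PowerSeries.C (1 / 2 : ℚ) = 1 := by
    have : (2 : PowerSeries ℚ) = PowerSeries.C (2 : ℚ) := (map_ofNat PowerSeries.C 2).symm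
    rw [this, ← map_mul]; norm_num
  have key : G + F = 2 * PowerSeries.rescale (1 / 2 : ℚ) F := by
    apply mul_right_cancel₀ hne
    rw [add_mul, hh, h0']
    have : 2 * PowerSeries.rescale (1 / 2 : ℚ) F * (PowerSeries.exp ℚ - 1)
      = 2 * (PowerSeries.rescale (1 / 2 : ℚ) F * (E - 1)) * (E + 1) := by
      rw [← hEE]; ring
    rw [this, hr]
    linear_combination (-PowerSeries.X * (E + 1)) * hC
  have hc := congrArg (PowerSeries.coeff m) key
  have h2 : (2 : PowerSeries ℚ) = PowerSeries.C (2 : ℚ) := (map_ofNat PowerSeries.C 2).symm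
  rw [h2, PowerSeries.coeff_C_mul, PowerSeries.coeff_rescale, map_add, hG, hF,
    PowerSeries.coeff_mk, PowerSeries.coeff_mk] at hc
  simp only [map_smul, Polynomial.coe_aeval_eq_eval, Polynomial.bernoulli_eval_zero,
    smul_eq_mul] at hc
  have hf : (m.factorial : ℚ) ≠ 0 := by positivity
  have h3 : (2 : ℚ) ^ m * (1 / 2) ^ m = 1 := by rw [← mul_pow]; norm_num
  field_simp at hc
  linear_combination (2 : ℚ) ^ m * hc + 2 * bernoulli m * h3

lemma bernoulli_poly_redTo {p : ℕ} [Fact p.Prime] (m : ℕ) (hm : m + 1 < p) :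
    ∃ W : ZMod p → ZMod p, ∀ x z, RedTo p x z →
      RedTo p ((Polynomial.bernoulli m).eval x) (W z) := by
  have h1 : ∀ k : ℕ, ∃ z, k < p - 1 → RedTo p (bernoulli k) z := by
    intro k
    by_cases hk : k < p - 1
    · obtain ⟨z, hz⟩ := bernoulli_redTo (p := p) k (by omega)
      exact ⟨z, fun _ => hz⟩
    · exact ⟨0, fun h => absurd h hk⟩
  choose β hβ using h1
  refine ⟨fun z => ∑ i ∈ Finset.range (m + 1), β i * (m.choose i : ZMod p) * z ^ (m - i), ?_⟩
  intro x z h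
  rw [Polynomial.bernoulli, Polynomial.eval_finsetSum]
  refine RedTo.sum _ fun i hi => ?_
  rw [Polynomial.eval_monomial]
  have := Finset.mem_range.1 hi
  exact ((hβ i (by omega)).mul (RedTo.nat _)).mul (h.pow _)

/-- Half power sum. -/
lemma half_sum {p : ℕ} [Fact p.Prime] (h5 : 5 ≤ p) (b : ZMod p)
    (hb : RedTo p (bernoulli (p - 3)) b) :
    ∑ m ∈ Finset.range ((p + 1) / 2), (m : ZMod p) ^ (p - 4) = -2 * b := by
  obtain ⟨W, hW⟩ := bernoulli_poly_redTo (p := p) (p - 3) (by omega)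
  have hodd : p % 2 = 1 := (Fact.out : p.Prime).eq_two_or_odd.resolve_left (by omega)
  have h2 : (2 : ZMod p) ≠ 0 := by
    exact_mod_cast natCast_ne_zero_of_lt (p := p) (n := 2) (by omega) (by omega)
  have h3 : (3 : ZMod p) ≠ 0 := by
    exact_mod_cast natCast_ne_zero_of_lt (p := p) (n := 3) (by omega) (by omega)
  have hn : (((p + 1) / 2 : ℕ) : ZMod p) = 1 / 2 := by
    rw [eq_div_iff h2]
    have : (p + 1) / 2 * 2 = p + 1 := by omega
    have := congrArg (Nat.cast : ℕ → ZMod p) this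
    push_cast at this
    simpa using this
  have e1 := hW _ _ (RedTo.nat ((p + 1) / 2))
  have e2 : RedTo p ((Polynomial.bernoulli (p - 3)).eval (1 / 2 : ℚ)) (W (1 / 2)) := by
    apply hW
    simpa using (RedTo.nat (p := p) 2).inv (by simpa using h2)
  rw [hn] at e1
  have e3 := bernoulli_half (p - 3)
  have e4 := (((RedTo.nat (p := p) 2).pow (p - 3)).mul (e2.add hb))
  have e5 := (RedTo.nat (p := p) 2).mul hb
  push_cast at e4 e5
  rw [e3] at e4
  have e6 := e4.unique e5
  have hfer : (2 : ZMod p) ^ (p - 3) * 4 = 1 := by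
    have : (2 : ZMod p) ^ (p - 1) = 1 := ZMod.pow_card_sub_one_eq_one h2
    rw [← this, show p - 1 = p - 3 + 2 by omega, pow_add]; norm_num
  have hw : W (1 / 2) = 7 * b := by
    linear_combination 4 * e6 - (W (1 / 2) + b) * hfer
  have f := Polynomial.sum_range_pow_eq_bernoulli_sub ((p + 1) / 2) (p - 4)
  rw [show (p - 4).succ = p - 3 by omega] at f
  have g1 := e1.sub hb
  rw [← f] at g1
  have g2 : RedTo p ((((p - 4 : ℕ) : ℚ) + 1) * ∑ k ∈ Finset.range ((p + 1) / 2), (k : ℚ) ^ (p - 4))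
      ((((p - 4 : ℕ) : ZMod p) + 1) *
        ∑ k ∈ Finset.range ((p + 1) / 2), (k : ZMod p) ^ (p - 4)) := by
    refine RedTo.mul ?_ (RedTo.sum _ fun k _ => (RedTo.nat k).pow _)
    simpa using (RedTo.nat (p := p) (p - 4)).add (RedTo.nat 1)
  have g3 := g2.unique g1
  have hc : ((p - 4 : ℕ) : ZMod p) = -4 := by
    rw [Nat.cast_sub (by omega)]; simp
  rw [hc, hw] at g3
  apply mul_left_cancel₀ h3
  linear_combination -g3

/-- Sum of a nontrivial even power over even residues vanishes. -/
lemma even_sum_pow {p : ℕ} [Fact p.Prime] (h5 : 5 ≤ p) (e : ℕ) (he : Even e) (h0 : 0 < e)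
    (h1 : e < p - 1) :
    ∑ k ∈ (Finset.Icc 1 (p - 1)).filter (fun k => Even k), (k : ZMod p) ^ e = 0 := by
  have hodd : p % 2 = 1 := (Fact.out : p.Prime).eq_two_or_odd.resolve_left (by omega)
  have h2 : (2 : ZMod p) ≠ 0 := by
    exact_mod_cast natCast_ne_zero_of_lt (p := p) (n := 2) (by omega) (by omega)
  have hs := Finset.sum_filter_add_sum_filter_not (Finset.Icc 1 (p - 1)) (fun k => Even k)
    (fun k => (k : ZMod p) ^ e)
  have hr : ∑ k ∈ (Finset.Icc 1 (p - 1)).filter (fun k => ¬ Even k), (k : ZMod p) ^ e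
      = ∑ k ∈ (Finset.Icc 1 (p - 1)).filter (fun k => Even k), (k : ZMod p) ^ e := by
    refine Finset.sum_nbij' (fun k => p - k) (fun k => p - k) ?_ ?_ ?_ ?_ ?_
    · intro k hk
      simp only [Finset.mem_filter, Finset.mem_Icc, Nat.even_iff] at hk ⊢
      omega
    · intro k hk
      simp only [Finset.mem_filter, Finset.mem_Icc, Nat.even_iff] at hk ⊢
      omega
    · intro k hk
      simp only [Finset.mem_filter, Finset.mem_Icc, Nat.even_iff] at hk ⊢
      omega
    · intro k hk
      simp only [Finset.mem_filter, Finset.mem_Icc, Nat.even_iff] at hk ⊢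
      omega
    · intro k hk
      simp only [Finset.mem_filter, Finset.mem_Icc, Nat.even_iff] at hk
      rw [Nat.cast_sub (by omega), ZMod.natCast_self, zero_sub, he.neg_pow]
  have ht : ∑ k ∈ Finset.Icc 1 (p - 1), (k : ZMod p) ^ e = 0 := by
    have hu := FiniteField.sum_pow_lt_card_sub_one (K := ZMod p) e (by rw [ZMod.card]; exact h1)
    rw [← hu]
    have : ∑ k ∈ Finset.Icc 1 (p - 1), (k : ZMod p) ^ e
        = ∑ k ∈ Finset.range p, (k : ZMod p) ^ e := by
      refine Finset.sum_subset ?_ ?_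
      · intro k hk
        simp only [Finset.mem_Icc, Finset.mem_range] at hk ⊢
        omega
      · intro k hk hk'
        simp only [Finset.mem_Icc, Finset.mem_range] at hk hk'
        have : k = 0 := by omega
        subst this
        simp [h0.ne']
    rw [this]
    refine Finset.sum_nbij' (fun k => (k : ZMod p)) (fun z => z.val) ?_ ?_ ?_ ?_ ?_
    · intro k _; simp
    · intro z _; simpa using ZMod.val_lt z
    · intro k hk; exact ZMod.val_cast_of_lt (Finset.mem_range.1 hk)
    · intro z _; simp
    · intro k _; rfl
  rw [hr, ht] at hs
  apply mul_left_cancel₀ h2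
  linear_combination hs

lemma inv_eq_pow' {p : ℕ} [Fact p.Prime] (h5 : 5 ≤ p) (x : ZMod p) : x⁻¹ = x ^ (p - 2) := by
  by_cases hx : x = 0
  · subst hx
    rw [inv_zero, zero_pow (by omega)]
  · symm
    apply eq_inv_of_mul_eq_one_left
    rw [← pow_succ, show p - 2 + 1 = p - 1 by omega]
    exact ZMod.pow_card_sub_one_eq_one hx

lemma even_sum_reindex {p : ℕ} [Fact p.Prime] (h5 : 5 ≤ p) (f : ℕ → ZMod p) :
    ∑ k ∈ (Finset.Icc 1 (p - 1)).filter (fun k => Even k), f k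
      = ∑ m ∈ Finset.Icc 1 ((p - 1) / 2), f (2 * m) := by
  refine Finset.sum_nbij' (fun k => k / 2) (fun m => 2 * m) ?_ ?_ ?_ ?_ ?_
  · intro k hk
    simp only [Finset.mem_filter, Finset.mem_Icc, Nat.even_iff] at hk ⊢
    omega
  · intro k hk
    simp only [Finset.mem_filter, Finset.mem_Icc, Nat.even_iff] at hk ⊢
    omega
  · intro k hk
    simp only [Finset.mem_filter, Finset.mem_Icc, Nat.even_iff] at hk ⊢
    omega
  · intro k hk
    simp
  · intro k hk
    simp only [Finset.mem_filter, Finset.mem_Icc, Nat.even_iff] at hk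
    rw [show 2 * (k / 2) = k by omega]

lemma even_sum_cube {p : ℕ} [Fact p.Prime] (h5 : 5 ≤ p) (b : ZMod p)
    (hb : RedTo p (bernoulli (p - 3)) b) :
    ∑ k ∈ (Finset.Icc 1 (p - 1)).filter (fun k => Even k), (k : ZMod p) ^ (p - 4)
      = -b / 4 := by
  have hodd : p % 2 = 1 := (Fact.out : p.Prime).eq_two_or_odd.resolve_left (by omega)
  have h2 : (2 : ZMod p) ≠ 0 := by
    exact_mod_cast natCast_ne_zero_of_lt (p := p) (n := 2) (by omega) (by omega)
  have h4 : (4 : ZMod p) ≠ 0 := by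
    exact_mod_cast natCast_ne_zero_of_lt (p := p) (n := 4) (by omega) (by omega)
  rw [even_sum_reindex h5]
  have hfer : (2 : ZMod p) ^ (p - 4) * 8 = 1 := by
    have : (2 : ZMod p) ^ (p - 1) = 1 := ZMod.pow_card_sub_one_eq_one h2
    rw [← this, show p - 1 = p - 4 + 3 by omega, pow_add]; norm_num
  have hh := half_sum h5 b hb
  have : ∑ m ∈ Finset.Icc 1 ((p - 1) / 2), (m : ZMod p) ^ (p - 4)
      = ∑ m ∈ Finset.range ((p + 1) / 2), (m : ZMod p) ^ (p - 4) := by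
    refine Finset.sum_subset ?_ ?_
    · intro k hk
      simp only [Finset.mem_Icc, Finset.mem_range] at hk ⊢
      omega
    · intro k hk hk'
      simp only [Finset.mem_Icc, Finset.mem_range] at hk hk'
      have : k = 0 := by omega
      subst this
      rw [Nat.cast_zero, zero_pow (by omega)]
  rw [← this] at hh
  simp only [Nat.cast_mul, mul_pow, ← Finset.mul_sum]
  rw [hh, eq_div_iff h4]
  push_cast
  linear_combination (-b) * hfer

lemma harmonic_mod {p : ℕ} [Fact p.Prime] (h5 : 5 ≤ p) (β : ℕ → ZMod p)
    (hβ : ∀ i, i < p - 1 → RedTo p (bernoulli i) (β i)) (k : ℕ) :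
    ∑ j ∈ Finset.Icc 1 (k - 1), (j : ZMod p)⁻¹
      = -∑ i ∈ Finset.range (p - 1), β i * ((p - 1).choose i : ZMod p) *
          (k : ZMod p) ^ (p - 1 - i) := by
  have h1 : ∑ j ∈ Finset.Icc 1 (k - 1), (j : ZMod p)⁻¹
      = ∑ j ∈ Finset.range k, (j : ZMod p) ^ (p - 2) := by
    simp only [← inv_eq_pow' h5]
    refine Finset.sum_subset ?_ ?_
    · intro j hj
      simp only [Finset.mem_Icc, Finset.mem_range] at hj ⊢
      omega
    · intro j hj hj'
      simp only [Finset.mem_Icc, Finset.mem_range] at hj hj'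
      have : j = 0 := by omega
      subst this
      simp
  have hp : ((p - 1 : ℕ) : ZMod p) = -1 := by
    rw [Nat.cast_sub (by omega)]; simp
  have a1 : RedTo p (∑ j ∈ Finset.range k, (j : ℚ) ^ (p - 2))
      (∑ j ∈ Finset.range k, (j : ZMod p) ^ (p - 2)) :=
    RedTo.sum _ fun j _ => (RedTo.nat j).pow _
  rw [sum_range_pow, show p - 2 + 1 = p - 1 by omega] at a1
  have hq : ((p - 2 : ℕ) : ℚ) + 1 = ((p - 1 : ℕ) : ℚ) := by
    rw [show p - 1 = p - 2 + 1 by omega]; push_cast; rfl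
  rw [hq] at a1
  have a2 := RedTo.sum (p := p) (Finset.range (p - 1)) fun i hi =>
    (((hβ i (Finset.mem_range.1 hi)).mul (RedTo.nat ((p - 1).choose i))).mul
      ((RedTo.nat k).pow (p - 1 - i))).div (RedTo.nat (p - 1))
      (natCast_ne_zero_of_lt (by omega) (by omega))
  rw [h1, a1.unique a2, hp, ← Finset.sum_neg_distrib]
  refine Finset.sum_congr rfl fun i _ => ?_
  rw [div_neg, div_one]

theorem double_sum_jkk (p : ℕ) [Fact p.Prime] (h5 : 5 ≤ p) :
    ‖(((∑ k ∈ (Finset.Icc 1 (p - 1)).filter (fun k => Even k),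
          ∑ j ∈ Finset.Icc 1 (k - 1), (1 : ℚ) / (j * (k : ℚ) ^ 2))
        - (5 / 8) * bernoulli (p - 3) : ℚ) : ℚ_[p])‖
      ≤ (p : ℝ) ^ (-(1 : ℤ)) := by
  have hodd : p % 2 = 1 := (Fact.out : p.Prime).eq_two_or_odd.resolve_left (by omega)
  have h2 : (2 : ZMod p) ≠ 0 := by
    exact_mod_cast natCast_ne_zero_of_lt (p := p) (n := 2) (by omega) (by omega)
  have h8 : (8 : ZMod p) ≠ 0 := by
    have : (8 : ZMod p) = 2 ^ 3 := by norm_num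
    rw [this]; exact pow_ne_zero _ h2
  have h4 : (4 : ZMod p) ≠ 0 := by
    have : (4 : ZMod p) = 2 ^ 2 := by norm_num
    rw [this]; exact pow_ne_zero _ h2
  have hp : ((p - 1 : ℕ) : ZMod p) = -1 := by
    rw [Nat.cast_sub (by omega)]; simp
  have hex : ∀ k : ℕ, ∃ z, k < p - 1 → RedTo p (bernoulli k) z := by
    intro k
    by_cases hk : k < p - 1
    · obtain ⟨z, hz⟩ := bernoulli_redTo (p := p) k (by omega)
      exact ⟨z, fun _ => hz⟩
    · exact ⟨0, fun h => absurd h hk⟩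
  choose β hβ using hex
  have hb := hβ (p - 3) (by omega)
  set S := (Finset.Icc 1 (p - 1)).filter (fun k => Even k) with hS
  have hSmem : ∀ k ∈ S, 1 ≤ k ∧ k < p := by
    intro k hk
    simp only [hS, Finset.mem_filter, Finset.mem_Icc] at hk
    omega
  -- reduction of the double sum
  have r1 : RedTo p (∑ k ∈ S, ∑ j ∈ Finset.Icc 1 (k - 1), (1 : ℚ) / (j * (k : ℚ) ^ 2))
      (∑ k ∈ S, ∑ j ∈ Finset.Icc 1 (k - 1), (j : ZMod p)⁻¹ * ((k : ZMod p) ^ 2)⁻¹) := by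
    refine RedTo.sum _ fun k hk => RedTo.sum _ fun j hj => ?_
    have hk' := hSmem k hk
    rw [Finset.mem_Icc] at hj
    rw [one_div, mul_inv]
    exact ((RedTo.nat j).inv (natCast_ne_zero_of_lt (by omega) (by omega))).mul
      (((RedTo.nat k).pow 2).inv (pow_ne_zero _ (natCast_ne_zero_of_lt (by omega) (by omega))))
  have r2 : RedTo p ((5 / 8) * bernoulli (p - 3)) ((5 / 8) * β (p - 3)) := by
    refine RedTo.mul ?_ hb
    have := (RedTo.nat (p := p) 5).div (RedTo.nat 8) (by exact_mod_cast h8)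
    exact_mod_cast this
  -- swap the sums
  have s1 : ∑ k ∈ S, ∑ j ∈ Finset.Icc 1 (k - 1), (j : ZMod p)⁻¹ * ((k : ZMod p) ^ 2)⁻¹
      = ∑ i ∈ Finset.range (p - 1), -(β i * ((p - 1).choose i : ZMod p)) *
          ∑ k ∈ S, (k : ZMod p) ^ (p - 1 - i) * ((k : ZMod p) ^ 2)⁻¹ := by
    simp only [Finset.mul_sum]
    rw [Finset.sum_comm]
    refine Finset.sum_congr rfl fun k _ => ?_
    rw [← Finset.sum_mul, harmonic_mod h5 β hβ k, ← Finset.sum_neg_distrib, Finset.sum_mul]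
    refine Finset.sum_congr rfl fun i _ => ?_
    ring
  have s2 : ∀ i, i + 3 ≤ p → ∑ k ∈ S, (k : ZMod p) ^ (p - 1 - i) * ((k : ZMod p) ^ 2)⁻¹
      = ∑ k ∈ S, (k : ZMod p) ^ (p - 3 - i) := by
    intro i hi
    refine Finset.sum_congr rfl fun k hk => ?_
    have hk' := hSmem k hk
    have hk0 : (k : ZMod p) ≠ 0 := natCast_ne_zero_of_lt (by omega) (by omega)
    rw [show p - 1 - i = p - 3 - i + 2 by omega, pow_add, mul_inv_cancel_right₀ (pow_ne_zero _ hk0)]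
  have hb1 : β 1 = -1 / 2 := by
    have a := hβ 1 (by omega)
    rw [bernoulli_one] at a
    have b := ((RedTo.nat (p := p) 1).neg).div (RedTo.nat 2) (by exact_mod_cast h2)
    push_cast at b
    exact a.unique b
  have hbodd : ∀ i, i < p - 1 → 1 < i → i % 2 = 1 → β i = 0 := by
    intro i hi h1 ho
    have a := hβ i hi
    rw [bernoulli_eq_zero_of_odd (Nat.odd_iff.2 ho) h1] at a
    have b := RedTo.nat (p := p) 0
    push_cast at b
    exact a.unique b
  have hch : ((p - 1).choose (p - 3) : ZMod p) = 1 := by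
    have e1 : (p - 1).choose (p - 3) = (p - 1).choose 2 := by
      rw [← Nat.choose_symm (by omega : 2 ≤ p - 1)]
      congr 1
    have e2 : (p - 1).choose 2 * 2 = (p - 1) * (p - 2) := by
      have := Nat.choose_two_right (p - 1)
      rw [this]
      exact Nat.div_mul_cancel (by
        rw [show p - 1 - 1 = p - 2 by omega]
        exact Dvd.dvd.mul_right (by omega) _)
    have e3 := congrArg (Nat.cast : ℕ → ZMod p) e2
    have hp2 : ((p - 2 : ℕ) : ZMod p) = -2 := by
      rw [Nat.cast_sub (by omega)]; simp
    rw [Nat.cast_mul, Nat.cast_mul, hp, hp2] at e3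
    rw [e1]
    apply mul_right_cancel₀ h2
    push_cast at e3
    rw [e3]; ring
  have hcard : (∑ k ∈ S, (k : ZMod p) ^ 0) = -1 / 2 := by
    rw [hS, even_sum_reindex h5 (fun k => (k : ZMod p) ^ 0)]
    simp only [pow_zero, Finset.sum_const, Nat.card_Icc, nsmul_eq_mul, mul_one]
    rw [eq_div_iff h2, ← hp]
    have : ((p - 1) / 2 + 1 - 1) * 2 = p - 1 := by omega
    exact_mod_cast congrArg (Nat.cast : ℕ → ZMod p) this
  have s3 : ∑ k ∈ S, ∑ j ∈ Finset.Icc 1 (k - 1), (j : ZMod p)⁻¹ * ((k : ZMod p) ^ 2)⁻¹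
      = 5 / 8 * β (p - 3) := by
    rw [s1, Finset.sum_eq_add_of_mem 1 (p - 3) (by simp; omega) (by simp; omega) (by omega)]
    · rw [s2 1 (by omega), s2 (p - 3) (by omega), Nat.sub_self, hcard, hch, hb1,
        Nat.choose_one_right, hp, show p - 3 - 1 = p - 4 by omega, hS, even_sum_cube h5 _ hb]
      have : (8 : ZMod p) = 2 ^ 3 := by norm_num
      have h4' : (4 : ZMod p) = 2 ^ 2 := by norm_num
      rw [this, h4']
      field_simp
      ring
    · intro i hi hne
      rw [Finset.mem_range] at hi
      rcases Nat.mod_two_eq_zero_or_one i with h | h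
      · rw [s2 i (by omega), hS, even_sum_pow h5 (p - 3 - i) (by rw [Nat.even_iff]; omega)
          (by omega) (by omega), mul_zero]
      · rw [hbodd i hi (by omega) h]; simp
  apply RedTo.norm_le
  have := r1.sub r2
  rwa [s3, sub_self] at this
end

section
/- For every prime p ≥ 5, Σ_{1 ≤ j < k ≤ p-1, k even} 1/(j^2 k) ≡ -(3/8) B_{p-3} (mod p), as a congruence of p-integral rationals. -/
namespace DSJJK

open Finset

/-- The rational `q` is `p`-integral with reduction `z` mod `p`. -/
def Red (p : ℕ) [Fact p.Prime] (q : ℚ) (z : ZMod p) : Prop :=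
  ∃ x : ℤ_[p], (x : ℚ_[p]) = (q : ℚ_[p]) ∧ PadicInt.toZMod x = z

variable {p : ℕ} [Fact p.Prime]

lemma Red.add {q r : ℚ} {z w : ZMod p} (h : Red p q z) (h' : Red p r w) :
    Red p (q + r) (z + w) := by
  obtain ⟨x, hx, rfl⟩ := h
  obtain ⟨y, hy, rfl⟩ := h'
  exact ⟨x + y, by push_cast; rw [hx, hy], map_add _ _ _⟩

lemma Red.mul {q r : ℚ} {z w : ZMod p} (h : Red p q z) (h' : Red p r w) :
    Red p (q * r) (z * w) := by
  obtain ⟨x, hx, rfl⟩ := h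
  obtain ⟨y, hy, rfl⟩ := h'
  exact ⟨x * y, by push_cast; rw [hx, hy], map_mul _ _ _⟩

lemma Red.nat (n : ℕ) : Red p (n : ℚ) (n : ZMod p) :=
  ⟨n, by push_cast; rfl, map_natCast _ _⟩

lemma Red.neg {q : ℚ} {z : ZMod p} (h : Red p q z) : Red p (-q) (-z) := by
  obtain ⟨x, hx, rfl⟩ := h
  exact ⟨-x, by push_cast; rw [hx], map_neg _ _⟩

lemma Red.sub {q r : ℚ} {z w : ZMod p} (h : Red p q z) (h' : Red p r w) :
    Red p (q - r) (z - w) := by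
  rw [sub_eq_add_neg, sub_eq_add_neg]; exact h.add h'.neg

lemma Red.pow {q : ℚ} {z : ZMod p} (h : Red p q z) (n : ℕ) : Red p (q ^ n) (z ^ n) := by
  obtain ⟨x, hx, rfl⟩ := h
  exact ⟨x ^ n, by push_cast; rw [hx], map_pow _ _ _⟩

lemma Red.sum {ι : Type*} (s : Finset ι) {f : ι → ℚ} {g : ι → ZMod p}
    (h : ∀ i ∈ s, Red p (f i) (g i)) : Red p (∑ i ∈ s, f i) (∑ i ∈ s, g i) := by
  classical
  induction s using Finset.induction_on with
  | empty => simpa using Red.nat (p := p) 0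
  | insert a s ha ih =>
    rw [Finset.sum_insert ha, Finset.sum_insert ha]
    exact (h a (by simp)).add (ih fun i hi => h i (by simp [hi]))

lemma toZMod_eq_zero_iff (x : ℤ_[p]) : PadicInt.toZMod x = 0 ↔ ‖x‖ < 1 := by
  rw [← RingHom.mem_ker, PadicInt.ker_toZMod, IsLocalRing.mem_maximalIdeal, PadicInt.mem_nonunits]

lemma Red.inv {q : ℚ} {z : ZMod p} (h : Red p q z) (hz : z ≠ 0) : Red p q⁻¹ z⁻¹ := by
  obtain ⟨x, hx, rfl⟩ := h
  have hu : IsUnit x := by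
    by_contra hc
    exact hz ((toZMod_eq_zero_iff x).2 (PadicInt.not_isUnit_iff.1 hc))
  obtain ⟨y, hy⟩ := hu.exists_right_inv
  refine ⟨y, ?_, ?_⟩
  · have : (x : ℚ_[p]) * y = 1 := by exact_mod_cast congrArg (fun t : ℤ_[p] => (t : ℚ_[p])) hy
    push_cast
    rw [← hx]
    exact eq_inv_of_mul_eq_one_right this
  · have := congrArg PadicInt.toZMod hy
    rw [map_mul, map_one] at this
    exact eq_inv_of_mul_eq_one_right this

lemma Red.unique {q : ℚ} {z w : ZMod p} (h : Red p q z) (h' : Red p q w) : z = w := by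
  obtain ⟨x, hx, rfl⟩ := h
  obtain ⟨y, hy, rfl⟩ := h'
  have : x = y := Subtype.ext (hx.trans hy.symm)
  rw [this]

lemma Red.norm {q : ℚ} (h : Red p q 0) : ‖(q : ℚ_[p])‖ ≤ (p : ℝ) ^ (-(1 : ℤ)) := by
  obtain ⟨x, hx, h0⟩ := h
  rw [← hx, ← PadicInt.norm_def]
  rw [toZMod_eq_zero_iff] at h0
  rw [PadicInt.norm_le_pow_iff_norm_lt_pow_add_one]
  simpa using h0

lemma cast_ne {n : ℕ} (h0 : 0 < n) (h : n < p) : (n : ZMod p) ≠ 0 := by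
  rw [Ne, ZMod.natCast_eq_zero_iff]
  exact fun hd => absurd (Nat.le_of_dvd h0 hd) (by omega)

lemma red_bernoulli (n : ℕ) (hn : n + 1 < p) : ∃ z, Red p (bernoulli n) z := by
  induction n using Nat.strong_induction_on with
  | _ n ih =>
    have key := _root_.sum_bernoulli (n + 1)
    rw [Finset.sum_range_succ] at key
    have hch : ((n + 1).choose n : ℚ) = ((n + 1 : ℕ) : ℚ) := by simp
    rw [hch] at key
    have hb : bernoulli n = ((((if n + 1 = 1 then 1 else 0 : ℕ)) : ℚ) -
        ∑ k ∈ range n, ((n + 1).choose k : ℚ) * bernoulli k) * (((n + 1 : ℕ) : ℚ))⁻¹ := by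
      have : (((n + 1 : ℕ)) : ℚ) ≠ 0 := by positivity
      rw [eq_mul_inv_iff_mul_eq₀ this]
      push_cast at key ⊢
      linarith
    have : ∀ k, ∃ z, k < n → Red p (bernoulli k) z := by
      intro k
      by_cases hk : k < n
      · obtain ⟨z, hz⟩ := ih k hk (by omega)
        exact ⟨z, fun _ => hz⟩
      · exact ⟨0, fun h => absurd h hk⟩
    choose g hg using this
    rw [hb]
    exact ⟨_, ((Red.nat _).sub (Red.sum _ fun k hk =>
      (Red.nat _).mul (hg k (by simpa using hk)))).mul ((Red.nat _).inv (cast_ne (by omega) hn))⟩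

lemma exists_beta (p : ℕ) [Fact p.Prime] :
    ∃ β : ℕ → ZMod p, ∀ n, n + 1 < p → Red p (bernoulli n) (β n) := by
  have : ∀ n, ∃ z : ZMod p, n + 1 < p → Red p (bernoulli n) z := by
    intro n
    by_cases h : n + 1 < p
    · obtain ⟨z, hz⟩ := red_bernoulli n h
      exact ⟨z, fun _ => hz⟩
    · exact ⟨0, fun h' => absurd h' h⟩
  choose g hg using this
  exact ⟨g, hg⟩

lemma faulhaber {β : ℕ → ZMod p} (hβ : ∀ n, n + 1 < p → Red p (bernoulli n) (β n))
    (n s : ℕ) (hs : s + 1 < p) :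
    ((s + 1 : ℕ) : ZMod p) * ∑ k ∈ range n, (k : ZMod p) ^ s =
      ∑ i ∈ range (s + 1), β i * ((s + 1).choose i : ZMod p) * (n : ZMod p) ^ (s + 1 - i) := by
  have h := sum_range_pow n s
  rw [← Finset.sum_div, eq_div_iff (by positivity), mul_comm] at h
  have h1 : Red p (((s + 1 : ℕ) : ℚ) * ∑ k ∈ range n, (k : ℚ) ^ s)
      (((s + 1 : ℕ) : ZMod p) * ∑ k ∈ range n, (k : ZMod p) ^ s) :=
    (Red.nat _).mul (Red.sum _ fun k _ => (Red.nat _).pow _)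
  refine h1.unique ?_
  push_cast
  rw [h]
  refine Red.sum _ fun i hi => ((hβ i ?_).mul (Red.nat _)).mul ((Red.nat _).pow _)
  have := Finset.mem_range.1 hi
  omega

lemma bern_half (k : ℕ) :
    ∑ i ∈ range (k + 1), bernoulli i * (k.choose i : ℚ) * ((2 : ℕ) : ℚ)⁻¹ ^ (k - i) =
      (2 * (((2 : ℕ) : ℚ) ^ k)⁻¹ - 1) * bernoulli k := by
  have h := bernoulliFun_eval_half k
  have h2 : bernoulliFun k 2⁻¹ = ((Polynomial.eval (2⁻¹ : ℚ) (Polynomial.bernoulli k) : ℚ) : ℝ) := by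
    rw [bernoulliFun, Polynomial.eval_map_algebraMap]
    have := Polynomial.aeval_algebraMap_apply ℝ (2⁻¹ : ℚ) (Polynomial.bernoulli k)
    simpa using this
  rw [h2] at h
  have h3 : Polynomial.eval (2⁻¹ : ℚ) (Polynomial.bernoulli k) = (2 / 2 ^ k - 1) * bernoulli k := by
    apply Rat.cast_injective (α := ℝ)
    rw [h]
    push_cast
    rfl
  rw [div_eq_mul_inv] at h3
  push_cast
  rw [← h3, Polynomial.bernoulli_def, Polynomial.eval_finsetSum]
  simp_rw [Polynomial.eval_monomial]
  rw [← Finset.sum_flip]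
  refine Finset.sum_congr rfl fun i hi => ?_
  have : i ≤ k := by have := Finset.mem_range.1 hi; omega
  rw [Nat.sub_sub_self this, Nat.choose_symm this]

lemma fermat {a : ZMod p} (h : a ≠ 0) : a ^ (p - 1) = 1 := ZMod.pow_card_sub_one_eq_one h

lemma half_sum {β : ℕ → ZMod p} (hβ : ∀ n, n + 1 < p → Red p (bernoulli n) (β n)) (h5 : 5 ≤ p) :
    ∑ k ∈ range ((p + 1) / 2), (k : ZMod p) ^ (p - 4) = -2 * β (p - 3) := by
  have hodd : p % 2 = 1 := (Fact.out : p.Prime).eq_two_or_odd.resolve_left (by omega)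
  have h2 : (2 : ZMod p) ≠ 0 := by exact_mod_cast cast_ne (p := p) (n := 2) (by omega) (by omega)
  have h3 : (3 : ZMod p) ≠ 0 := by exact_mod_cast cast_ne (p := p) (n := 3) (by omega) (by omega)
  have hM : (((p + 1) / 2 : ℕ) : ZMod p) = ((2 : ℕ) : ZMod p)⁻¹ := by
    apply eq_inv_of_mul_eq_one_left
    rw [← Nat.cast_mul, Nat.div_mul_cancel (by omega)]
    simp
  have hf := faulhaber hβ ((p + 1) / 2) (p - 4) (by omega)
  rw [show p - 4 + 1 = p - 3 by omega, hM] at hf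
  have hb : ∑ i ∈ range (p - 3 + 1), β i * ((p - 3).choose i : ZMod p) *
      ((2 : ℕ) : ZMod p)⁻¹ ^ (p - 3 - i) =
      (((2 : ℕ) : ZMod p) * (((2 : ℕ) : ZMod p) ^ (p - 3))⁻¹ - ((1 : ℕ) : ZMod p)) * β (p - 3) := by
    have h1 := bern_half (p - 3)
    have r1 : Red p (∑ i ∈ range (p - 3 + 1), bernoulli i * ((p - 3).choose i : ℚ) *
        ((2 : ℕ) : ℚ)⁻¹ ^ (p - 3 - i)) (∑ i ∈ range (p - 3 + 1), β i * ((p - 3).choose i : ZMod p) *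
      ((2 : ℕ) : ZMod p)⁻¹ ^ (p - 3 - i)) := by
      refine Red.sum _ fun i hi => ((hβ i ?_).mul (Red.nat _)).mul
        (((Red.nat _).inv (by exact_mod_cast h2)).pow _)
      have := Finset.mem_range.1 hi
      omega
    refine r1.unique ?_
    rw [h1]
    have r2 := (((Red.nat (p := p) 2).mul (((Red.nat (p := p) 2).pow (p - 3)).inv
      (pow_ne_zero _ (by exact_mod_cast h2)))).sub (Red.nat (p := p) 1)).mul (hβ (p - 3) (by omega))
    exact_mod_cast r2
  rw [Finset.sum_range_succ, ← hf] at hb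
  have hc : ((p - 3 : ℕ) : ZMod p) = -3 := by
    rw [Nat.cast_sub (by omega)]; simp
  have h4 : (((2 : ℕ) : ZMod p) ^ (p - 3))⁻¹ = 4 := by
    apply inv_eq_of_mul_eq_one_right
    have := fermat h2
    rw [show p - 1 = (p - 3) + 2 by omega, pow_add] at this
    push_cast
    linear_combination this
  rw [hc, h4] at hb
  simp only [Nat.sub_self, pow_zero, Nat.choose_self] at hb
  push_cast at hb
  apply mul_left_cancel₀ h3
  linear_combination -hb

/-- power sum over even numbers -/
def E (p t : ℕ) : ZMod p := ∑ k ∈ (Icc 1 (p - 1)).filter (fun k => Even k), (k : ZMod p) ^ t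

lemma E_half (h5 : 5 ≤ p) :
    E p (p - 4) = 2 ^ (p - 4) * ∑ k ∈ range ((p + 1) / 2), (k : ZMod p) ^ (p - 4) := by
  have hodd : p % 2 = 1 := (Fact.out : p.Prime).eq_two_or_odd.resolve_left (by omega)
  rw [show (p + 1) / 2 = (p - 1) / 2 + 1 by omega, Finset.sum_range_succ', Nat.cast_zero,
    zero_pow (by omega), add_zero, Finset.mul_sum, E]
  symm
  refine Finset.sum_bij (fun k _ => 2 * (k + 1)) ?_ ?_ ?_ ?_
  · intro a ha
    have := Finset.mem_range.1 ha
    simp only [Finset.mem_filter, Finset.mem_Icc]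
    exact ⟨by omega, even_two_mul _⟩
  · intro a _ b _ h
    omega
  · intro b hb
    simp only [Finset.mem_filter, Finset.mem_Icc] at hb
    obtain ⟨⟨h1, h2⟩, c, hc⟩ := hb
    exact ⟨c - 1, Finset.mem_range.2 (by omega), by omega⟩
  · intro a _
    push_cast
    rw [mul_pow]

lemma E_even (h5 : 5 ≤ p) (t : ℕ) (ht : Even t) :
    2 * E p t = ∑ k ∈ Icc 1 (p - 1), (k : ZMod p) ^ t := by
  have hodd : p % 2 = 1 := (Fact.out : p.Prime).eq_two_or_odd.resolve_left (by omega)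
  rw [← Finset.sum_filter_add_sum_filter_not (Icc 1 (p - 1)) (fun k => Even k), two_mul]
  unfold E
  congr 1
  refine Finset.sum_bij (fun k _ => p - k) ?_ ?_ ?_ ?_
  · intro a ha
    simp only [Finset.mem_filter, Finset.mem_Icc, Nat.even_iff] at ha ⊢
    omega
  · intro a ha b hb h
    simp only [Finset.mem_filter, Finset.mem_Icc] at ha hb
    omega
  · intro b hb
    simp only [Finset.mem_filter, Finset.mem_Icc, Nat.even_iff] at hb
    refine ⟨p - b, ?_, by omega⟩
    simp only [Finset.mem_filter, Finset.mem_Icc, Nat.even_iff]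
    omega
  · intro a ha
    simp only [Finset.mem_filter, Finset.mem_Icc] at ha
    rw [Nat.cast_sub (by omega)]
    simp [ht.neg_pow]

lemma E_zero (h5 : 5 ≤ p) : 2 * E p 0 = -1 := by
  rw [E_even h5 0 (by simp)]
  simp [Nat.cast_sub (show 1 ≤ p by omega)]

lemma E_vanish {β : ℕ → ZMod p} (hβ : ∀ n, n + 1 < p → Red p (bernoulli n) (β n)) (h5 : 5 ≤ p)
    (t : ℕ) (ht : Even t) (h0 : 0 < t) (htp : t + 1 < p) : E p t = 0 := by
  have h2 : (2 : ZMod p) ≠ 0 := by exact_mod_cast cast_ne (p := p) (n := 2) (by omega) (by omega)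
  have hf := faulhaber hβ p t htp
  have hz : ∑ i ∈ range (t + 1), β i * ((t + 1).choose i : ZMod p) * (p : ZMod p) ^ (t + 1 - i)
      = 0 := by
    refine Finset.sum_eq_zero fun i hi => ?_
    have := Finset.mem_range.1 hi
    rw [ZMod.natCast_self, zero_pow (by omega), mul_zero]
  rw [hz, mul_eq_zero, or_iff_right (cast_ne (by omega) htp)] at hf
  have he := E_even h5 t ht
  have : ∑ k ∈ Icc 1 (p - 1), (k : ZMod p) ^ t = ∑ k ∈ range p, (k : ZMod p) ^ t := by
    refine Finset.sum_subset ?_ ?_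
    · intro k hk
      simp only [Finset.mem_Icc, Finset.mem_range] at hk ⊢
      omega
    · intro k hk hk'
      simp only [Finset.mem_Icc, Finset.mem_range] at hk hk'
      have : k = 0 := by omega
      subst this
      simp; omega
  rw [this, hf] at he
  exact (mul_eq_zero.1 he).resolve_left h2

lemma inv_eq_pow {a : ZMod p} (h5 : 5 ≤ p) (h : a ≠ 0) : a⁻¹ = a ^ (p - 2) := by
  apply inv_eq_of_mul_eq_one_right
  rw [← pow_succ', show p - 2 + 1 = p - 1 by omega, fermat h]

lemma inv_sq_eq_pow {a : ZMod p} (h5 : 5 ≤ p) (h : a ≠ 0) : (a ^ 2)⁻¹ = a ^ (p - 3) := by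
  apply inv_eq_of_mul_eq_one_right
  rw [← pow_add, show 2 + (p - 3) = p - 1 by omega, fermat h]

lemma S_eq {β : ℕ → ZMod p} (hβ : ∀ n, n + 1 < p → Red p (bernoulli n) (β n)) (h5 : 5 ≤ p) :
    ((p - 2 : ℕ) : ZMod p) * (∑ k ∈ (Icc 1 (p - 1)).filter (fun k => Even k),
      ∑ j ∈ Icc 1 (k - 1), ((j : ZMod p) ^ 2 * k)⁻¹) =
    ∑ i ∈ range (p - 2), β i * ((p - 2).choose i : ZMod p) * E p (p - 3 - i) := by
  have hin : ∀ k ∈ (Icc 1 (p - 1)).filter (fun k => Even k),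
      ((p - 2 : ℕ) : ZMod p) * ∑ j ∈ Icc 1 (k - 1), ((j : ZMod p) ^ 2 * k)⁻¹ =
      ∑ i ∈ range (p - 2), β i * ((p - 2).choose i : ZMod p) * (k : ZMod p) ^ (p - 3 - i) := by
    intro k hk
    simp only [Finset.mem_filter, Finset.mem_Icc] at hk
    have hk0 : (k : ZMod p) ≠ 0 := cast_ne (by omega) (by omega)
    have hsum : ∑ j ∈ Icc 1 (k - 1), ((j : ZMod p) ^ 2 * k)⁻¹ =
        (∑ j ∈ range k, (j : ZMod p) ^ (p - 3)) * (k : ZMod p)⁻¹ := by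
      rw [Finset.sum_mul]
      have hs : Icc 1 (k - 1) ⊆ range k := by
        intro j hj
        simp only [Finset.mem_Icc, Finset.mem_range] at hj ⊢
        omega
      rw [← Finset.sum_subset hs]
      · refine Finset.sum_congr rfl fun j hj => ?_
        simp only [Finset.mem_Icc] at hj
        rw [mul_inv, inv_sq_eq_pow h5 (cast_ne (by omega) (by omega))]
      · intro j hj hj'
        simp only [Finset.mem_Icc, Finset.mem_range] at hj hj'
        have : j = 0 := by omega
        subst this
        rw [Nat.cast_zero, zero_pow (by omega), zero_mul]
    have hf := faulhaber hβ k (p - 3) (by omega)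
    rw [show p - 3 + 1 = p - 2 by omega] at hf
    rw [hsum, ← mul_assoc, hf, Finset.sum_mul]
    refine Finset.sum_congr rfl fun i hi => ?_
    have := Finset.mem_range.1 hi
    rw [show p - 2 - i = (p - 3 - i) + 1 by omega, pow_succ]
    field_simp
  rw [Finset.mul_sum, Finset.sum_congr rfl hin, Finset.sum_comm]
  refine Finset.sum_congr rfl fun i _ => ?_
  rw [E, Finset.mul_sum]

lemma S_val {β : ℕ → ZMod p} (hβ : ∀ n, n + 1 < p → Red p (bernoulli n) (β n)) (h5 : 5 ≤ p) :
    8 * (∑ k ∈ (Icc 1 (p - 1)).filter (fun k => Even k),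
      ∑ j ∈ Icc 1 (k - 1), ((j : ZMod p) ^ 2 * k)⁻¹) = -3 * β (p - 3) := by
  have hodd : p % 2 = 1 := (Fact.out : p.Prime).eq_two_or_odd.resolve_left (by omega)
  have h2 : (2 : ZMod p) ≠ 0 := by exact_mod_cast cast_ne (p := p) (n := 2) (by omega) (by omega)
  have hS := S_eq hβ h5
  set S := (∑ k ∈ (Icc 1 (p - 1)).filter (fun k => Even k),
      ∑ j ∈ Icc 1 (k - 1), ((j : ZMod p) ^ 2 * k)⁻¹)
  have hsub : ({1, p - 3} : Finset ℕ) ⊆ range (p - 2) := by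
    intro i hi
    simp only [Finset.mem_insert, Finset.mem_singleton, Finset.mem_range] at hi ⊢
    omega
  rw [← Finset.sum_subset hsub, Finset.sum_pair (by omega)] at hS
  · have hc : ((p - 2 : ℕ) : ZMod p) = -2 := by
      rw [Nat.cast_sub (by omega)]; simp
    have hch : (p - 2).choose (p - 3) = p - 2 := by
      rw [show p - 2 = (p - 3) + 1 by omega, Nat.choose_succ_self_right]
    rw [Nat.choose_one_right, hch, hc, Nat.sub_self, show p - 3 - 1 = p - 4 by omega] at hS
    have hb1 : β 1 * 2 = -1 := by
      have r := (hβ 1 (by omega)).mul (Red.nat (p := p) 2)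
      have r' := (Red.nat (p := p) 1).neg
      have e : bernoulli 1 * ((2 : ℕ) : ℚ) = -((1 : ℕ) : ℚ) := by
        rw [bernoulli_one]; norm_num
      rw [e] at r
      have := r.unique r'
      exact_mod_cast this
    have hE0 := E_zero h5
    have hE := E_half h5
    rw [half_sum hβ h5] at hE
    have hp : (2 : ZMod p) ^ (p - 4) * 8 = 1 := by
      have := fermat h2
      rw [show p - 1 = (p - 4) + 3 by omega, pow_add] at this
      linear_combination this
    have hS' : S = β 1 * E p (p - 4) + β (p - 3) * E p 0 := by
      apply mul_left_cancel₀ h2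
      linear_combination -hS
    rw [hS', hE]
    linear_combination (-2 * β 1 * β (p - 3)) * hp - β (p - 3) * hb1 + 4 * β (p - 3) * hE0
  · intro i hi hi'
    simp only [Finset.mem_insert, Finset.mem_singleton, Finset.mem_range, not_or] at hi hi'
    rcases Nat.even_or_odd i with he | ho
    · rw [E_vanish hβ h5 _ _ (by omega) (by omega), mul_zero]
      rw [Nat.even_iff] at *
      omega
    · have hb : β i = 0 := by
        have r := hβ i (by omega)
        have h1 : 1 < i := by
          rw [Nat.odd_iff] at ho
          omega
        rw [bernoulli_eq_zero_of_odd ho h1] at r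
        have r' := Red.nat (p := p) 0
        have := r.unique (by simpa using r')
        exact this
      rw [hb]; ring

end DSJJK

open DSJJK in
theorem double_sum_jjk (p : ℕ) [Fact p.Prime] (h5 : 5 ≤ p) :
    ‖(((∑ k ∈ (Finset.Icc 1 (p - 1)).filter (fun k => Even k),
          ∑ j ∈ Finset.Icc 1 (k - 1), (1 : ℚ) / ((j : ℚ) ^ 2 * k))
        - (-(3 / 8) * bernoulli (p - 3)) : ℚ) : ℚ_[p])‖
      ≤ (p : ℝ) ^ (-(1 : ℤ)) := by
  obtain ⟨β, hβ⟩ := exists_beta p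
  have h2 : (2 : ZMod p) ≠ 0 := by exact_mod_cast cast_ne (p := p) (n := 2) (by omega) (by omega)
  have h8 : ((8 : ℕ) : ZMod p) ≠ 0 := by
    have : ((8 : ℕ) : ZMod p) = 2 ^ 3 := by norm_num
    rw [this]; exact pow_ne_zero _ h2
  apply Red.norm
  have r1 : Red p (∑ k ∈ (Finset.Icc 1 (p - 1)).filter (fun k => Even k),
          ∑ j ∈ Finset.Icc 1 (k - 1), (1 : ℚ) / ((j : ℚ) ^ 2 * k))
      (∑ k ∈ (Finset.Icc 1 (p - 1)).filter (fun k => Even k),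
          ∑ j ∈ Finset.Icc 1 (k - 1), ((j : ZMod p) ^ 2 * k)⁻¹) := by
    refine Red.sum _ fun k hk => Red.sum _ fun j hj => ?_
    simp only [Finset.mem_filter, Finset.mem_Icc] at hk hj
    rw [one_div]
    exact (((Red.nat _).pow _).mul (Red.nat _)).inv
      (mul_ne_zero (pow_ne_zero _ (cast_ne (by omega) (by omega))) (cast_ne (by omega) (by omega)))
  have r2 : Red p (-(3 / 8) * bernoulli (p - 3))
      (-(((3 : ℕ) : ZMod p) * ((8 : ℕ) : ZMod p)⁻¹) * β (p - 3)) := by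
    have := ((Red.nat (p := p) 3).mul ((Red.nat (p := p) 8).inv h8)).neg.mul (hβ (p - 3) (by omega))
    rw [div_eq_mul_inv]
    exact_mod_cast this
  have r := r1.sub r2
  have hv := S_val hβ h5
  convert r using 1
  symm
  rw [sub_eq_zero]
  apply mul_left_cancel₀ h8
  have : ((8 : ℕ) : ZMod p) * (-(((3 : ℕ) : ZMod p) * ((8 : ℕ) : ZMod p)⁻¹) * β (p - 3)) =
      -3 * β (p - 3) := by
    field_simp
    push_cast
    ring
  rw [this]
  exact_mod_cast hv
end

section
/- For every prime p ≥ 5, Σ_{1 ≤ j < k ≤ p-1, k even} 1/(jk) ≡ (1/2)(q_2(p)^2 - p q_2(p)^3) - (7/16) p B_{p-3} (mod p^2), as a congruence of p-integral rationals. -/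
open Finset

theorem aux_cancel {R : Type*} [CommRing R] [IsDomain R] {P a b : R} (hP : P ≠ 0)
    (h : P * a = P * b) : a = b := mul_left_cancel₀ hP h

/-- Newton-type expansion of a product up to fourth order. -/
theorem aux_newton {R ι : Type*} [CommRing R] [DecidableEq ι] (s : Finset ι) (x : ι → R) (t : R) :
    ∃ c, 6 * ∏ i ∈ s, (1 + t * x i) = 6 + 6 * t * (∑ i ∈ s, x i)
      + 3 * t ^ 2 * ((∑ i ∈ s, x i) ^ 2 - ∑ i ∈ s, x i ^ 2)
      + t ^ 3 * ((∑ i ∈ s, x i) ^ 3 - 3 * (∑ i ∈ s, x i) * (∑ i ∈ s, x i ^ 2)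
          + 2 * ∑ i ∈ s, x i ^ 3) + t ^ 4 * c := by
  induction s using Finset.induction_on with
  | empty => exact ⟨0, by simp⟩
  | insert a s ha ih =>
    obtain ⟨c, hc⟩ := ih
    simp only [Finset.prod_insert ha, Finset.sum_insert ha]
    refine ⟨c * (1 + t * x a) + x a * ((∑ i ∈ s, x i) ^ 3
      - 3 * (∑ i ∈ s, x i) * (∑ i ∈ s, x i ^ 2) + 2 * ∑ i ∈ s, x i ^ 3), ?_⟩
    linear_combination (1 + t * x a) * hc

theorem aux_algB {R : Type*} [CommRing R] [IsDomain R] {P h t q H2 H3 X Y B sn s1 w : R}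
    (hP : P ≠ 0) (hh : 2 * h = 1) (ht : 3 * t = 1)
    (hY : P ^ 2 ∣ Y - P * B)
    (hs : P ∣ s1 - H3)
    (hw : 4 * w = 1 + P * q)
    (hY1 : P ^ 2 ∣ Y - (2 * sn - (P - 3) * P * s1))
    (hY2 : P ^ 2 ∣ Y - (2 * (w * sn) - (P - 3) * P * (w * h * s1)))
    (hX1 : P ^ 2 ∣ X - (2 * H2 + 2 * P * H3))
    (hX2 : P ^ 2 ∣ X - (2 * (h ^ 2 * H2) + 2 * P * (h ^ 3 * H3))) :
    (∃ c, H3 = -2 * B + P * c) ∧ ∃ c, 3 * H2 = 7 * P * B + P ^ 2 * c := by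
  obtain ⟨c1, hY⟩ := hY
  obtain ⟨c2, hs⟩ := hs
  obtain ⟨c3, hY1⟩ := hY1
  obtain ⟨c4, hY2⟩ := hY2
  obtain ⟨c5, hX1⟩ := hX1
  obtain ⟨c6, hX2⟩ := hX2
  have e1 : (8 * w - 8) * Y = -(P - 3) * P * s1 * (4 * w) + P ^ 2 * (8 * w * c3 - 8 * c4) := by
    linear_combination 8 * w * hY1 - 8 * hY2 + 4 * (P - 3) * P * w * s1 * hh
  have hH3 : ∃ c, H3 = -2 * B + P * c := by
    have e2 : P * (-6 * B) = P * (3 * H3 + P * (-2 * q * B - (-6 + 2 * P * q) * c1 + 3 * c2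
        - s1 + 3 * q * s1 - P * q * s1 + (8 * w * c3 - 8 * c4))) := by
      linear_combination e1 - (-6 + 2 * P * q) * hY + 3 * P * hs - 2 * Y * hw
        - (P - 3) * P * s1 * hw
    have e3 := aux_cancel hP e2
    refine ⟨-t * (-2 * q * B - (-6 + 2 * P * q) * c1 + 3 * c2
        - s1 + 3 * q * s1 - P * q * s1 + (8 * w * c3 - 8 * c4)), ?_⟩
    linear_combination -t * e3 - (H3 + 2 * B) * ht
  refine ⟨hH3, ?_⟩
  obtain ⟨c, hc⟩ := hH3
  have h4 : 4 * h ^ 2 = 1 := by linear_combination (2 * h + 1) * hh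
  have h8 : 8 * h ^ 3 = 1 := by linear_combination (4 * h ^ 2 + 2 * h + 1) * hh
  have e2 : 3 * X = - P * H3 + P ^ 2 * (4 * c6 - c5) := by
    linear_combination 4 * hX2 - hX1 + 2 * H2 * h4 + P * H3 * h8
  have e3 : 2 * (3 * H2) = 2 * (7 * P * B) + P ^ 2 * (-7 * c + (4 * c6 - c5) - 3 * c5) := by
    linear_combination e2 - 3 * hX1 - 7 * P * hc
  refine ⟨h * (-7 * c + (4 * c6 - c5) - 3 * c5), ?_⟩
  linear_combination h * e3 + (7 * P * B - 3 * H2) * hh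

theorem aux_algH {R : Type*} [CommRing R] [IsDomain R] {P h t q H H2 H3 B A D c1 c2 : R}
    (hP : P ≠ 0) (hh : 2 * h = 1) (ht : 3 * t = 1)
    (hH3 : ∃ c, H3 = -2 * B + P * c) (hH2 : ∃ c, 3 * H2 = 7 * P * B + P ^ 2 * c)
    (hA : 6 * A = 6 - 6 * P * H + 3 * P ^ 2 * (H ^ 2 - H2)
      - P ^ 3 * (H ^ 3 - 3 * H * H2 + 2 * H3) + P ^ 4 * c1)
    (hD : 6 * D = 6 - 6 * P * (h * H) + 3 * P ^ 2 * ((h * H) ^ 2 - h ^ 2 * H2)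
      - P ^ 3 * ((h * H) ^ 3 - 3 * (h * H) * (h ^ 2 * H2) + 2 * (h ^ 3 * H3)) + P ^ 4 * c2)
    (hAD : A = (1 + P * q) * D) :
    ∃ c, 12 * H = -24 * q + 12 * P * q ^ 2 - 8 * P ^ 2 * q ^ 3 - 7 * P ^ 2 * B + P ^ 3 * c := by
  obtain ⟨c3, hH3⟩ := hH3
  obtain ⟨c4, hH2⟩ := hH2
  have h4 : 4 * h ^ 2 = 1 := by linear_combination (2 * h + 1) * hh
  have h8 : 8 * h ^ 3 = 1 := by linear_combination (4 * h ^ 2 + 2 * h + 1) * hh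
  have hH2' : H2 = P * (7 * t * B + P * (t * c4)) := by
    linear_combination t * hH2 - H2 * ht
  -- multiply by 8
  have hD' : 48 * D = 48 - 24 * P * H + 6 * P ^ 2 * (H ^ 2 - H2)
      - P ^ 3 * (H ^ 3 - 3 * H * H2 + 2 * H3) + P ^ 4 * (8 * c2) := by
    linear_combination 8 * hD - 24 * P * H * hh + 6 * P ^ 2 * (H ^ 2 - H2) * h4
      - P ^ 3 * (H ^ 3 - 3 * H * H2 + 2 * H3) * h8
  have E : P * (48 * q + 24 * H) = P * (P * (24 * q * H + 18 * (H ^ 2 - H2)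
      - 7 * P * (H ^ 3 - 3 * H * H2 + 2 * H3) - 6 * P * q * (H ^ 2 - H2)
      + P ^ 2 * (8 * c1 - 8 * c2 - 8 * P * q * c2 + q * (H ^ 3 - 3 * H * H2 + 2 * H3)))) := by
    linear_combination 8 * hA - (1 + P * q) * hD' - 48 * hAD
  have E1 := aux_cancel hP E
  set d := 8 * c1 - 8 * c2 - 8 * P * q * c2 + q * (H ^ 3 - 3 * H * H2 + 2 * H3) with hd
  clear_value d
  clear E hd hA hD hD' hAD
  obtain ⟨a, ha⟩ : ∃ a, H = -2 * q + P * a := by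
    refine ⟨h ^ 3 * t * (24 * q * H + 18 * (H ^ 2 - H2)
      - 7 * P * (H ^ 3 - 3 * H * H2 + 2 * H3) - 6 * P * q * (H ^ 2 - H2) + P ^ 2 * d), ?_⟩
    linear_combination h ^ 3 * t * E1 - (H + 2 * q) * (3 * t * h8 + ht)
  subst ha
  obtain ⟨b, hb⟩ : ∃ b, a = q ^ 2 + P * b := by
    have E2 : P * (24 * a) = P * (24 * q ^ 2 + P * (24 * q * a + 18 * (-4 * q * a + P * a ^ 2
        - (7 * t * B + P * (t * c4))) - 7 * ((-2 * q + P * a) ^ 3 - 3 * (-2 * q + P * a) * H2 + 2 * H3)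
        - 6 * q * ((-2 * q + P * a) ^ 2 - H2) + P * d)) := by
      linear_combination E1 - 18 * P * hH2'
    have E3 := aux_cancel hP E2
    refine ⟨h ^ 3 * t * (24 * q * a + 18 * (-4 * q * a + P * a ^ 2
        - (7 * t * B + P * (t * c4))) - 7 * ((-2 * q + P * a) ^ 3 - 3 * (-2 * q + P * a) * H2 + 2 * H3)
        - 6 * q * ((-2 * q + P * a) ^ 2 - H2) + P * d), ?_⟩
    linear_combination h ^ 3 * t * E3 - (a - q ^ 2) * (3 * t * h8 + ht)
  subst hb
  -- third step
  have E4 : P * (P * (24 * b)) = P * (P * (24 * q * q ^ 2 + 18 * (-4 * q * q ^ 2)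
      - 18 * (7 * t * B) + 56 * q ^ 3 + 28 * B - 24 * q ^ 3 + P * (24 * q * b
        + 18 * (-4 * q * b + (q ^ 2 + P * b) ^ 2 - t * c4)
        - 7 * (12 * q ^ 2 * (q ^ 2 + P * b) - 6 * q * P * (q ^ 2 + P * b) ^ 2
            + P ^ 2 * (q ^ 2 + P * b) ^ 3
            - 3 * (-2 * q + P * (q ^ 2 + P * b)) * (7 * t * B + P * (t * c4)) + 2 * c3)
        - 6 * q * (-4 * q * (q ^ 2 + P * b) + P * (q ^ 2 + P * b) ^ 2
            - (7 * t * B + P * (t * c4))) + d))) := by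
    rw [hH2', hH3] at E1
    linear_combination E1
  have E5 := aux_cancel hP (aux_cancel hP E4)
  set f := 24 * q * b
        + 18 * (-4 * q * b + (q ^ 2 + P * b) ^ 2 - t * c4)
        - 7 * (12 * q ^ 2 * (q ^ 2 + P * b) - 6 * q * P * (q ^ 2 + P * b) ^ 2
            + P ^ 2 * (q ^ 2 + P * b) ^ 3
            - 3 * (-2 * q + P * (q ^ 2 + P * b)) * (7 * t * B + P * (t * c4)) + 2 * c3)
        - 6 * q * (-4 * q * (q ^ 2 + P * b) + P * (q ^ 2 + P * b) ^ 2
            - (7 * t * B + P * (t * c4))) + d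
  refine ⟨h * f, ?_⟩
  linear_combination P ^ 2 * h * E5 - P ^ 2 * (12 * b + 8 * q ^ 3 + 7 * B) * hh
    - 42 * P ^ 2 * h * B * ht

theorem aux_algS {R : Type*} [CommRing R] [IsDomain R] {P h q H B S E3 c1 c2 : R}
    (hP : P ≠ 0) (hh : 2 * h = 1)
    (hH : ∃ c, 12 * H = -24 * q + 12 * P * q ^ 2 - 8 * P ^ 2 * q ^ 3 - 7 * P ^ 2 * B + P ^ 3 * c)
    (hF1 : P * q = - P * (h * H) + P ^ 2 * S - P ^ 3 * E3 + P ^ 4 * c1)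
    (hF2 : (1 + P * q) ^ 2 - 1 = - 2 * P * (h * H) + 4 * P ^ 2 * S - 8 * P ^ 3 * E3 + P ^ 4 * c2) :
    ∃ c, S - (h * (q ^ 2 - P * q ^ 3) - 7 * h ^ 4 * P * B) = P ^ 2 * c := by
  obtain ⟨c, hH⟩ := hH
  have h16 : 16 * h ^ 4 = 1 := by linear_combination (8 * h ^ 3 + 4 * h ^ 2 + 2 * h + 1) * hh
  have E : P * (P * (16 * S)) = P * (P * (8 * (q ^ 2 - P * q ^ 3) - 7 * P * B
      + P ^ 2 * (c - 32 * c1 + 4 * c2))) := by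
    linear_combination 4 * hF2 - 32 * hF1 + 12 * P * H * hh + P * hH
  have E2 := aux_cancel hP (aux_cancel hP E)
  refine ⟨h ^ 4 * (c - 32 * c1 + 4 * c2), ?_⟩
  linear_combination h ^ 4 * E2 - (S - h * (q ^ 2 - P * q ^ 3)) * h16 - h ^ 4 * 8 * (q ^ 2 - P * q ^ 3) * hh

theorem aux_even_sum {M : Type*} [AddCommMonoid M] (m : ℕ) (f : ℕ → M) :
    ∑ k ∈ (Icc 1 (2 * m)).filter (fun k => Even k), f k = ∑ i ∈ range m, f (2 * (i + 1)) := by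
  induction m with
  | zero => simp
  | succ m ih =>
    rw [sum_range_succ, ← ih, sum_filter, sum_filter, show 2 * (m + 1) = 2 * m + 1 + 1 by ring,
      sum_Icc_succ_top (by omega), sum_Icc_succ_top (by omega)]
    have h1 : ¬ Even (2 * m + 1) := by simp
    have h2 : Even (2 * m + 1 + 1) := ⟨m + 1, by ring⟩
    rw [if_neg h1, if_pos h2, add_zero]

theorem aux_refl_sum {M : Type*} [AddCommMonoid M] (m : ℕ) (f : ℕ → M) :
    ∑ k ∈ Icc 1 (2 * m), f k
      = ∑ i ∈ range m, (f (i + 1) + f (2 * m + 1 - (i + 1))) := by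
  rw [← Finset.Ico_add_one_right_eq_Icc, sum_Ico_eq_sum_range, sum_add_distrib,
    show 2 * m + 1 - 1 = m + m by omega, sum_range_add]
  congr 1
  · exact sum_congr rfl fun i _ => by rw [add_comm]
  · rw [← sum_range_reflect]
    refine sum_congr rfl fun i hi => ?_
    have := mem_range.1 hi
    congr 1
    omega

theorem aux_par_sum {M : Type*} [AddCommMonoid M] (m : ℕ) (f : ℕ → M) :
    ∑ k ∈ Icc 1 (2 * m), f k
      = ∑ i ∈ range m, (f (2 * (i + 1)) + f (2 * m + 1 - 2 * (i + 1))) := by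
  have h : ∑ i ∈ range m, f (2 * m + 1 - 2 * (i + 1)) = ∑ i ∈ range m, f (2 * i + 1) := by
    rw [← sum_range_reflect]
    refine sum_congr rfl fun i hi => ?_
    have := mem_range.1 hi
    congr 1
    omega
  rw [sum_add_distrib, h]
  clear h
  induction m with
  | zero => simp
  | succ m ih =>
    rw [show 2 * (m + 1) = 2 * m + 1 + 1 by ring,
      sum_Icc_succ_top (by omega), sum_Icc_succ_top (by omega), ih, sum_range_succ, sum_range_succ,
      show 2 * (m + 1) = 2 * m + 1 + 1 by ring]
    abel

theorem aux_pow_expand {R : Type*} [CommRing R] (P b : R) (r : ℕ) :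
    P ^ 2 ∣ (P + b) ^ (r + 1) - (b ^ (r + 1) + (r + 1) * P * b ^ r) := by
  induction r with
  | zero => simp [add_comm]
  | succ r ih =>
    obtain ⟨c, hc⟩ := ih
    refine ⟨c * (P + b) + (r + 1) * b ^ r, ?_⟩
    push_cast
    rw [pow_succ (P + b)]
    linear_combination (P + b) * hc

theorem aux_pow_refl {R : Type*} [CommRing R] (P a : R) (r : ℕ) (hr : Odd r) :
    P ^ 2 ∣ (P - a) ^ (r + 1) - (a ^ (r + 1) - (r + 1) * P * a ^ r) := by
  have := aux_pow_expand P (-a) r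
  rw [hr.neg_pow, (hr.add_one).neg_pow] at this
  convert this using 1
  ring

theorem aux_inv_refl {R : Type*} [CommRing R] {P k x y : R} (h1 : k * x = 1)
    (h2 : (P - k) * y = 1) : P ^ 2 ∣ y ^ 2 - (x ^ 2 + 2 * P * x ^ 3) := by
  have hy : y = - x + P * x * y := by linear_combination (-x) * h2 - y * h1
  refine ⟨x ^ 2 * y ^ 2 - 2 * x ^ 3 * y, ?_⟩
  linear_combination (y - x + P * x * y - 2 * P * x ^ 2) * hy

theorem aux_prod_nat (m : ℕ) :
    ∏ i ∈ range m, (m + 1 + i) = 2 ^ m * ∏ i ∈ range m, (2 * i + 1) := by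
  induction m with
  | zero => simp
  | succ m ih =>
    rw [prod_range_succ _ m, pow_succ]
    have h1 : (m + 1) * ∏ i ∈ range m, (m + 1 + 1 + i) = (∏ i ∈ range m, (m + 1 + i)) * (2 * m + 1) := by
      have := prod_range_succ (fun i => m + 1 + i) m
      rw [prod_range_succ'] at this
      have h2 : ∏ i ∈ range m, (m + 1 + 1 + i) = ∏ i ∈ range m, (m + 1 + (i + 1)) :=
        prod_congr rfl fun i _ => by ring
      rw [h2]
      rw [show m + 1 + m = 2 * m + 1 by ring, add_zero] at this
      rw [← this]; ring
    rw [prod_range_succ]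
    calc _ = 2 * ((m + 1) * ∏ i ∈ range m, (m + 1 + 1 + i)) := by ring
      _ = _ := by rw [h1, ih]; ring

section
variable {R : Type*} [CommRing R]

theorem aux_prodR [IsDomain R] (m : ℕ) (u : ℕ → R)
    (hu : ∀ k, 1 ≤ k → k ≤ 2 * m → (k : R) * u k = 1) :
    ∏ i ∈ range m, (1 + -((2 * m + 1 : ℕ) : R) * u (i + 1))
      = 2 ^ (2 * m) * ∏ i ∈ range m, (1 + -((2 * m + 1 : ℕ) : R) * u (2 * (i + 1))) := by
  have hf : (∏ i ∈ range m, ((i + 1 : ℕ) : R)) ≠ 0 := by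
    rw [prod_ne_zero_iff]
    intro i hi h
    have := hu (i + 1) (by omega) (by have := mem_range.1 hi; omega)
    rw [h] at this
    simp at this
  have e1 : (∏ i ∈ range m, ((i + 1 : ℕ) : R)) *
      ∏ i ∈ range m, (1 + -((2 * m + 1 : ℕ) : R) * u (i + 1))
      = (-1) ^ m * ((∏ i ∈ range m, (m + 1 + i) : ℕ) : R) := by
    rw [← prod_mul_distrib, ← prod_range_reflect (fun i => m + 1 + i), Nat.cast_prod]
    conv_rhs => rw [← card_range m, ← prod_const, card_range, ← prod_mul_distrib]
    refine prod_congr rfl fun i hi => ?_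
    have hi := mem_range.1 hi
    have h := hu (i + 1) (by omega) (by omega)
    obtain ⟨j, rfl⟩ : ∃ j, m = j + i + 1 := ⟨m - i - 1, by omega⟩
    rw [show j + i + 1 - 1 - i = j by omega]
    push_cast at h ⊢
    linear_combination -(2 * ((j:R) + i + 1) + 1) * h
  have e2 : (∏ i ∈ range m, ((i + 1 : ℕ) : R)) * (2 ^ m *
      ∏ i ∈ range m, (1 + -((2 * m + 1 : ℕ) : R) * u (2 * (i + 1))))
      = (-1) ^ m * ((∏ i ∈ range m, (2 * i + 1) : ℕ) : R) := by
    rw [← prod_range_reflect (fun i => 2 * i + 1), Nat.cast_prod]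
    have h2 : (2 : R) ^ m = ∏ i ∈ range m, 2 := by simp
    have h3 : (-1 : R) ^ m = ∏ i ∈ range m, (-1) := by simp
    rw [h2, h3, ← prod_mul_distrib, ← prod_mul_distrib, ← prod_mul_distrib]
    refine prod_congr rfl fun i hi => ?_
    have hi := mem_range.1 hi
    have h := hu (2 * (i + 1)) (by omega) (by omega)
    obtain ⟨j, rfl⟩ : ∃ j, m = j + i + 1 := ⟨m - i - 1, by omega⟩
    rw [show j + i + 1 - 1 - i = j by omega]
    push_cast at h ⊢
    linear_combination -(2 * ((j:R) + i + 1) + 1) * h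
  apply mul_left_cancel₀ hf
  rw [e1, aux_prod_nat]
  push_cast at e2 ⊢
  linear_combination -(2:R)^m * e2

theorem aux_choose (N : ℕ) (u : ℕ → R) (k : ℕ) (hk : k < N)
    (hu : ∀ j, 1 ≤ j → j ≤ k + 1 → (j : R) * u j = 1) :
    (N.choose (k + 1) : R) = N * u (k + 1) * (-1) ^ k * ∏ j ∈ Icc 1 k, (1 + -(N : R) * u j) := by
  induction k with
  | zero =>
    have := hu 1 le_rfl le_rfl
    simp at this
    simp [this]
  | succ k ih =>
    have ih := ih (by omega) (fun j h1 h2 => hu j h1 (by omega))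
    rw [prod_Icc_succ_top (by omega)]
    have h := hu (k + 1 + 1) (by omega) le_rfl
    have h' := hu (k + 1) (by omega) (by omega)
    have hc := Nat.choose_succ_right_eq N (k + 1)
    have hc' : (N.choose (k + 1 + 1) : R) * ((k + 1 + 1 : ℕ) : R)
        = N.choose (k + 1) * ((N : R) - ((k + 1 : ℕ) : R)) := by
      rw [← Nat.cast_sub hk.le, ← Nat.cast_mul, ← Nat.cast_mul, hc]
    rw [ih] at hc'
    set Q := ∏ j ∈ Icc 1 k, (1 + -(N : R) * u j)
    calc (N.choose (k + 1 + 1) : R) = ((N.choose (k + 1 + 1) : R) * ((k + 1 + 1 : ℕ) : R)) * u (k + 1 + 1) := by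
          linear_combination -(N.choose (k + 1 + 1) : R) * h
      _ = _ := by
          rw [hc', pow_succ]
          linear_combination -(N * (-1) ^ k * Q * u (k + 1 + 1)) * h'

end

theorem aux_even_choose (n : ℕ) (hn : n ≠ 0) :
    2 * ∑ k ∈ range (n + 1), (if Even k then (n.choose k : ℤ) else 0) = 2 ^ n := by
  have h1 := Int.alternating_sum_range_choose_of_ne hn
  have h2 : ∑ k ∈ range (n + 1), (n.choose k : ℤ) = 2 ^ n := by exact_mod_cast Nat.sum_range_choose n
  have h3 : 2 * ∑ k ∈ range (n + 1), (if Even k then (n.choose k : ℤ) else 0)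
      = ∑ k ∈ range (n + 1), (n.choose k : ℤ)
        + ∑ k ∈ range (n + 1), (-1) ^ k * (n.choose k : ℤ) := by
    rw [← sum_add_distrib, mul_sum]
    refine sum_congr rfl fun k _ => ?_
    split_ifs with h
    · rw [h.neg_one_pow]; ring
    · rw [(Nat.not_even_iff_odd.1 h).neg_one_pow]; ring
  rw [h3, h1, h2, add_zero]

theorem aux_F1 (m : ℕ) :
    ∑ k ∈ (Icc 1 (2 * m)).filter (fun k => Even k), ((2 * m + 1).choose k : ℤ) = 2 ^ (2 * m) - 1 := by
  have h := aux_even_choose (2 * m + 1) (by omega)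
  rw [sum_range_succ, if_neg (by simp), sum_range_succ'] at h
  rw [sum_filter, ← Finset.Ico_add_one_right_eq_Icc, sum_Ico_eq_sum_range]
  simp only [Even.zero, if_true, Nat.choose_zero_right] at h
  simp only [add_comm 1, Nat.add_sub_cancel]
  push_cast at h
  rw [pow_succ] at h
  linarith

theorem aux_F2 (m : ℕ) :
    ∑ k ∈ (Icc 1 (2 * m)).filter (fun k => Even k), ((2 * (2 * m + 1)).choose k : ℤ)
      = (2 ^ (2 * m)) ^ 2 - 1 := by
  have h := aux_even_choose (2 * (2 * m + 1)) (by omega)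
  obtain ⟨f, hf⟩ : ∃ f : ℕ → ℤ,
      f = fun k => if Even k then ((2 * (2 * m + 1)).choose k : ℤ) else 0 := ⟨_, rfl⟩
  have h0 : ∑ k ∈ range (2 * (2 * m + 1) + 1), f k = ∑ k ∈ range (2 * (2 * m + 1) + 1),
      (if Even k then ((2 * (2 * m + 1)).choose k : ℤ) else 0) := by rw [hf]
  rw [← h0] at h
  rw [show 2 * (2 * m + 1) + 1 = (2 * m + 1) + 1 + (2 * m + 1) by ring, sum_range_add,
    sum_range_succ, ← sum_range_reflect (fun x => f (2 * m + 1 + 1 + x))] at h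
  have h3 : ∑ j ∈ range (2 * m + 1), f (2 * m + 1 + 1 + (2 * m + 1 - 1 - j))
      = ∑ j ∈ range (2 * m + 1), f j := by
    refine sum_congr rfl fun j hj => ?_
    have hj := mem_range.1 hj
    rw [show 2 * m + 1 + 1 + (2 * m + 1 - 1 - j) = 2 * (2 * m + 1) - j by omega]
    simp only [hf]
    rw [Nat.choose_symm (by omega)]
    congr 1
    rw [Nat.even_sub (by omega)]
    simp
  have h4 : f (2 * m + 1) = 0 := by
    simp only [hf]; rw [if_neg (by simp)]
  rw [h3, h4, sum_range_succ'] at h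
  have h5 : f 0 = 1 := by simp [hf]
  rw [h5] at h
  rw [sum_filter, ← Finset.Ico_add_one_right_eq_Icc, sum_Ico_eq_sum_range]
  simp only [add_comm 1, Nat.add_sub_cancel]
  simp only [hf] at h
  have h6 : (2:ℤ) ^ (2 * (2 * m + 1)) = 4 * (2 ^ (2 * m)) ^ 2 := by ring
  rw [h6] at h
  linarith

section
variable {R : Type*} [CommRing R]

theorem aux_F (m N : ℕ) (hN : 2 * m < N) (u : ℕ → R)
    (hu : ∀ k, 1 ≤ k → k ≤ 2 * m → (k : R) * u k = 1) (i6 : R) (h6 : 6 * i6 = 1) :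
    (N : R) ^ 4 ∣ ∑ k ∈ (Icc 1 (2 * m)).filter (fun k => Even k), (N.choose k : R)
      - (-N * (∑ k ∈ (Icc 1 (2 * m)).filter (fun k => Even k), u k)
        + N ^ 2 * (∑ k ∈ (Icc 1 (2 * m)).filter (fun k => Even k), ∑ j ∈ Icc 1 (k - 1), u j * u k)
        - N ^ 3 * (∑ k ∈ (Icc 1 (2 * m)).filter (fun k => Even k),
            u k * i6 * 3 * ((∑ j ∈ Icc 1 (k - 1), u j) ^ 2 - ∑ j ∈ Icc 1 (k - 1), u j ^ 2))) := by
  rw [mul_sum, mul_sum, mul_sum, ← sum_add_distrib, ← sum_sub_distrib, ← sum_sub_distrib]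
  refine dvd_sum fun k hk => ?_
  simp only [mem_filter, mem_Icc] at hk
  obtain ⟨⟨hk1, hk2⟩, hk3⟩ := hk
  obtain ⟨l, rfl⟩ : ∃ l, k = l + 1 := ⟨k - 1, by omega⟩
  have hl : Odd l := by rcases Nat.even_or_odd l with h | h
                        · exact absurd hk3 (by simpa using h.add_one)
                        · exact h
  rw [aux_choose N u l (by omega) (fun j h1 h2 => hu j h1 (by omega)), hl.neg_one_pow,
    Nat.add_sub_cancel, ← sum_mul]
  obtain ⟨c, hc⟩ := aux_newton (Icc 1 l) u (-(N : R))
  set Q := ∏ i ∈ Icc 1 l, (1 + -(N : R) * u i)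
  set a1 := ∑ j ∈ Icc 1 l, u j
  set a2 := ∑ j ∈ Icc 1 l, u j ^ 2
  set a3 := ∑ j ∈ Icc 1 l, u j ^ 3
  refine ⟨u (l + 1) * i6 * ((a1 ^ 3 - 3 * a1 * a2 + 2 * a3) - N * c), ?_⟩
  linear_combination (-N * u (l + 1) * i6) * hc + (N * u (l + 1) * (Q - 1 + N * a1)) * h6

theorem aux_main [IsDomain R] (m r : ℕ) (hr : 2 * m = r + 3) (u : ℕ → R) (q B P : R)
    (hPm : ((2 * m + 1 : ℕ) : R) = P) (hP : P ≠ 0)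
    (hu : ∀ k, 1 ≤ k → k ≤ 2 * m → (k : R) * u k = 1)
    (hq : (2 : R) ^ (2 * m) = 1 + P * q)
    (hfer : ∀ k, 1 ≤ k → k ≤ 2 * m → P ∣ (k : R) ^ (2 * m) - 1)
    (hY : P ^ 2 ∣ ∑ k ∈ Icc 1 (2 * m), (k : R) ^ (r + 1) - P * B) :
    ∃ c, (∑ k ∈ (Icc 1 (2 * m)).filter (fun k => Even k), ∑ j ∈ Icc 1 (k - 1), u j * u k)
      - (u 2 * (q ^ 2 - P * q ^ 3) - 7 * u 2 ^ 4 * P * B) = P ^ 2 * c := by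
  have hh : 2 * u 2 = 1 := by exact_mod_cast hu 2 (by omega) (by omega)
  have ht : 3 * u 3 = 1 := by exact_mod_cast hu 3 (by omega) (by omega)
  have hro : Odd r := by
    rcases Nat.even_or_odd r with ⟨a, ha⟩ | h
    · omega
    · exact h
  have hrP : (r : R) + 1 = P - 3 := by
    have : ((2 * m : ℕ) : R) = ((r + 3 : ℕ) : R) := by rw [hr]
    rw [← hPm]
    push_cast at this ⊢
    linear_combination -this
  have hu2 : ∀ i ∈ range m, u (2 * (i + 1)) = u 2 * u (i + 1) := by
    intro i hi
    have hi := mem_range.1 hi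
    have h1 := hu (i + 1) (by omega) (by omega)
    have h2 := hu (2 * (i + 1)) (by omega) (by omega)
    push_cast at h1 h2
    linear_combination (u 2 * u (i + 1)) * h2 - u (2 * (i + 1)) * h1
      - u (2 * (i + 1)) * (i + 1) * u (i + 1) * hh
  have hE1 : ∑ k ∈ (Icc 1 (2 * m)).filter (fun k => Even k), u k
      = u 2 * ∑ i ∈ range m, u (i + 1) := by
    rw [aux_even_sum, mul_sum]
    exact sum_congr rfl hu2
  have cast1 : ∀ i ∈ range m, ((2 * m + 1 - (i + 1) : ℕ) : R) = P - ((i + 1 : ℕ) : R) := by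
    intro i hi
    have hi := mem_range.1 hi
    rw [Nat.cast_sub (by omega), hPm]
  have cast2 : ∀ i ∈ range m, ((2 * m + 1 - 2 * (i + 1) : ℕ) : R) = P - 2 * ((i + 1 : ℕ) : R) := by
    intro i hi
    have hi := mem_range.1 hi
    rw [Nat.cast_sub (by omega), hPm]
    push_cast
    ring
  -- inverse squares
  have hX1 : P ^ 2 ∣ ∑ k ∈ Icc 1 (2 * m), u k ^ 2 -
      (2 * (∑ i ∈ range m, u (i + 1) ^ 2) + 2 * P * (∑ i ∈ range m, u (i + 1) ^ 3)) := by
    rw [aux_refl_sum, mul_sum, mul_sum, ← sum_add_distrib, ← sum_sub_distrib]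
    refine dvd_sum fun i hi => ?_
    have hi' := mem_range.1 hi
    have h1 := hu (i + 1) (by omega) (by omega)
    have h2 := hu (2 * m + 1 - (i + 1)) (by omega) (by omega)
    rw [cast1 i hi] at h2
    convert aux_inv_refl h1 h2 using 1
    ring
  have hX2 : P ^ 2 ∣ ∑ k ∈ Icc 1 (2 * m), u k ^ 2 -
      (2 * (u 2 ^ 2 * ∑ i ∈ range m, u (i + 1) ^ 2)
        + 2 * P * (u 2 ^ 3 * ∑ i ∈ range m, u (i + 1) ^ 3)) := by
    rw [aux_par_sum, mul_sum, mul_sum, mul_sum, mul_sum, ← sum_add_distrib, ← sum_sub_distrib]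
    refine dvd_sum fun i hi => ?_
    have hi' := mem_range.1 hi
    have h1 := hu (2 * (i + 1)) (by omega) (by omega)
    have h2 := hu (2 * m + 1 - 2 * (i + 1)) (by omega) (by omega)
    rw [cast2 i hi] at h2
    rw [hu2 i hi] at h1 ⊢
    have h1' : 2 * ((i + 1 : ℕ) : R) * (u 2 * u (i + 1)) = 1 := by
      push_cast at h1 ⊢; exact h1
    convert aux_inv_refl h1' h2 using 1
    ring
  have hY1 : P ^ 2 ∣ ∑ k ∈ Icc 1 (2 * m), (k : R) ^ (r + 1) -
      (2 * (∑ i ∈ range m, ((i + 1 : ℕ) : R) ^ (r + 1))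
        - (P - 3) * P * (∑ i ∈ range m, ((i + 1 : ℕ) : R) ^ r)) := by
    rw [aux_refl_sum, mul_sum, mul_sum, ← sum_sub_distrib, ← sum_sub_distrib]
    refine dvd_sum fun i hi => ?_
    rw [cast1 i hi]
    convert aux_pow_refl P ((i + 1 : ℕ) : R) r hro using 1
    rw [hrP]
    ring
  have hY2 : P ^ 2 ∣ ∑ k ∈ Icc 1 (2 * m), (k : R) ^ (r + 1) -
      (2 * (2 ^ (r + 1) * ∑ i ∈ range m, ((i + 1 : ℕ) : R) ^ (r + 1))
        - (P - 3) * P * (2 ^ (r + 1) * u 2 * ∑ i ∈ range m, ((i + 1 : ℕ) : R) ^ r)) := by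
    rw [aux_par_sum, mul_sum, mul_sum, mul_sum, mul_sum, ← sum_sub_distrib, ← sum_sub_distrib]
    refine dvd_sum fun i hi => ?_
    rw [cast2 i hi]
    convert aux_pow_refl P (2 * ((i + 1 : ℕ) : R)) r hro using 1
    rw [hrP, Nat.cast_mul, mul_pow, mul_pow, mul_pow]
    push_cast
    linear_combination (P - 3) * P * 2 ^ r * ((i : R) + 1) ^ r * hh
  have hs : P ∣ ∑ i ∈ range m, ((i + 1 : ℕ) : R) ^ r - ∑ i ∈ range m, u (i + 1) ^ 3 := by
    rw [← sum_sub_distrib]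
    refine dvd_sum fun i hi => ?_
    have hi' := mem_range.1 hi
    have h1 := hu (i + 1) (by omega) (by omega)
    obtain ⟨c, hc⟩ := hfer (i + 1) (by omega) (by omega)
    rw [hr, pow_add] at hc
    generalize ((i + 1 : ℕ) : R) = a at *
    generalize u (i + 1) = x at *
    have h3 : a ^ 3 * x ^ 3 = 1 := by rw [← mul_pow, h1, one_pow]
    exact ⟨c * x ^ 3, by linear_combination x ^ 3 * hc - a ^ r * h3⟩
  have hw : 4 * (2 : R) ^ (r + 1) = 1 + P * q := by
    rw [← hq, hr]; ring
  obtain ⟨hH3, hH2⟩ := aux_algB hP hh ht hY hs hw hY1 hY2 hX1 hX2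
  -- the product identity
  have hAD := aux_prodR m u hu
  rw [hPm, hq] at hAD
  obtain ⟨c1, hA⟩ := aux_newton (range m) (fun i => u (i + 1)) (-P)
  obtain ⟨c2, hD⟩ := aux_newton (range m) (fun i => u (2 * (i + 1))) (-P)
  have d1 : ∑ i ∈ range m, u (2 * (i + 1)) = u 2 * ∑ i ∈ range m, u (i + 1) := by
    rw [mul_sum]; exact sum_congr rfl hu2
  have d2 : ∑ i ∈ range m, u (2 * (i + 1)) ^ 2 = u 2 ^ 2 * ∑ i ∈ range m, u (i + 1) ^ 2 := by
    rw [mul_sum]; exact sum_congr rfl fun i hi => by rw [hu2 i hi, mul_pow]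
  have d3 : ∑ i ∈ range m, u (2 * (i + 1)) ^ 3 = u 2 ^ 3 * ∑ i ∈ range m, u (i + 1) ^ 3 := by
    rw [mul_sum]; exact sum_congr rfl fun i hi => by rw [hu2 i hi, mul_pow]
  rw [d1, d2, d3] at hD
  have hH := aux_algH (H := ∑ i ∈ range m, u (i + 1)) (c1 := c1) (c2 := c2) hP hh ht hH3 hH2
    (by linear_combination hA) (by linear_combination hD) hAD
  -- binomial sums
  have h6 : 6 * (u 2 * u 3) = 1 := by linear_combination 3 * u 3 * hh + ht
  obtain ⟨e1, hF1⟩ := aux_F m (2 * m + 1) (by omega) u hu _ h6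
  obtain ⟨e2, hF2⟩ := aux_F m (2 * (2 * m + 1)) (by omega) u hu _ h6
  have g1 : ∑ k ∈ (Icc 1 (2 * m)).filter (fun k => Even k), ((2 * m + 1).choose k : R)
      = P * q := by
    have := congrArg (Int.cast : ℤ → R) (aux_F1 m)
    push_cast at this
    rw [this, hq]; ring
  have g2 : ∑ k ∈ (Icc 1 (2 * m)).filter (fun k => Even k), ((2 * (2 * m + 1)).choose k : R)
      = (1 + P * q) ^ 2 - 1 := by
    have := congrArg (Int.cast : ℤ → R) (aux_F2 m)
    push_cast at this
    rw [this, hq]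
  rw [g1, hE1, hPm] at hF1
  rw [g2, hE1, Nat.cast_mul, hPm] at hF2
  push_cast at hF2
  exact aux_algS (E3 := ∑ k ∈ (Icc 1 (2 * m)).filter (fun k => Even k),
      u k * (u 2 * u 3) * 3 * ((∑ j ∈ Icc 1 (k - 1), u j) ^ 2 - ∑ j ∈ Icc 1 (k - 1), u j ^ 2)) (c1 := e1) (c2 := 16 * e2) hP hh hH (by linear_combination hF1)
    (by linear_combination hF2)

end

theorem aux_unit (p : ℕ) [hp : Fact p.Prime] (k : ℕ) (h1 : 1 ≤ k) (h2 : k < p) :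
    ∃ x : ℤ_[p], (k : ℤ_[p]) * x = 1 := by
  refine ⟨PadicInt.inv k, PadicInt.mul_inv ?_⟩
  rw [PadicInt.norm_natCast_eq_one_iff]
  exact Nat.coprime_of_lt_prime (by omega) h2 hp.out

theorem aux_bern (p : ℕ) [Fact p.Prime] (n : ℕ) (hn : n + 1 < p) :
    ∃ b : ℤ_[p], (b : ℚ_[p]) = ((bernoulli n : ℚ) : ℚ_[p]) := by
  induction n using Nat.strong_induction_on with
  | _ n ih =>
    have h := sum_bernoulli (n + 1)
    rw [sum_range_succ] at h
    have h2 : ((n + 1 : ℕ) : ℚ) * bernoulli n = (if n + 1 = 1 then 1 else 0)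
        - ∑ k ∈ range n, ((n + 1).choose k : ℚ) * bernoulli k := by
      rw [← h]; simp
    have h3 := congrArg (Rat.cast : ℚ → ℚ_[p]) h2
    have ih' : ∀ k, ∃ b : ℤ_[p], k < n → (b : ℚ_[p]) = ((bernoulli k : ℚ) : ℚ_[p]) := by
      intro k
      by_cases hk : k < n
      · obtain ⟨b, hb⟩ := ih k hk (by omega)
        exact ⟨b, fun _ => hb⟩
      · exact ⟨0, fun h => absurd h hk⟩
    choose b hb using ih'
    obtain ⟨x, hx⟩ := aux_unit p (n + 1) (by omega) hn
    have hx' := congrArg (fun z : ℤ_[p] => (z : ℚ_[p])) hx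
    refine ⟨x * ((if n + 1 = 1 then 1 else 0) - ∑ k ∈ range n, ((n + 1).choose k : ℤ_[p]) * b k), ?_⟩
    have h5 : (((if n + 1 = 1 then 1 else 0) - ∑ k ∈ range n, ((n + 1).choose k : ℤ_[p]) * b k : ℤ_[p]) : ℚ_[p])
        = (((if n + 1 = 1 then 1 else 0)
        - ∑ k ∈ range n, ((n + 1).choose k : ℚ) * bernoulli k : ℚ) : ℚ_[p]) := by
      rw [PadicInt.coe_sub, PadicInt.coe_sum, Rat.cast_sub, Rat.cast_sum]
      congr 1
      · split_ifs <;> simp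
      · refine sum_congr rfl fun k hk => ?_
        rw [PadicInt.coe_mul, hb k (mem_range.1 hk)]
        push_cast
        rfl
    rw [PadicInt.coe_mul, h5, ← h3]
    push_cast at hx' ⊢
    linear_combination ((bernoulli n : ℚ) : ℚ_[p]) * hx'

theorem aux_faul (p : ℕ) [Fact p.Prime] (r : ℕ) (hr : r + 4 = p) (B : ℤ_[p])
    (hB : (B : ℚ_[p]) = ((bernoulli (r + 1) : ℚ) : ℚ_[p])) :
    (p : ℤ_[p]) ^ 2 ∣ ∑ k ∈ Icc 1 (p - 1), (k : ℤ_[p]) ^ (r + 1) - p * B := by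
  have hb : ∀ k, ∃ b : ℤ_[p], k < r + 1 → (b : ℚ_[p]) = ((bernoulli k : ℚ) : ℚ_[p]) := by
    intro k
    by_cases hk : k < r + 1
    · obtain ⟨b, hb⟩ := aux_bern p k (by omega)
      exact ⟨b, fun _ => hb⟩
    · exact ⟨0, fun h => absurd h hk⟩
  choose b hb using hb
  obtain ⟨x, hx⟩ := aux_unit p (r + 2) (by omega) (by omega)
  have hx' := congrArg (fun z : ℤ_[p] => (z : ℚ_[p])) hx
  simp only [PadicInt.coe_mul, PadicInt.coe_one, PadicInt.coe_natCast] at hx'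
  have hne : ((r + 2 : ℕ) : ℚ_[p]) ≠ 0 := by exact_mod_cast (by omega : r + 2 ≠ 0)
  have h0 : ∑ k ∈ Icc 1 (p - 1), (k : ℤ_[p]) ^ (r + 1) = ∑ k ∈ range p, (k : ℤ_[p]) ^ (r + 1) := by
    obtain ⟨s, rfl⟩ : ∃ s, p = s + 1 := ⟨p - 1, by omega⟩
    rw [sum_range_succ', ← Finset.Ico_add_one_right_eq_Icc, sum_Ico_eq_sum_range]
    simp [add_comm]
  rw [h0]
  refine ⟨∑ i ∈ range (r + 1), b i * ((r + 2).choose i : ℤ_[p]) * (p : ℤ_[p]) ^ (r - i) * x, ?_⟩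
  apply PadicInt.ext
  have h := congrArg (Rat.cast : ℚ → ℚ_[p]) (sum_range_pow p (r + 1))
  rw [sum_range_succ] at h
  push_cast at h hne hx'
  have hne' : (r : ℚ_[p]) + 1 + 1 ≠ 0 := by rw [add_assoc]; norm_num; exact hne
  simp only [PadicInt.coe_sub, PadicInt.coe_sum, PadicInt.coe_mul, PadicInt.coe_pow,
    PadicInt.coe_natCast]
  rw [h, hB, mul_sum]
  have e : ∀ i ∈ range (r + 1), ((bernoulli i : ℚ) : ℚ_[p]) * ((r + 1 + 1).choose i : ℚ_[p])
      * (p : ℚ_[p]) ^ (r + 1 + 1 - i) / ((r : ℚ_[p]) + 1 + 1)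
      = (p : ℚ_[p]) ^ 2 * ((b i : ℚ_[p]) * ((r + 2).choose i : ℚ_[p]) * (p : ℚ_[p]) ^ (r - i) * x) := by
    intro i hi
    have hi := mem_range.1 hi
    rw [hb i hi, show r + 1 + 1 - i = (r - i) + 2 by omega, div_eq_iff hne', pow_add]
    linear_combination -((bernoulli i : ℚ) : ℚ_[p]) * ((r + 2).choose i : ℚ_[p])
      * (p : ℚ_[p]) ^ (r - i) * (p : ℚ_[p]) ^ 2 * hx'
  rw [sum_congr rfl e, Nat.choose_succ_self_right, show r + 1 - r = 1 by omega]
  refine (add_sub_assoc _ _ _).trans (add_eq_left.2 ?_)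
  push_cast
  rw [sub_eq_zero, div_eq_iff hne']
  ring

theorem double_sum_jk (p : ℕ) [Fact p.Prime] (h5 : 5 ≤ p) :
    ‖(((∑ k ∈ (Finset.Icc 1 (p - 1)).filter (fun k => Even k),
          ∑ j ∈ Finset.Icc 1 (k - 1), (1 : ℚ) / (j * k))
        - ((1 / 2) * (((2 ^ (p - 1) - 1 : ℚ) / p) ^ 2 - (p : ℚ) * ((2 ^ (p - 1) - 1 : ℚ) / p) ^ 3)
          - (7 / 16) * (p : ℚ) * bernoulli (p - 3)) : ℚ) : ℚ_[p])‖
      ≤ (p : ℝ) ^ (-(2 : ℤ)) := by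
  have hp : p.Prime := Fact.out
  obtain ⟨m, hm⟩ : ∃ m, p = 2 * m + 1 := by
    rcases hp.eq_two_or_odd' with h | ⟨m, h⟩
    · omega
    · exact ⟨m, h⟩
  obtain ⟨r, hr⟩ : ∃ r, 2 * m = r + 3 := ⟨2 * m - 3, by omega⟩
  have hpm : p - 1 = 2 * m := by omega
  have hu : ∀ k, ∃ x : ℤ_[p], 1 ≤ k → k ≤ 2 * m → (k : ℤ_[p]) * x = 1 := by
    intro k
    by_cases hk : 1 ≤ k ∧ k ≤ 2 * m
    · obtain ⟨x, hx⟩ := aux_unit p k hk.1 (by omega)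
      exact ⟨x, fun _ _ => hx⟩
    · exact ⟨0, fun h1 h2 => absurd ⟨h1, h2⟩ hk⟩
  choose u hu using hu
  have huc : ∀ k, 1 ≤ k → k ≤ 2 * m → (u k : ℚ_[p]) = 1 / (k : ℚ_[p]) := by
    intro k h1 h2
    have h := congrArg (fun z : ℤ_[p] => (z : ℚ_[p])) (hu k h1 h2)
    simp only [PadicInt.coe_mul, PadicInt.coe_one, PadicInt.coe_natCast] at h
    exact eq_one_div_of_mul_eq_one_right h
  have hfer : ∀ k, 1 ≤ k → k ≤ 2 * m → (p : ℤ_[p]) ∣ (k : ℤ_[p]) ^ (2 * m) - 1 := by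
    intro k h1 h2
    have hc : IsCoprime (k : ℤ) p :=
      Nat.isCoprime_iff_coprime.2 (Nat.coprime_of_lt_prime (by omega) (by omega) hp).symm
    have h := (Int.ModEq.pow_card_sub_one_eq_one hp hc).symm.dvd
    rw [hpm] at h
    have h' := map_dvd (Int.castRingHom ℤ_[p]) h
    simpa using h'
  obtain ⟨q, hq⟩ := hfer 2 (by omega) (by omega)
  obtain ⟨B, hB⟩ := aux_bern p (r + 1) (by omega)
  have hY := aux_faul p r (by omega) B hB
  rw [hpm] at hY
  have hP : (p : ℤ_[p]) ≠ 0 := by exact_mod_cast hp.ne_zero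
  have hP' : (p : ℚ_[p]) ≠ 0 := by exact_mod_cast hp.ne_zero
  obtain ⟨c, hc⟩ := aux_main m r hr u q B (p : ℤ_[p]) (by rw [← hm]) hP hu
    (by push_cast at hq; linear_combination hq) hfer hY
  have hqc : (2 ^ (2 * m) - 1 : ℚ_[p]) / p = q := by
    rw [div_eq_iff hP']
    have h := congrArg (fun z : ℤ_[p] => (z : ℚ_[p])) hq
    simp only [PadicInt.coe_mul, PadicInt.coe_one, PadicInt.coe_natCast, PadicInt.coe_sub,
      PadicInt.coe_pow] at h
    push_cast at h
    rw [h]; ring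
  have h2 : (u 2 : ℚ_[p]) = 1 / 2 := by
    have := huc 2 (by omega) (by omega)
    exact_mod_cast this
  have hS : ((∑ k ∈ (Finset.Icc 1 (2 * m)).filter (fun k => Even k),
        ∑ j ∈ Finset.Icc 1 (k - 1), u j * u k : ℤ_[p]) : ℚ_[p])
      = ∑ k ∈ (Finset.Icc 1 (2 * m)).filter (fun k => Even k),
        ∑ j ∈ Finset.Icc 1 (k - 1), (1 : ℚ_[p]) / (j * k) := by
    rw [PadicInt.coe_sum]
    refine sum_congr rfl fun k hk => ?_
    simp only [mem_filter, mem_Icc] at hk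
    rw [PadicInt.coe_sum]
    refine sum_congr rfl fun j hj => ?_
    simp only [mem_Icc] at hj
    rw [PadicInt.coe_mul, huc j (by omega) (by omega), huc k (by omega) (by omega),
      one_div_mul_one_div]
  have hfin := congrArg (fun z : ℤ_[p] => (z : ℚ_[p])) hc
  simp only [PadicInt.coe_sub] at hfin
  rw [hS] at hfin
  simp only [PadicInt.coe_mul, PadicInt.coe_natCast, PadicInt.coe_sub,
      PadicInt.coe_pow, h2, hB] at hfin
  have h7 : ((7 : ℤ_[p]) : ℚ_[p]) = 7 := rfl
  rw [h7] at hfin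
  rw [hpm, show p - 3 = r + 1 by omega]
  have hgoal : (((∑ k ∈ (Finset.Icc 1 (2 * m)).filter (fun k => Even k),
          ∑ j ∈ Finset.Icc 1 (k - 1), (1 : ℚ) / (j * k))
        - ((1 / 2) * (((2 ^ (2 * m) - 1 : ℚ) / p) ^ 2 - (p : ℚ) * ((2 ^ (2 * m) - 1 : ℚ) / p) ^ 3)
          - (7 / 16) * (p : ℚ) * bernoulli (r + 1)) : ℚ) : ℚ_[p])
      = (((p : ℤ_[p]) ^ 2 * c : ℤ_[p]) : ℚ_[p]) := by
    push_cast
    rw [hqc, ← hfin]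
    ring
  rw [hgoal, PadicInt.padic_norm_e_of_padicInt, norm_mul, PadicInt.norm_p_pow]
  have := PadicInt.norm_le_one c
  have h0 : (0 : ℝ) ≤ (p : ℝ) ^ (-(2 : ℕ) : ℤ) := by positivity
  exact mul_le_of_le_one_right h0 this
end
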